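/- Let d > 4. There exist β0 > 0 and constants c, C > 0 such that for all β ∈ (0, β0] and all integers r ≥ 3, setting ζ = z_c(1 − V^{−1/2}): χ^𝕋(z) ≠ 0 for all z ∈ ℂ with |z| ≤ ζ; and the function φ(z) = 1/χ^𝕋(z) satisfies |φ'(z) + 2d| ≤ C β for all |z| ≤ ζ and |φ(z)| ≥ c |1 − z/ζ| for all |z| ≤ ζ. -/

import Mathlib

open scoped BigOperators

/-- A unit step in `ℤ^d`: a coordinate direction together with a sign. -/
def wsawStep (d : ℕ) (e : Fin d × Bool) : Fin d → ℤ :=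
  fun i => if i = e.1 then (if e.2 then 1 else -1) else 0

/-- The position after `k` steps of the walk on `ℤ^d` with step sequence `s`.
(An `n`-step nearest-neighbour walk on `ℤ^d` started at `0` is the same thing as a
sequence of `n` unit steps.) -/
def wsawPos {d n : ℕ} (s : Fin n → Fin d × Bool) (k : ℕ) : Fin d → ℤ :=
  ∑ j ∈ Finset.univ.filter (fun j : Fin n => (j : ℕ) < k), wsawStep d (s j)

/-- The weakly self-avoiding walk weight `∏_{0 ≤ s < t ≤ n} (1 + β U_{st}(ω))`
of the `ℤ^d` walk with step sequence `s`. -/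
noncomputable def wsawWeight {d : ℕ} (β : ℝ) (n : ℕ) (s : Fin n → Fin d × Bool) : ℝ :=
  ∏ p ∈ (Finset.range (n + 1) ×ˢ Finset.range (n + 1)).filter (fun p => p.1 < p.2),
    (1 + β * (if wsawPos s p.1 = wsawPos s p.2 then (-1 : ℝ) else 0))

/-- The two-point partition function `c_n(x)` on `ℤ^d`. -/
noncomputable def cZx (d : ℕ) (β : ℝ) (n : ℕ) (x : Fin d → ℤ) : ℝ :=
  ∑ s ∈ Finset.univ.filter (fun s : Fin n → Fin d × Bool => wsawPos s n = x),
    wsawWeight β n s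

/-- The partition function `c_n = Σ_x c_n(x)` on `ℤ^d`. -/
noncomputable def cZ (d : ℕ) (β : ℝ) (n : ℕ) : ℝ :=
  ∑ s : Fin n → Fin d × Bool, wsawWeight β n s

/-- The position after `k` steps of the torus walk with step sequence `s`:
the mod-`r` projection of the `ℤ^d` position (for `r ≥ 3`, `n`-step torus walks
started at `0` correspond bijectively to step sequences). -/
def wsawPosT {d : ℕ} (r : ℕ) {n : ℕ} (s : Fin n → Fin d × Bool) (k : ℕ) : Fin d → ZMod r :=
  fun i => ((wsawPos s k i : ℤ) : ZMod r)

/-- The weakly self-avoiding walk weight of the torus walk with step sequence `s`. -/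
noncomputable def wsawWeightT {d : ℕ} (r : ℕ) (β : ℝ) (n : ℕ) (s : Fin n → Fin d × Bool) : ℝ :=
  ∏ p ∈ (Finset.range (n + 1) ×ˢ Finset.range (n + 1)).filter (fun p => p.1 < p.2),
    (1 + β * (if wsawPosT r s p.1 = wsawPosT r s p.2 then (-1 : ℝ) else 0))

/-- The torus partition function `c_n^𝕋`. -/
noncomputable def cT (d r : ℕ) (β : ℝ) (n : ℕ) : ℝ :=
  ∑ s : Fin n → Fin d × Bool, wsawWeightT r β n s

/-- `μ` is the growth constant: `μ = lim_{n→∞} c_n^{1/n}`. -/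
def HasGrowthConst (d : ℕ) (β μ : ℝ) : Prop :=
  Filter.Tendsto (fun n : ℕ => (cZ d β n) ^ ((n : ℝ)⁻¹)) Filter.atTop (nhds μ)

/-- The susceptibility `χ(z)` on `ℤ^d`, for complex `z`. -/
noncomputable def chi (d : ℕ) (β : ℝ) (z : ℂ) : ℂ := ∑' n : ℕ, (cZ d β n : ℂ) * z ^ n

/-- The susceptibility `χ(z)` on `ℤ^d`, for real `z`. -/
noncomputable def chiR (d : ℕ) (β : ℝ) (z : ℝ) : ℝ := ∑' n : ℕ, cZ d β n * z ^ n

/-- The torus susceptibility `χ^𝕋(z)`, for complex `z`. -/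
noncomputable def chiT (d r : ℕ) (β : ℝ) (z : ℂ) : ℂ := ∑' n : ℕ, (cT d r β n : ℂ) * z ^ n

/-- The torus susceptibility `χ^𝕋(z)`, for real `z`. -/
noncomputable def chiTR (d r : ℕ) (β : ℝ) (z : ℝ) : ℝ := ∑' n : ℕ, cT d r β n * z ^ n

/-- The sup norm `‖x‖_∞` of `x ∈ ℤ^d`, as a real number. -/
noncomputable def nInf {d : ℕ} (x : Fin d → ℤ) : ℝ :=
  ((Finset.univ.sup fun i => (x i).natAbs : ℕ) : ℝ)

/-- `⟨x⟩ = max {1, ‖x‖_∞}`. -/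
noncomputable def vee {d : ℕ} (x : Fin d → ℤ) : ℝ := max 1 (nInf x)

/-- The two-point function `G_z(x) = Σ_n c_n(x) z^n` on `ℤ^d`. -/
noncomputable def Gpt (d : ℕ) (β z : ℝ) (x : Fin d → ℤ) : ℝ := ∑' n : ℕ, cZx d β n x * z ^ n

/-- The bubble diagram `B_z = G_z * G_z`. -/
noncomputable def Bpt (d : ℕ) (β z : ℝ) (x : Fin d → ℤ) : ℝ :=
  ∑' y : Fin d → ℤ, Gpt d β z (x - y) * Gpt d β z y

/-- The triangle diagram `T_z = G_z * G_z * G_z`. -/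
noncomputable def Tpt (d : ℕ) (β z : ℝ) (x : Fin d → ℤ) : ℝ :=
  ∑' y : Fin d → ℤ, Bpt d β z (x - y) * Gpt d β z y

/-- The representative in `[-r/2, r/2) ∩ ℤ` of `x ∈ ℤ/rℤ`. -/
def repC (r : ℕ) (x : ZMod r) : ℤ :=
  if 2 * (x.val : ℤ) < (r : ℤ) then (x.val : ℤ) else (x.val : ℤ) - (r : ℤ)

section laceExpansion

open Finset

/-- The product of the weights `u s t` over all pairs `a ≤ s < t ≤ b`. -/
noncomputable def pairProd (u : ℕ → ℕ → ℝ) (a b : ℕ) : ℝ :=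
  ∏ t ∈ Ioc a b, ∏ s ∈ Ico a t, u s t

/-- The lace kernel: `laceKer u a b m` is the contribution to `pairProd u a n` in which `m` is the
right end of the connected cluster of the interval `[a, b]`. -/
noncomputable def laceKer (u : ℕ → ℕ → ℝ) (a b m : ℕ) : ℝ :=
  if m = b then pairProd u a b
  else ∑ t ∈ (Ioc b m).attach, ((∏ s ∈ Ico a b, u s t.1) - 1) *
    (∏ t' ∈ Ioo b t.1, ∏ s ∈ Ico a b, u s t') * pairProd u a b * laceKer u b t.1 m
termination_by m - b
decreasing_by
  have := Finset.mem_Ioc.1 t.2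
  omega

theorem laceKer_self (u : ℕ → ℕ → ℝ) (a b : ℕ) : laceKer u a b b = pairProd u a b := by
  rw [laceKer, if_pos rfl]

theorem laceKer_of_ne (u : ℕ → ℕ → ℝ) {a b m : ℕ} (h : m ≠ b) :
    laceKer u a b m = ∑ t ∈ Ioc b m, ((∏ s ∈ Ico a b, u s t) - 1) *
      (∏ t' ∈ Ioo b t, ∏ s ∈ Ico a b, u s t') * pairProd u a b * laceKer u b t m := by
  rw [laceKer, if_neg h]
  exact Finset.sum_attach (Ioc b m) (fun t => ((∏ s ∈ Ico a b, u s t) - 1) *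
      (∏ t' ∈ Ioo b t, ∏ s ∈ Ico a b, u s t') * pairProd u a b * laceKer u b t m)

theorem pairProd_split (u : ℕ → ℕ → ℝ) {a b n : ℕ} (hab : a ≤ b) (hbn : b ≤ n) :
    pairProd u a n = pairProd u a b * pairProd u b n * ∏ t ∈ Ioc b n, ∏ s ∈ Ico a b, u s t := by
  unfold pairProd
  rw [← Finset.prod_Ioc_consecutive _ hab hbn, mul_assoc, ← Finset.prod_mul_distrib]
  congr 1
  refine Finset.prod_congr rfl fun t ht => ?_
  rw [Finset.mem_Ioc] at ht
  rw [mul_comm, Finset.prod_Ico_consecutive _ hab ht.1.le]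

theorem prod_Ioc_eq_one_add (v : ℕ → ℝ) {b n : ℕ} (h : b ≤ n) :
    ∏ t ∈ Ioc b n, v t = 1 + ∑ t ∈ Ioc b n, (v t - 1) * ∏ t' ∈ Ioo b t, v t' := by
  induction n, h using Nat.le_induction with
  | base => simp
  | succ n hn ih =>
    rw [Finset.prod_Ioc_succ_top (by omega), Finset.sum_Ioc_succ_top (by omega), ← add_assoc, ← ih]
    have : Ioo b (n + 1) = Ioc b n := by ext; simp
    rw [this]; ring

theorem pairProd_eq_sum_laceKer (u : ℕ → ℕ → ℝ) {a b n : ℕ} (hab : a ≤ b) (hbn : b ≤ n) :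
    pairProd u a n = ∑ m ∈ Icc b n, laceKer u a b m * pairProd u m n := by
  induction hk : n - b using Nat.strong_induction_on generalizing a b with
  | _ k ih =>
    rw [pairProd_split u hab hbn, prod_Ioc_eq_one_add _ hbn, mul_add, mul_one, Finset.mul_sum]
    rw [← Finset.add_sum_Ioc_eq_sum_Icc hbn, laceKer_self]
    congr 1
    have h1 : ∀ m ∈ Ioc b n, laceKer u a b m * pairProd u m n =
        ∑ t ∈ Ioc b m, ((∏ s ∈ Ico a b, u s t) - 1) *
      (∏ t' ∈ Ioo b t, ∏ s ∈ Ico a b, u s t') * pairProd u a b *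
        (laceKer u b t m * pairProd u m n) := by
      intro m hm
      rw [laceKer_of_ne u (by rw [mem_Ioc] at hm; omega), Finset.sum_mul]
      exact Finset.sum_congr rfl fun _ _ => by ring
    rw [Finset.sum_congr rfl h1, Finset.sum_comm' (t' := Ioc b n) (s' := fun t => Icc t n)
      (by intro x y; simp only [mem_Ioc, mem_Icc]; omega)]
    refine Finset.sum_congr rfl fun t ht => ?_
    rw [mem_Ioc] at ht
    rw [← Finset.mul_sum, ← ih (n - t) (by omega) ht.1.le ht.2 rfl]
    ring

theorem pairProd_nonneg {u : ℕ → ℕ → ℝ} (h0 : ∀ s t, 0 ≤ u s t) (a b : ℕ) : 0 ≤ pairProd u a b :=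
  Finset.prod_nonneg fun _ _ => Finset.prod_nonneg fun _ _ => h0 _ _

theorem pairProd_le_mul {u : ℕ → ℕ → ℝ} (h0 : ∀ s t, 0 ≤ u s t) (h1 : ∀ s t, u s t ≤ 1)
    {a b n : ℕ} (hab : a ≤ b) (hbn : b ≤ n) :
    pairProd u a n ≤ pairProd u a b * pairProd u b n := by
  rw [pairProd_split u hab hbn]
  refine mul_le_of_le_one_right (mul_nonneg (pairProd_nonneg h0 _ _) (pairProd_nonneg h0 _ _)) ?_
  exact Finset.prod_le_one (fun _ _ => Finset.prod_nonneg fun _ _ => h0 _ _)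
    fun _ _ => Finset.prod_le_one (fun _ _ => h0 _ _) fun _ _ => h1 _ _

theorem one_sub_prod_le_sum {u : ℕ → ℕ → ℝ} (h0 : ∀ s t, 0 ≤ u s t) (h1 : ∀ s t, u s t ≤ 1)
    (S : Finset ℕ) (t : ℕ) :
    1 - ∏ s ∈ S, u s t ≤ ∑ s ∈ S, (1 - u s t) := by
  classical
  induction S using Finset.induction_on with
  | empty => simp
  | insert a S ha ih =>
    rw [Finset.prod_insert ha, Finset.sum_insert ha]
    have hp : ∏ s ∈ S, u s t ≤ 1 := Finset.prod_le_one (fun _ _ => h0 _ _) fun _ _ => h1 _ _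
    nlinarith [h0 a t, h1 a t]

theorem abs_laceKer_le {u : ℕ → ℕ → ℝ} (h0 : ∀ s t, 0 ≤ u s t) (h1 : ∀ s t, u s t ≤ 1)
    {a b m : ℕ} (h : m ≠ b) :
    |laceKer u a b m| ≤ ∑ t ∈ Ioc b m, ∑ s ∈ Ico a b,
      (1 - u s t) * pairProd u a s * pairProd u s b * |laceKer u b t m| := by
  rw [laceKer_of_ne u h]
  refine (Finset.abs_sum_le_sum_abs _ _).trans (Finset.sum_le_sum fun t _ => ?_)
  have hp : ∏ s ∈ Ico a b, u s t ≤ 1 := Finset.prod_le_one (fun _ _ => h0 _ _) fun _ _ => h1 _ _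
  have hq0 : 0 ≤ ∏ t' ∈ Ioo b t, ∏ s ∈ Ico a b, u s t' :=
    Finset.prod_nonneg fun _ _ => Finset.prod_nonneg fun _ _ => h0 _ _
  have hq1 : ∏ t' ∈ Ioo b t, ∏ s ∈ Ico a b, u s t' ≤ 1 :=
    Finset.prod_le_one (fun _ _ => Finset.prod_nonneg fun _ _ => h0 _ _)
    fun _ _ => Finset.prod_le_one (fun _ _ => h0 _ _) fun _ _ => h1 _ _
  have hK := pairProd_nonneg h0 a b
  rw [abs_mul, abs_mul, abs_mul, abs_of_nonneg hK, abs_of_nonneg hq0, abs_sub_comm,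
    abs_of_nonneg (sub_nonneg.2 hp), ← Finset.sum_mul]
  refine mul_le_mul_of_nonneg_right ?_ (abs_nonneg _)
  calc _ ≤ (1 - ∏ s ∈ Ico a b, u s t) * 1 * pairProd u a b := by
        refine mul_le_mul_of_nonneg_right ?_ hK
        exact mul_le_mul_of_nonneg_left hq1 (sub_nonneg.2 hp)
    _ ≤ (∑ s ∈ Ico a b, (1 - u s t)) * pairProd u a b := by
        rw [mul_one]
        exact mul_le_mul_of_nonneg_right (one_sub_prod_le_sum h0 h1 _ _) hK
    _ ≤ _ := by
        rw [Finset.sum_mul]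
        refine Finset.sum_le_sum fun s hs => ?_
        rw [mem_Ico] at hs
        rw [mul_assoc]
        exact mul_le_mul_of_nonneg_left (pairProd_le_mul h0 h1 hs.1 hs.2.le)
          (sub_nonneg.2 (h1 _ _))

theorem pairProd_congr {u v : ℕ → ℕ → ℝ} {a b : ℕ}
    (h : ∀ s t, a ≤ s → s < t → t ≤ b → u s t = v s t) : pairProd u a b = pairProd v a b := by
  refine Finset.prod_congr rfl fun t ht => Finset.prod_congr rfl fun s hs => ?_
  rw [mem_Ioc] at ht; rw [mem_Ico] at hs
  exact h s t hs.1 hs.2 ht.2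

theorem laceKer_congr {u v : ℕ → ℕ → ℝ} {a b m : ℕ} (hab : a ≤ b) (hbm : b ≤ m)
    (h : ∀ s t, a ≤ s → s < t → t ≤ m → u s t = v s t) : laceKer u a b m = laceKer v a b m := by
  induction hk : m - b using Nat.strong_induction_on generalizing a b with
  | _ k ih =>
    have hK : pairProd u a b = pairProd v a b :=
      pairProd_congr fun s t h1 h2 h3 => h s t h1 h2 (h3.trans hbm)
    rcases eq_or_ne m b with rfl | hne
    · rw [laceKer_self, laceKer_self, hK]
    rw [laceKer_of_ne u hne, laceKer_of_ne v hne]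
    refine Finset.sum_congr rfl fun t ht => ?_
    rw [mem_Ioc] at ht
    have h1 : ∀ t', b < t' → t' ≤ m → ∏ s ∈ Ico a b, u s t' = ∏ s ∈ Ico a b, v s t' := by
      intro t' h1 h2
      refine Finset.prod_congr rfl fun s hs => ?_
      rw [mem_Ico] at hs
      exact h s t' hs.1 (hs.2.trans h1) h2
    rw [h1 t ht.1 ht.2, hK, ih (m - t) (by omega) ht.1.le ht.2
      (fun s t' h1 h2 h3 => h s t' (hab.trans h1) h2 h3) rfl]
    congr 3
    refine Finset.prod_congr rfl fun t' ht' => ?_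
    rw [mem_Ioo] at ht'
    exact h1 t' ht'.1 (ht'.2.le.trans ht.2)

theorem pairProd_shift (u : ℕ → ℕ → ℝ) (c a b : ℕ) :
    pairProd u (c + a) (c + b) = pairProd (fun s t => u (c + s) (c + t)) a b := by
  unfold pairProd
  rw [← Finset.image_add_left_Ioc, Finset.prod_image (by simp)]
  refine Finset.prod_congr rfl fun t _ => ?_
  rw [← Finset.image_add_left_Ico, Finset.prod_image (by simp)]

theorem laceKer_shift (u : ℕ → ℕ → ℝ) (c a b m : ℕ) :
    laceKer u (c + a) (c + b) (c + m) = laceKer (fun s t => u (c + s) (c + t)) a b m := by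
  induction hk : m - b using Nat.strong_induction_on generalizing a b with
  | _ k ih =>
    rcases eq_or_ne m b with rfl | hne
    · rw [laceKer_self, laceKer_self, pairProd_shift]
    rw [laceKer_of_ne _ (by omega : c + m ≠ c + b), laceKer_of_ne _ hne,
      ← Finset.image_add_left_Ioc, Finset.sum_image (by simp)]
    refine Finset.sum_congr rfl fun t ht => ?_
    rw [mem_Ioc] at ht
    have h1 : ∀ t', ∏ s ∈ Ico (c + a) (c + b), u s (c + t') =
        ∏ s ∈ Ico a b, u (c + s) (c + t') := by
      intro t'
      rw [← Finset.image_add_left_Ico, Finset.prod_image (by simp)]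
    rw [h1, ih (m - t) (by omega) b t rfl, pairProd_shift, ← Finset.image_add_left_Ioo,
      Finset.prod_image (by simp)]
    simp only [h1]

/-- Position after `k` steps of the walk with steps `e (s j)` in an abelian group. -/
def walkPos {Λ E : Type*} [AddCommGroup Λ] (e : E → Λ) {n : ℕ} (s : Fin n → E) (k : ℕ) : Λ :=
  ∑ j ∈ univ.filter (fun j : Fin n => (j : ℕ) < k), e (s j)

/-- The interaction of the times `s` and `t` along `ω`. -/
noncomputable def selfInt {Λ : Type*} [DecidableEq Λ] (β : ℝ) (ω : ℕ → Λ) (s t : ℕ) : ℝ :=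
  if ω s = ω t then 1 - β else 1

/-- Sum of a functional over all `n`-step walks from the origin, each step having weight `z`. -/
noncomputable def walkSum {Λ E : Type*} [AddCommGroup Λ] [Fintype E] (e : E → Λ) (z : ℝ)
    (n : ℕ) (F : (ℕ → Λ) → ℝ) : ℝ :=
  z ^ n * ∑ s : Fin n → E, F (walkPos e s)

section walks
variable {Λ E : Type*} [AddCommGroup Λ] [Fintype E] (e : E → Λ)

theorem walkPos_zero {n : ℕ} (s : Fin n → E) : walkPos e s 0 = 0 := by
  simp [walkPos]

theorem walkPos_of_le {n : ℕ} (s : Fin n → E) {k : ℕ} (h : n ≤ k) :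
    walkPos e s k = walkPos e s n := by
  unfold walkPos
  congr 1
  ext j
  simp only [mem_filter, mem_univ, true_and]
  have := j.2
  omega

theorem walkPos_append {m n : ℕ} (s : Fin m → E) (t : Fin n → E) (k : ℕ) :
    walkPos e (Fin.append s t) k = walkPos e s k + walkPos e t (k - m) := by
  unfold walkPos
  rw [Finset.sum_filter, Finset.sum_filter, Finset.sum_filter, Fin.sum_univ_add]
  simp only [Fin.append_left, Fin.append_right, Fin.val_castAdd, Fin.val_natAdd]
  congr 1
  refine Finset.sum_congr rfl fun j _ => ?_
  congr 1
  exact propext (by omega)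

theorem walkSum_add (z : ℝ) (m n : ℕ) (F : (ℕ → Λ) → ℝ) :
    walkSum e z (m + n) F = walkSum e z m fun ω₁ => walkSum e z n fun ω₂ =>
      F fun k => ω₁ k + ω₂ (k - m) := by
  unfold walkSum
  rw [← (Fin.appendEquiv m n).sum_comp, Fintype.sum_prod_type, ← Finset.mul_sum, ← mul_assoc,
    pow_add]
  congr 1
  refine Finset.sum_congr rfl fun s _ => Finset.sum_congr rfl fun t _ => ?_
  congr 1
  funext k
  exact walkPos_append e s t k

theorem walkSum_congr (z : ℝ) (n : ℕ) {F G : (ℕ → Λ) → ℝ}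
    (h : ∀ ω : ℕ → Λ, ω 0 = 0 → (∀ k, n ≤ k → ω k = ω n) → F ω = G ω) :
    walkSum e z n F = walkSum e z n G := by
  unfold walkSum
  congr 1
  exact Finset.sum_congr rfl fun s _ => h _ (walkPos_zero e s) fun k hk => walkPos_of_le e s hk

theorem walkSum_mono {z : ℝ} (hz : 0 ≤ z) (n : ℕ) {F G : (ℕ → Λ) → ℝ}
    (h : ∀ ω : ℕ → Λ, ω 0 = 0 → (∀ k, n ≤ k → ω k = ω n) → F ω ≤ G ω) :
    walkSum e z n F ≤ walkSum e z n G := by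
  unfold walkSum
  refine mul_le_mul_of_nonneg_left ?_ (pow_nonneg hz n)
  exact Finset.sum_le_sum fun s _ => h _ (walkPos_zero e s) fun k hk => walkPos_of_le e s hk

theorem walkSum_nonneg {z : ℝ} (hz : 0 ≤ z) (n : ℕ) {F : (ℕ → Λ) → ℝ}
    (h : ∀ ω : ℕ → Λ, 0 ≤ F ω) : 0 ≤ walkSum e z n F :=
  mul_nonneg (pow_nonneg hz n) (Finset.sum_nonneg fun _ _ => h _)

theorem walkSum_sum {ι : Type*} (S : Finset ι) (z : ℝ) (n : ℕ) (F : ι → (ℕ → Λ) → ℝ) :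
    walkSum e z n (fun ω => ∑ i ∈ S, F i ω) = ∑ i ∈ S, walkSum e z n (F i) := by
  unfold walkSum
  rw [Finset.sum_comm, Finset.mul_sum]

theorem walkSum_const_mul (c z : ℝ) (n : ℕ) (F : (ℕ → Λ) → ℝ) :
    walkSum e z n (fun ω => c * F ω) = c * walkSum e z n F := by
  unfold walkSum
  rw [← Finset.mul_sum]; ring

theorem walkSum_mul_const (c z : ℝ) (n : ℕ) (F : (ℕ → Λ) → ℝ) :
    walkSum e z n (fun ω => F ω * c) = walkSum e z n F * c := by
  unfold walkSum
  rw [← Finset.sum_mul]; ring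

theorem walkSum_zero (z : ℝ) (F : (ℕ → Λ) → ℝ) : walkSum e z 0 F = F 0 := by
  unfold walkSum
  rw [Fintype.sum_unique]
  simp only [pow_zero, one_mul]
  congr 1

theorem walkSum_eq_pow_mul (z : ℝ) (n : ℕ) (F : (ℕ → Λ) → ℝ) :
    walkSum e z n F = z ^ n * walkSum e 1 n F := by
  simp [walkSum]

variable [DecidableEq Λ]

/-- Two-point function of `n`-step walks, each step having weight `z`. -/
noncomputable def twoPt (β z : ℝ) (n : ℕ) (x : Λ) : ℝ :=
  walkSum e z n fun ω => if ω n = x then pairProd (selfInt β ω) 0 n else 0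

/-- The weighted absolute sum of the lace kernel over walks passing through `x` at time `b`. -/
noncomputable def laceAt (β z : ℝ) (w : ℕ → Λ → ℝ) (m b : ℕ) (x : Λ) : ℝ :=
  walkSum e z m fun ω => if ω b = x then |laceKer (selfInt β ω) 0 b m| * w m (ω m) else 0

/-- The sum of `laceAt` over all intermediate times. -/
noncomputable def laceSum (β z : ℝ) (w : ℕ → Λ → ℝ) (m : ℕ) (x : Λ) : ℝ :=
  ∑ b ∈ Icc 1 m, laceAt e β z w m b x

theorem selfInt_nonneg {β : ℝ} (hβ : β ≤ 1) (ω : ℕ → Λ) (s t : ℕ) : 0 ≤ selfInt β ω s t := by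
  unfold selfInt; split_ifs <;> linarith

theorem selfInt_le_one {β : ℝ} (hβ : 0 ≤ β) (ω : ℕ → Λ) (s t : ℕ) : selfInt β ω s t ≤ 1 := by
  unfold selfInt; split_ifs <;> linarith

theorem selfInt_concat_left (β : ℝ) {m : ℕ} {ω₁ ω₂ : ℕ → Λ} (h₂ : ω₂ 0 = 0) {s t : ℕ}
    (hs : s ≤ m) (ht : t ≤ m) :
    selfInt β (fun k => ω₁ k + ω₂ (k - m)) s t = selfInt β ω₁ s t := by
  simp [selfInt, Nat.sub_eq_zero_of_le hs, Nat.sub_eq_zero_of_le ht, h₂]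

theorem selfInt_concat_right (β : ℝ) {m : ℕ} {ω₁ ω₂ : ℕ → Λ} (h₁ : ∀ k, m ≤ k → ω₁ k = ω₁ m)
    (s t : ℕ) : selfInt β (fun k => ω₁ k + ω₂ (k - m)) (m + s) (m + t) = selfInt β ω₂ s t := by
  simp [selfInt, h₁ (m + s) (by omega), h₁ (m + t) (by omega)]

theorem pairProd_concat_left (β : ℝ) {m : ℕ} {ω₁ ω₂ : ℕ → Λ} (h₂ : ω₂ 0 = 0) {a b : ℕ}
    (hb : b ≤ m) : pairProd (selfInt β (fun k => ω₁ k + ω₂ (k - m))) a b =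
      pairProd (selfInt β ω₁) a b :=
  pairProd_congr fun s t _ hst ht =>
    selfInt_concat_left β h₂ (hst.le.trans (ht.trans hb)) (ht.trans hb)

theorem pairProd_concat_right (β : ℝ) {m : ℕ} {ω₁ ω₂ : ℕ → Λ} (h₁ : ∀ k, m ≤ k → ω₁ k = ω₁ m)
    (a b : ℕ) : pairProd (selfInt β (fun k => ω₁ k + ω₂ (k - m))) (m + a) (m + b) =
      pairProd (selfInt β ω₂) a b := by
  rw [pairProd_shift]
  exact pairProd_congr fun s t _ _ _ => selfInt_concat_right β h₁ s t

theorem laceKer_concat_left (β : ℝ) {m : ℕ} {ω₁ ω₂ : ℕ → Λ} (h₂ : ω₂ 0 = 0) {a b c : ℕ}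
    (hab : a ≤ b) (hbc : b ≤ c)
    (hc : c ≤ m) : laceKer (selfInt β (fun k => ω₁ k + ω₂ (k - m))) a b c =
      laceKer (selfInt β ω₁) a b c :=
  laceKer_congr hab hbc fun s t _ hst ht =>
    selfInt_concat_left β h₂ (hst.le.trans (ht.trans hc)) (ht.trans hc)

theorem laceKer_concat_right (β : ℝ) {m : ℕ} {ω₁ ω₂ : ℕ → Λ} (h₁ : ∀ k, m ≤ k → ω₁ k = ω₁ m)
    {a b c : ℕ} (hab : a ≤ b) (hbc : b ≤ c) :
    laceKer (selfInt β (fun k => ω₁ k + ω₂ (k - m))) (m + a) (m + b) (m + c) =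
      laceKer (selfInt β ω₂) a b c := by
  rw [laceKer_shift]
  exact laceKer_congr hab hbc fun s t _ _ _ => selfInt_concat_right β h₁ s t

theorem twoPt_nonneg {β z : ℝ} (hβ : β ≤ 1) (hz : 0 ≤ z) (n : ℕ) (x : Λ) :
    0 ≤ twoPt e β z n x :=
  walkSum_nonneg e hz n fun ω => by
    split_ifs
    · exact pairProd_nonneg (selfInt_nonneg hβ ω) _ _
    · rfl

theorem laceAt_nonneg {β z : ℝ} (hz : 0 ≤ z) {w : ℕ → Λ → ℝ} (hw : ∀ n x, 0 ≤ w n x)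
    (m b : ℕ) (x : Λ) : 0 ≤ laceAt e β z w m b x :=
  walkSum_nonneg e hz m fun ω => by
    split_ifs
    · exact mul_nonneg (abs_nonneg _) (hw _ _)
    · rfl

theorem laceSum_nonneg {β z : ℝ} (hz : 0 ≤ z) {w : ℕ → Λ → ℝ} (hw : ∀ n x, 0 ≤ w n x)
    (m : ℕ) (x : Λ) : 0 ≤ laceSum e β z w m x :=
  Finset.sum_nonneg fun b _ => laceAt_nonneg e hz hw m b x

theorem laceAt_self {β z : ℝ} (hβ : β ≤ 1) (w : ℕ → Λ → ℝ) (m : ℕ) (x : Λ) :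
    laceAt e β z w m m x = twoPt e β z m x * w m x := by
  unfold laceAt twoPt
  rw [← walkSum_mul_const]
  congr 1
  funext ω
  split_ifs with h
  · rw [laceKer_self, abs_of_nonneg (pairProd_nonneg (selfInt_nonneg hβ ω) _ _), h]
  · simp

variable [Fintype Λ]

theorem walkSum_three (β z : ℝ) {i j l t : ℕ} (ht : t ≤ l) (x : Λ) (f g h : Λ → ℝ) :
    walkSum e z (i + j + l) (fun ω => if ω (i + j) = x then
      (1 - selfInt β ω i (i + j + t)) * pairProd (selfInt β ω) 0 i *
        pairProd (selfInt β ω) i (i + j) *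
        |laceKer (selfInt β ω) (i + j) (i + j + t) (i + j + l)| *
        (f (ω i) * g (ω (i + j) - ω i) * h (ω (i + j + l) - ω (i + j))) else 0) =
    β * ∑ y, (twoPt e β z i y * f y) * (twoPt e β z j (x - y) * g (x - y)) *
      laceAt e β z (fun _ => h) l t (y - x) := by
  rw [walkSum_add, walkSum_add, Finset.mul_sum]
  have key : ∀ ω₁ : ℕ → Λ, ω₁ 0 = 0 → (∀ k, i ≤ k → ω₁ k = ω₁ i) →
      ∀ ω₂ : ℕ → Λ, ω₂ 0 = 0 → (∀ k, j ≤ k → ω₂ k = ω₂ j) →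
      ∀ ω₃ : ℕ → Λ, ω₃ 0 = 0 → (∀ k, l ≤ k → ω₃ k = ω₃ l) →
      (fun ω : ℕ → Λ => if ω (i + j) = x then
      (1 - selfInt β ω i (i + j + t)) * pairProd (selfInt β ω) 0 i *
        pairProd (selfInt β ω) i (i + j) *
        |laceKer (selfInt β ω) (i + j) (i + j + t) (i + j + l)| *
        (f (ω i) * g (ω (i + j) - ω i) * h (ω (i + j + l) - ω (i + j))) else 0)
        (fun k => ω₁ k + ω₂ (k - i) + ω₃ (k - (i + j))) =
      ∑ y, β * (((if ω₁ i = y then pairProd (selfInt β ω₁) 0 i else 0) * f y) *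
        (((if ω₂ j = x - y then pairProd (selfInt β ω₂) 0 j else 0) * g (x - y)) *
        (if ω₃ t = y - x then |laceKer (selfInt β ω₃) 0 t l| * h (ω₃ l) else 0))) := by
    intro ω₁ a₁ b₁ ω₂ a₂ b₂ ω₃ a₃ b₃
    have hb : ∀ k, i + j ≤ k → ω₁ k + ω₂ (k - i) = ω₁ (i + j) + ω₂ (i + j - i) := by
      intro k hk
      rw [b₁ k (by omega), b₁ (i + j) (by omega), b₂ (k - i) (by omega), b₂ (i + j - i) (by omega)]
    have e1 := pairProd_concat_left β (ω₁ := fun k => ω₁ k + ω₂ (k - i)) a₃ (a := 0) (b := i)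
      (m := i + j) (by omega)
    have e2 := pairProd_concat_left β (ω₁ := ω₁) a₂ (a := 0) (b := i) (m := i) le_rfl
    have e3 := pairProd_concat_left β (ω₁ := fun k => ω₁ k + ω₂ (k - i)) a₃ (a := i) (b := i + j)
      (m := i + j) le_rfl
    have e4 := pairProd_concat_right β (ω₂ := ω₂) b₁ 0 j
    have e5 := laceKer_concat_right β (ω₂ := ω₃) hb (Nat.zero_le t) ht
    rw [add_zero] at e4 e5
    dsimp only at e1 e2 e3 e4 e5 ⊢
    rw [e1, e2, e3, e4, e5]
    rw [Finset.sum_eq_single (ω₁ i)]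
    · have f1 : ω₁ (i + j) = ω₁ i := b₁ _ (by omega)
      have f2 : ω₁ (i + j + l) = ω₁ i := b₁ _ (by omega)
      have f3 : ω₁ (i + j + t) = ω₁ i := b₁ _ (by omega)
      have f4 : ω₂ (i + j + l - i) = ω₂ j := b₂ _ (by omega)
      have f5 : ω₂ (i + j + t - i) = ω₂ j := b₂ _ (by omega)
      have f6 : ω₂ (i + j - i) = ω₂ j := b₂ _ (by omega)
      have g1 : i - (i + j) = 0 := by omega
      have g2 : i + j + l - (i + j) = l := by omega
      have g3 : i + j + t - (i + j) = t := by omega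
      simp only [selfInt, f1, f2, f3, f4, f5, f6, g1, g2, g3, Nat.sub_self, a₂, a₃, add_zero,
        add_sub_cancel_left, if_true]
      by_cases hx : ω₁ i + ω₂ j = x
      · subst hx
        have c2 : (ω₁ i = ω₁ i + ω₂ j + ω₃ t) ↔ (ω₃ t = ω₁ i - (ω₁ i + ω₂ j)) := by
          constructor
          · intro hh
            rw [eq_sub_iff_add_eq, add_comm]; exact hh.symm
          · intro hh
            rw [hh]; abel
        simp only [c2, if_true, add_sub_cancel_left]
        split_ifs
        · ring
        · simp
      · rw [if_neg hx, if_neg (by rw [eq_sub_iff_add_eq, add_comm]; exact hx)]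
        simp
    · intro y _ hy
      rw [if_neg (Ne.symm hy)]; simp
    · simp
  rw [walkSum_congr e z i (G := fun ω₁ => ∑ y, β * (((if ω₁ i = y then
      pairProd (selfInt β ω₁) 0 i else 0) * f y) * ((twoPt e β z j (x - y) * g (x - y)) *
      laceAt e β z (fun _ => h) l t (y - x))))]
  · rw [walkSum_sum]
    refine Finset.sum_congr rfl fun y _ => ?_
    rw [walkSum_const_mul, walkSum_mul_const, walkSum_mul_const]
    unfold twoPt; ring
  · intro ω₁ a₁ b₁
    rw [walkSum_congr e z j (G := fun ω₂ => ∑ y, β * (((if ω₁ i = y then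
      pairProd (selfInt β ω₁) 0 i else 0) * f y) * (((if ω₂ j = x - y then
      pairProd (selfInt β ω₂) 0 j else 0) * g (x - y)) *
      laceAt e β z (fun _ => h) l t (y - x))))]
    · rw [walkSum_sum]
      refine Finset.sum_congr rfl fun y _ => ?_
      rw [walkSum_const_mul, walkSum_const_mul, walkSum_mul_const, walkSum_mul_const]
      rfl
    · intro ω₂ a₂ b₂
      rw [walkSum_congr e z l (fun ω₃ a₃ b₃ => key ω₁ a₁ b₁ ω₂ a₂ b₂ ω₃ a₃ b₃), walkSum_sum]
      refine Finset.sum_congr rfl fun y _ => ?_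
      rw [walkSum_const_mul, walkSum_const_mul, walkSum_const_mul]
      rfl

end walks

theorem sum_range_conv_le {G : ℕ → ℕ → ℝ} (hG : ∀ i j, 0 ≤ G i j) (M : ℕ) :
    ∑ n ∈ range M, ∑ b ∈ range (n + 1), G b (n - b) ≤ ∑ b ∈ range M, ∑ l ∈ range M, G b l := by
  rw [Finset.sum_comm' (t' := range M) (s' := fun b => Ico b M)
    (by intro x y; simp only [mem_range, mem_Ico]; omega)]
  refine Finset.sum_le_sum fun b _ => ?_
  rw [Finset.sum_Ico_eq_sum_range]
  simp only [Nat.add_sub_cancel_left]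
  exact Finset.sum_le_sum_of_subset_of_nonneg (range_mono (Nat.sub_le _ _)) fun _ _ _ => hG _ _

theorem sum_range_conv_three_le {F : ℕ → ℕ → ℕ → ℝ} (hF : ∀ i j l, 0 ≤ F i j l) (M : ℕ) :
    ∑ n ∈ range M, ∑ b ∈ Icc 1 n, ∑ s ∈ range b, F s (b - s) (n - b) ≤
      ∑ s ∈ range M, ∑ j ∈ range M, ∑ l ∈ range M, F s j l := by
  calc _ ≤ ∑ n ∈ range M, ∑ b ∈ range (n + 1), ∑ s ∈ range (b + 1), F s (b - s) (n - b) := by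
        refine Finset.sum_le_sum fun n _ => ?_
        refine (Finset.sum_le_sum fun b _ => ?_).trans (Finset.sum_le_sum_of_subset_of_nonneg
          (s := Icc 1 n) ?_ ?_)
        · exact Finset.sum_le_sum_of_subset_of_nonneg (range_mono (Nat.le_succ _))
            fun _ _ _ => hF _ _ _
        · intro b; simp only [mem_Icc, mem_range]; omega
        · exact fun _ _ _ => Finset.sum_nonneg fun _ _ => hF _ _ _
    _ ≤ ∑ b ∈ range M, ∑ l ∈ range M, ∑ s ∈ range (b + 1), F s (b - s) l :=
        sum_range_conv_le (G := fun b l => ∑ s ∈ range (b + 1), F s (b - s) l)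
          (fun _ _ => Finset.sum_nonneg fun _ _ => hF _ _ _) M
    _ = ∑ l ∈ range M, ∑ b ∈ range M, ∑ s ∈ range (b + 1), F s (b - s) l := Finset.sum_comm
    _ ≤ ∑ l ∈ range M, ∑ s ∈ range M, ∑ j ∈ range M, F s j l :=
        Finset.sum_le_sum fun l _ => sum_range_conv_le (G := fun s j => F s j l)
          (fun _ _ => hF _ _ _) M
    _ = _ := by
        rw [Finset.sum_comm]
        exact Finset.sum_congr rfl fun s _ => Finset.sum_comm

/-- A weight on walks, as a function of their length and displacement, which is subadditive up to
a factor `2`. -/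
structure IsPathWeight {Λ : Type*} [AddCommGroup Λ] (w : ℕ → Λ → ℝ) : Prop where
  nonneg : ∀ n x, 0 ≤ w n x
  add_le : ∀ m n x y, w (m + n) (x + y) ≤ 2 * (w m x + w n y)

theorem isPathWeight_one {Λ : Type*} [AddCommGroup Λ] :
    IsPathWeight (fun (_ : ℕ) (_ : Λ) => (1 : ℝ)) :=
  ⟨fun _ _ => zero_le_one, fun _ _ _ _ => by norm_num⟩

section walks
variable {Λ E : Type*} [AddCommGroup Λ] [Fintype E] (e : E → Λ) [DecidableEq Λ] [Fintype Λ]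

/-- The one-loop diagram with one of its three parts weighted by `w`. -/
noncomputable def loopDiag (β z : ℝ) (w : ℕ → Λ → ℝ) (i j l : ℕ) (x : Λ) : ℝ :=
  ∑ y, ((twoPt e β z i y * w i y) * twoPt e β z j (x - y) *
      laceSum e β z (fun _ _ => 1) l (y - x) +
    twoPt e β z i y * (twoPt e β z j (x - y) * w j (x - y)) *
      laceSum e β z (fun _ _ => 1) l (y - x) +
    twoPt e β z i y * twoPt e β z j (x - y) * laceSum e β z w l (y - x))

theorem loopDiag_nonneg {β z : ℝ} (hβ : β ≤ 1) (hz : 0 ≤ z) {w : ℕ → Λ → ℝ}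
    (hw : ∀ n x, 0 ≤ w n x) (i j l : ℕ) (x : Λ) : 0 ≤ loopDiag e β z w i j l x := by
  refine Finset.sum_nonneg fun y _ => ?_
  have h1 := twoPt_nonneg e hβ hz i y
  have h2 := twoPt_nonneg e hβ hz j (x - y)
  have h3 := laceSum_nonneg e (β := β) hz (fun _ _ => zero_le_one) l (y - x)
  have h4 := laceSum_nonneg e (β := β) hz hw l (y - x)
  have h5 := hw i y
  have h6 := hw j (x - y)
  positivity

theorem laceAt_le {β z : ℝ} (hβ0 : 0 ≤ β) (hβ : β ≤ 1) (hz : 0 ≤ z) {w : ℕ → Λ → ℝ}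
    (hw : IsPathWeight w) {b l : ℕ} (hl : 1 ≤ l) (x : Λ) :
    laceAt e β z w (b + l) b x ≤ 4 * β * ∑ s ∈ range b, loopDiag e β z w s (b - s) l x := by
  have step1 : laceAt e β z w (b + l) b x ≤ ∑ t ∈ Icc 1 l, ∑ s ∈ range b,
      walkSum e z (b + l) (fun ω => (if ω b = x then
        (1 - selfInt β ω s (b + t)) * pairProd (selfInt β ω) 0 s * pairProd (selfInt β ω) s b *
          |laceKer (selfInt β ω) b (b + t) (b + l)| * w (b + l) (ω (b + l)) else 0)) := by
    unfold laceAt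
    simp_rw [← walkSum_sum]
    refine walkSum_mono e hz _ fun ω _ _ => ?_
    split_ifs with h
    · refine (mul_le_mul_of_nonneg_right (abs_laceKer_le (selfInt_nonneg hβ ω)
        (selfInt_le_one hβ0 ω) (by omega)) (hw.nonneg _ _)).trans (le_of_eq ?_)
      have : Ioc b (b + l) = (Icc 1 l).image (b + ·) := by
        rw [Finset.image_add_left_Icc]; ext; simp
      rw [this, Finset.sum_image (by simp), Finset.sum_mul]
      refine Finset.sum_congr rfl fun t _ => ?_
      rw [Finset.sum_mul, Nat.Ico_zero_eq_range]
    · simp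
  refine step1.trans ?_
  have step2 : ∀ t ∈ Icc 1 l, ∀ s ∈ range b,
      walkSum e z (b + l) (fun ω => (if ω b = x then
        (1 - selfInt β ω s (b + t)) * pairProd (selfInt β ω) 0 s * pairProd (selfInt β ω) s b *
          |laceKer (selfInt β ω) b (b + t) (b + l)| * w (b + l) (ω (b + l)) else 0)) ≤
      4 * (β * ∑ y, (twoPt e β z s y * w s y) * (twoPt e β z (b - s) (x - y) * 1) *
          laceAt e β z (fun _ _ => 1) l t (y - x) +
        β * ∑ y, (twoPt e β z s y * 1) * (twoPt e β z (b - s) (x - y) * w (b - s) (x - y)) *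
          laceAt e β z (fun _ _ => 1) l t (y - x) +
        β * ∑ y, (twoPt e β z s y * 1) * (twoPt e β z (b - s) (x - y) * 1) *
          laceAt e β z w l t (y - x)) := by
    intro t ht s hs
    rw [mem_Icc] at ht
    rw [mem_range] at hs
    obtain ⟨j, rfl⟩ := Nat.exists_eq_add_of_lt hs
    have hj : s + j + 1 - s = j + 1 := by omega
    rw [hj]
    have T1 := walkSum_three e β z (i := s) (j := j + 1) ht.2 x (w s) (fun _ => 1) (fun _ => 1)
    have T2 := walkSum_three e β z (i := s) (j := j + 1) ht.2 x (fun _ => 1) (w (j + 1))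
      (fun _ => 1)
    have T3 := walkSum_three e β z (i := s) (j := j + 1) ht.2 x (fun _ => 1) (fun _ => 1) (w l)
    have T3' : laceAt e β z (fun _ => w l) l t = laceAt e β z w l t := rfl
    rw [T3'] at T3
    rw [← T1, ← T2, ← T3, ← add_assoc s j 1]
    have add3 : ∀ F G H : (ℕ → Λ) → ℝ, 4 * (walkSum e z (s + j + 1 + l) F +
        walkSum e z (s + j + 1 + l) G + walkSum e z (s + j + 1 + l) H) =
        walkSum e z (s + j + 1 + l) (fun ω => 4 * (F ω + G ω + H ω)) := by
      intro F G H
      simp only [walkSum, ← Finset.mul_sum, Finset.sum_add_distrib]; ring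
    rw [add3]
    refine walkSum_mono e hz _ fun ω h0 _ => ?_
    split_ifs with h
    · have hX : 0 ≤ (1 - selfInt β ω s (s + j + 1 + t)) * pairProd (selfInt β ω) 0 s *
          pairProd (selfInt β ω) s (s + j + 1) *
          |laceKer (selfInt β ω) (s + j + 1) (s + j + 1 + t) (s + j + 1 + l)| :=
        mul_nonneg (mul_nonneg (mul_nonneg (sub_nonneg.2 (selfInt_le_one hβ0 ω _ _))
          (pairProd_nonneg (selfInt_nonneg hβ ω) _ _))
          (pairProd_nonneg (selfInt_nonneg hβ ω) _ _)) (abs_nonneg _)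
      have hW : w (s + j + 1 + l) (ω (s + j + 1 + l)) ≤ 4 * (w s (ω s) +
          w (j + 1) (ω (s + j + 1) - ω s) + w l (ω (s + j + 1 + l) - ω (s + j + 1))) := by
        have a1 := hw.add_le s (j + 1 + l) (ω s) (ω (s + j + 1 + l) - ω s)
        have a2 := hw.add_le (j + 1) l (ω (s + j + 1) - ω s) (ω (s + j + 1 + l) - ω (s + j + 1))
        rw [show ω (s + j + 1) - ω s + (ω (s + j + 1 + l) - ω (s + j + 1)) =
          ω (s + j + 1 + l) - ω s by abel] at a2
        rw [show s + (j + 1 + l) = s + j + 1 + l by ring, add_sub_cancel] at a1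
        have := hw.nonneg s (ω s)
        linarith
      refine (mul_le_mul_of_nonneg_left hW hX).trans (le_of_eq ?_)
      ring
    · simp
  refine (Finset.sum_le_sum fun t ht => Finset.sum_le_sum fun s hs => step2 t ht s hs).trans
    (le_of_eq ?_)
  rw [Finset.sum_comm, Finset.mul_sum]
  refine Finset.sum_congr rfl fun s _ => ?_
  unfold loopDiag laceSum
  simp only [Finset.sum_add_distrib, ← Finset.mul_sum]
  rw [Finset.sum_comm, Finset.sum_comm (s := Icc 1 l) (t := univ),
    Finset.sum_comm (s := Icc 1 l) (t := univ)]
  simp only [← Finset.mul_sum, mul_one]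
  ring

theorem laceSum_le {β z : ℝ} (hβ0 : 0 ≤ β) (hβ : β ≤ 1) (hz : 0 ≤ z) {w : ℕ → Λ → ℝ}
    (hw : IsPathWeight w) (n : ℕ) (x : Λ) :
    laceSum e β z w n x ≤ twoPt e β z n x * w n x + 4 * β * ∑ b ∈ Icc 1 n, ∑ s ∈ range b,
      loopDiag e β z w s (b - s) (n - b) x := by
  have h1 : ∀ b ∈ Icc 1 n, laceAt e β z w n b x ≤ (if b = n then twoPt e β z n x * w n x else 0) +
      4 * β * ∑ s ∈ range b, loopDiag e β z w s (b - s) (n - b) x := by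
    intro b hb
    rw [mem_Icc] at hb
    have hpos : 0 ≤ 4 * β * ∑ s ∈ range b, loopDiag e β z w s (b - s) (n - b) x :=
      mul_nonneg (by positivity) (Finset.sum_nonneg fun _ _ =>
        loopDiag_nonneg e hβ hz hw.nonneg _ _ _ _)
    split_ifs with h
    · subst h
      rw [laceAt_self e hβ]
      linarith
    · obtain ⟨l, rfl⟩ := Nat.exists_eq_add_of_lt (lt_of_le_of_ne hb.2 h)
      have := laceAt_le e hβ0 hβ hz hw (b := b) (l := l + 1) (by omega) x
      rw [show b + l + 1 - b = l + 1 by omega, zero_add]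
      exact this
  unfold laceSum
  refine (Finset.sum_le_sum h1).trans ?_
  rw [Finset.sum_add_distrib, ← Finset.mul_sum]
  gcongr
  rw [Finset.sum_ite_eq']
  split_ifs
  · exact le_rfl
  · exact mul_nonneg (twoPt_nonneg e hβ hz _ _) (hw.nonneg _ _)

theorem sum_laceSum_le {β z : ℝ} (hβ0 : 0 ≤ β) (hβ : β ≤ 1) (hz : 0 ≤ z) {w : ℕ → Λ → ℝ}
    (hw : IsPathWeight w) (M : ℕ) (x : Λ) :
    ∑ n ∈ range M, laceSum e β z w n x ≤ ∑ n ∈ range M, twoPt e β z n x * w n x +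
      4 * β * ∑ y, ((∑ n ∈ range M, twoPt e β z n y * w n y) *
          (∑ n ∈ range M, twoPt e β z n (x - y)) *
          (∑ n ∈ range M, laceSum e β z (fun _ _ => 1) n (y - x)) +
        (∑ n ∈ range M, twoPt e β z n y) *
          (∑ n ∈ range M, twoPt e β z n (x - y) * w n (x - y)) *
          (∑ n ∈ range M, laceSum e β z (fun _ _ => 1) n (y - x)) +
        (∑ n ∈ range M, twoPt e β z n y) * (∑ n ∈ range M, twoPt e β z n (x - y)) *
          (∑ n ∈ range M, laceSum e β z w n (y - x))) := by
  refine (Finset.sum_le_sum fun n _ => laceSum_le e hβ0 hβ hz hw n x).trans ?_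
  rw [Finset.sum_add_distrib, ← Finset.mul_sum]
  gcongr
  refine (sum_range_conv_three_le (F := fun i j l => loopDiag e β z w i j l x)
    (fun _ _ _ => loopDiag_nonneg e hβ hz hw.nonneg _ _ _ _) M).trans (le_of_eq ?_)
  have prod3 : ∀ f g h : ℕ → ℝ, (∑ n ∈ range M, f n) * (∑ n ∈ range M, g n) *
      (∑ n ∈ range M, h n) = ∑ i ∈ range M, ∑ j ∈ range M, ∑ l ∈ range M, f i * g j * h l := by
    intro f g h
    rw [Finset.sum_mul_sum, Finset.sum_mul]
    refine Finset.sum_congr rfl fun i _ => ?_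
    rw [Finset.sum_mul]
    exact Finset.sum_congr rfl fun j _ => Finset.mul_sum _ _ _
  simp only [prod3, ← Finset.sum_add_distrib]
  unfold loopDiag
  rw [Finset.sum_comm' (s := univ) (t := fun _ => range M) (t' := range M) (s' := fun _ => univ)
    (by simp)]
  refine Finset.sum_congr rfl fun i _ => ?_
  rw [Finset.sum_comm (s := univ)]
  refine Finset.sum_congr rfl fun j _ => ?_
  rw [Finset.sum_comm (s := univ)]

end walks

section groups
variable {Λ : Type*} [AddCommGroup Λ] [Fintype Λ]

theorem sum_mul_sub_le {g : Λ → ℝ} {B : ℝ} (hB : ∑ x, g x ^ 2 ≤ B) (x : Λ) :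
    ∑ y, g y * g (x - y) ≤ B := by
  have h1 : ∑ y, g (x - y) ^ 2 = ∑ y, g y ^ 2 :=
    (Equiv.subLeft x).sum_comp (fun y => g y ^ 2)
  have h2 : ∑ y, g y * g (x - y) ≤ ∑ y, (1 / 2 * g y ^ 2 + 1 / 2 * g (x - y) ^ 2) :=
    Finset.sum_le_sum fun y _ => by nlinarith [sq_nonneg (g y - g (x - y))]
  rw [Finset.sum_add_distrib, ← Finset.mul_sum, ← Finset.mul_sum, h1] at h2
  linarith

theorem sum_mul_le_of_loop {g φ : Λ → ℝ} {B β : ℝ} (hβ : 0 ≤ β) (hg : ∀ x, 0 ≤ g x)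
    (hφ0 : ∀ x, 0 ≤ φ x)
    (hB : ∑ x, g x ^ 2 ≤ B) (hβB : 24 * β * B ≤ 1)
    (hφ : ∀ x, φ x ≤ g x + 12 * β * ∑ y, g y * g (x - y) * φ (y - x)) (x : Λ) :
    ∑ y, g y * φ (x - y) ≤ 2 * B := by
  have hB0 : 0 ≤ B := (Finset.sum_nonneg fun _ _ => sq_nonneg _).trans hB
  have key : ∀ x, ∑ y, g y * φ (x - y) ≤ B + 12 * β * B * ∑ y, g y * φ (0 - y) := by
    intro x
    have h1 : ∀ x, φ x ≤ g x + 12 * β * ∑ v, g (x - v) * (g v * φ (0 - v)) := by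
      intro x
      refine (hφ x).trans (le_of_eq ?_)
      rw [← (Equiv.subLeft x).sum_comp]
      simp [mul_assoc]
    calc ∑ y, g y * φ (x - y)
        ≤ ∑ y, g y * (g (x - y) + 12 * β * ∑ v, g (x - y - v) * (g v * φ (0 - v))) :=
          Finset.sum_le_sum fun y _ => mul_le_mul_of_nonneg_left (h1 _) (hg _)
      _ = ∑ y, g y * g (x - y) + 12 * β * ∑ v, (g v * φ (0 - v)) * ∑ y, g y * g (x - v - y) := by
          simp only [mul_add, Finset.sum_add_distrib, Finset.mul_sum]
          congr 1
          rw [Finset.sum_comm]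
          refine Finset.sum_congr rfl fun v _ => Finset.sum_congr rfl fun y _ => ?_
          rw [sub_right_comm x v y]; ring
      _ ≤ B + 12 * β * ∑ v, (g v * φ (0 - v)) * B := by
          gcongr with v
          · exact sum_mul_sub_le hB x
          · exact mul_nonneg (hg _) (hφ0 _)
          · exact sum_mul_sub_le hB _
      _ = _ := by rw [← Finset.sum_mul]; ring
  have h0 := key 0
  have hx := key x
  have : 0 ≤ ∑ y, g y * φ (0 - y) := Finset.sum_nonneg fun _ _ => mul_nonneg (hg _) (hφ0 _)
  nlinarith

theorem le_of_loop {g gw φ ψ : Λ → ℝ} {B β γ : ℝ} (hβ : 0 ≤ β) (hg : ∀ x, 0 ≤ g x)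
    (hgs : ∀ x, g (-x) = g x) (hφ0 : ∀ x, 0 ≤ φ x)
    (hB : ∑ x, g x ^ 2 ≤ B) (hβB : 24 * β * B ≤ 1) (hgw : ∀ x, gw x ≤ γ) (hγ : 0 ≤ γ)
    (hφ : ∀ x, φ x ≤ g x + 12 * β * ∑ y, g y * g (x - y) * φ (y - x))
    (hψ : ∀ x, ψ x ≤ gw x + 4 * β * ∑ y, (gw y * g (x - y) * φ (y - x) +
      g y * gw (x - y) * φ (y - x) + g y * g (x - y) * ψ (y - x))) (x : Λ) :
    ψ x ≤ 2 * γ := by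
  have hB0 : 0 ≤ B := (Finset.sum_nonneg fun _ _ => sq_nonneg _).trans hB
  obtain ⟨m, -, hm⟩ := Finset.exists_max_image univ ψ ⟨0, mem_univ _⟩
  refine (hm x (mem_univ _)).trans ?_
  by_cases hneg : ψ m ≤ 0
  · linarith
  push Not at hneg
  have hT := sum_mul_le_of_loop hβ hg hφ0 hB hβB hφ
  have t1 : ∑ y, gw y * g (m - y) * φ (y - m) ≤ γ * (2 * B) := by
    calc _ ≤ ∑ y, γ * (g (m - y) * φ (0 - (m - y))) := by
          refine Finset.sum_le_sum fun y _ => ?_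
          rw [zero_sub, neg_sub, mul_assoc]
          exact mul_le_mul_of_nonneg_right (hgw y) (mul_nonneg (hg _) (hφ0 _))
      _ = γ * ∑ y, g y * φ (0 - y) := by
          rw [← Finset.mul_sum]
          congr 1
          exact (Equiv.subLeft m).sum_comp (fun y => g y * φ (0 - y))
      _ ≤ _ := mul_le_mul_of_nonneg_left (hT 0) hγ
  have t2 : ∑ y, g y * gw (m - y) * φ (y - m) ≤ γ * (2 * B) := by
    calc _ ≤ ∑ y, γ * (g (-y) * φ (-m - -y)) := by
          refine Finset.sum_le_sum fun y _ => ?_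
          rw [hgs, show -m - -y = y - m by abel]
          have := mul_le_mul_of_nonneg_right (hgw (m - y)) (mul_nonneg (hg y) (hφ0 (y - m)))
          linarith
      _ = γ * ∑ y, g y * φ (-m - y) := by
          rw [← Finset.mul_sum]
          congr 1
          exact Equiv.sum_comp (Equiv.neg Λ) (fun y => g y * φ (-m - y))
      _ ≤ _ := mul_le_mul_of_nonneg_left (hT _) hγ
  have t3 : ∑ y, g y * g (m - y) * ψ (y - m) ≤ B * ψ m := by
    calc _ ≤ ∑ y, g y * g (m - y) * ψ m := by
          gcongr with y
          · exact mul_nonneg (hg _) (hg _)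
          · exact hm _ (mem_univ _)
      _ ≤ _ := by
          rw [← Finset.sum_mul]
          exact mul_le_mul_of_nonneg_right (sum_mul_sub_le hB m) hneg.le
  have h := hψ m
  rw [Finset.sum_add_distrib, Finset.sum_add_distrib] at h
  have h2 : 4 * β * (∑ y, gw y * g (m - y) * φ (y - m) + ∑ y, g y * gw (m - y) * φ (y - m) +
      ∑ y, g y * g (m - y) * ψ (y - m)) ≤ 4 * β * (4 * B * γ + B * ψ m) :=
    mul_le_mul_of_nonneg_left (by linarith) (by linarith)
  have h3 := hgw m
  nlinarith [mul_le_mul_of_nonneg_right hβB hγ, mul_le_mul_of_nonneg_right hβB hneg.le]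

end groups

section walks
variable {Λ E : Type*} [AddCommGroup Λ] [Fintype E] (e : E → Λ)

theorem walkSum_neg {σ : E ≃ E} (hσ : ∀ i, e (σ i) = -e i) (z : ℝ) (n : ℕ)
    (F : (ℕ → Λ) → ℝ) : walkSum e z n (fun ω => F (fun k => -ω k)) = walkSum e z n F := by
  unfold walkSum
  congr 1
  rw [← (Equiv.piCongrRight (fun _ : Fin n => σ)).sum_comp
    (fun s : Fin n → E => F (walkPos e s))]
  refine Finset.sum_congr rfl fun s _ => congrArg F (funext fun k => ?_)
  simp [walkPos, hσ]

variable [DecidableEq Λ]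

theorem selfInt_neg (β : ℝ) (ω : ℕ → Λ) : selfInt β (fun k => -ω k) = selfInt β ω := by
  funext s t
  simp [selfInt]

theorem twoPt_neg {σ : E ≃ E} (hσ : ∀ i, e (σ i) = -e i) (β z : ℝ) (n : ℕ) (x : Λ) :
    twoPt e β z n (-x) = twoPt e β z n x := by
  unfold twoPt
  rw [← walkSum_neg e hσ]
  simp only [selfInt_neg, neg_inj]

theorem twoPt_zero (β z : ℝ) (x : Λ) : twoPt e β z 0 x = if x = 0 then 1 else 0 := by
  unfold twoPt
  rw [walkSum_zero]
  simp [pairProd, eq_comm]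

theorem twoPt_one_le {β z : ℝ} (hβ : 0 ≤ β) (hz : 0 ≤ z) (x : Λ) :
    twoPt e β z 1 x ≤ walkSum e z 1 fun ω => if ω 1 = x then 1 else 0 := by
  unfold twoPt
  refine walkSum_mono e hz 1 fun ω _ _ => ?_
  split_ifs
  · simp [pairProd, selfInt_le_one hβ]
  · rfl

variable [Fintype Λ]

theorem walkSum_one (z : ℝ) (F : (ℕ → Λ) → ℝ) (f : Λ → ℝ) (h : ∀ ω, F ω = f (ω 1)) :
    walkSum e z 1 F = z * ∑ i, f (e i) := by
  unfold walkSum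
  rw [pow_one]
  congr 1
  rw [← (Equiv.funUnique (Fin 1) E).symm.sum_comp]
  refine Finset.sum_congr rfl fun i _ => ?_
  rw [h]
  simp [walkPos]

theorem sum_twoPt_one_mul_le {β z : ℝ} (hβ : 0 ≤ β) (hβ1 : β ≤ 1) (hz : 0 ≤ z) {f : Λ → ℝ}
    (hf : ∀ x, 0 ≤ f x) : ∑ x, twoPt e β z 1 x * f x ≤ z * ∑ i, f (e i) := by
  calc _ ≤ ∑ x, (walkSum e z 1 fun ω => if ω 1 = x then 1 else 0) * f x :=
        Finset.sum_le_sum fun x _ => mul_le_mul_of_nonneg_right (twoPt_one_le e hβ hz x) (hf x)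
    _ = walkSum e z 1 fun ω => f (ω 1) := by
        simp only [← walkSum_mul_const]
        rw [← walkSum_sum]
        simp
    _ = _ := walkSum_one e z _ f fun _ => rfl

theorem twoPt_add_le {β z : ℝ} (hβ : 0 ≤ β) (hβ1 : β ≤ 1) (hz : 0 ≤ z) (m n : ℕ) (x : Λ) :
    twoPt e β z (m + n) x ≤ ∑ y, twoPt e β z m y * twoPt e β z n (x - y) := by
  calc twoPt e β z (m + n) x ≤ walkSum e z m fun ω₁ => walkSum e z n fun ω₂ =>
      ∑ y, (if ω₁ m = y then pairProd (selfInt β ω₁) 0 m else 0) *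
        (if ω₂ n = x - y then pairProd (selfInt β ω₂) 0 n else 0) := by
        unfold twoPt
        rw [walkSum_add]
        refine walkSum_mono e hz m fun ω₁ a₁ b₁ => walkSum_mono e hz n fun ω₂ a₂ b₂ => ?_
        rw [Finset.sum_eq_single (ω₁ m) (fun y _ hy => by rw [if_neg (Ne.symm hy), zero_mul])
          (by simp)]
        have hx : (ω₁ (m + n) + ω₂ (m + n - m) = x) ↔ ω₂ n = x - ω₁ m := by
          rw [b₁ _ (by omega), Nat.add_sub_cancel_left, eq_sub_iff_add_eq, add_comm]
        simp only [hx, if_true]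
        split_ifs
        · refine (pairProd_le_mul (selfInt_nonneg hβ1 _) (selfInt_le_one hβ _) (Nat.zero_le m)
            (Nat.le_add_right m n)).trans (le_of_eq ?_)
          rw [pairProd_concat_left β a₂ le_rfl]
          have := pairProd_concat_right β (ω₂ := ω₂) b₁ 0 n
          rw [add_zero] at this
          rw [this]
        · simp
    _ = _ := by
        unfold twoPt
        simp only [walkSum_sum, walkSum_const_mul, walkSum_mul_const]

theorem sum_twoPt_mul_length_le {β z B : ℝ} (hβ : 0 ≤ β) (hβ1 : β ≤ 1) (hz : 0 ≤ z) (M : ℕ)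
    (hB : ∑ x, (∑ n ∈ range M, twoPt e β z n x) ^ 2 ≤ B) (x : Λ) :
    ∑ n ∈ range M, twoPt e β z n x * n ≤ B := by
  have h0 := fun n x => twoPt_nonneg e hβ1 hz n x
  calc ∑ n ∈ range M, twoPt e β z n x * n
      ≤ ∑ n ∈ range M, ∑ b ∈ range (n + 1), ∑ y, twoPt e β z b y * twoPt e β z (n - b) (x - y) := by
        refine Finset.sum_le_sum fun n _ => ?_
        have h1 : ∀ b ∈ range (n + 1), twoPt e β z n x ≤
            ∑ y, twoPt e β z b y * twoPt e β z (n - b) (x - y) := by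
          intro b hb
          have := twoPt_add_le e hβ hβ1 hz b (n - b) x
          rwa [Nat.add_sub_cancel' (by simpa [Nat.lt_succ_iff] using hb)] at this
        have h2 := Finset.sum_le_sum h1
        rw [Finset.sum_const, card_range, nsmul_eq_mul] at h2
        push_cast at h2
        nlinarith [h0 n x]
    _ ≤ ∑ b ∈ range M, ∑ l ∈ range M, ∑ y, twoPt e β z b y * twoPt e β z l (x - y) :=
        sum_range_conv_le (G := fun b l => ∑ y, twoPt e β z b y * twoPt e β z l (x - y))
          (fun _ _ => Finset.sum_nonneg fun _ _ => mul_nonneg (h0 _ _) (h0 _ _)) M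
    _ = ∑ y, (∑ n ∈ range M, twoPt e β z n y) * (∑ n ∈ range M, twoPt e β z n (x - y)) := by
        simp only [Finset.sum_mul_sum]
        rw [Finset.sum_comm' (s := univ) (t := fun _ => range M) (t' := range M)
          (s' := fun _ => univ) (by simp)]
        exact Finset.sum_congr rfl fun i _ => Finset.sum_comm
    _ ≤ B := sum_mul_sub_le (g := fun y => ∑ n ∈ range M, twoPt e β z n y) hB x

/-- The absolute sum, weighted by `w`, of the `m`-th lace coefficient. -/
noncomputable def laceAbs (β z : ℝ) (w : ℕ → Λ → ℝ) (m : ℕ) : ℝ :=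
  walkSum e z m fun ω => |laceKer (selfInt β ω) 0 1 m| * w m (ω m)

theorem laceAbs_nonneg {β z : ℝ} (hz : 0 ≤ z) {w : ℕ → Λ → ℝ} (hw : ∀ n x, 0 ≤ w n x) (m : ℕ) :
    0 ≤ laceAbs e β z w m :=
  walkSum_nonneg e hz m fun ω => mul_nonneg (abs_nonneg _) (hw _ _)

theorem sum_laceAt_one (β z : ℝ) (w : ℕ → Λ → ℝ) (m : ℕ) :
    ∑ x, laceAt e β z w m 1 x = laceAbs e β z w m := by
  unfold laceAt laceAbs
  rw [← walkSum_sum]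
  simp

theorem laceAbs_le {β z : ℝ} (hβ0 : 0 ≤ β) (hβ : β ≤ 1) (hz : 0 ≤ z) {w : ℕ → Λ → ℝ}
    (hw : IsPathWeight w) {l : ℕ} (hl : 1 ≤ l) :
    laceAbs e β z w (1 + l) ≤ 4 * β * ∑ x, twoPt e β z 1 x *
      ((w 0 0 + w 1 x) * laceSum e β z (fun _ _ => 1) l (-x) + laceSum e β z w l (-x)) := by
  rw [← sum_laceAt_one, Finset.mul_sum]
  refine Finset.sum_le_sum fun x _ => (laceAt_le e hβ0 hβ hz hw hl x).trans (le_of_eq ?_)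
  congr 1
  rw [Finset.sum_range_one]
  unfold loopDiag
  rw [Finset.sum_eq_single 0]
  · simp only [twoPt_zero]
    simp only [if_true, sub_zero, Nat.sub_zero, zero_sub]
    ring
  · intro y _ hy
    simp [twoPt_zero, hy]
  · simp

theorem sum_laceAbs_le {β z B γ : ℝ} (hβ0 : 0 ≤ β) (hβ : β ≤ 1) (hz : 0 ≤ z) {w : ℕ → Λ → ℝ}
    (hw : IsPathWeight w) {σ : E ≃ E} (hσ : ∀ i, e (σ i) = -e i) (hβB : 24 * β * B ≤ 1)
    (hB1 : 1 ≤ B) (hγ : 0 ≤ γ)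
    (hB : ∀ M, ∑ x, (∑ n ∈ range M, twoPt e β z n x) ^ 2 ≤ B)
    (hγw : ∀ M x, ∑ n ∈ range M, twoPt e β z n x * w n x ≤ γ) (M : ℕ) :
    ∑ m ∈ range M, laceAbs e β z w (m + 2) ≤
      4 * β * (z * ∑ i, ((w 0 0 + w 1 (e i)) * (2 * B) + 2 * γ)) := by
  have h0 := fun n x => twoPt_nonneg e hβ hz n x
  have hφ0 := fun n x => laceSum_nonneg e (β := β) hz (fun _ _ => zero_le_one) n x
  have hψ0 := fun n x => laceSum_nonneg e (β := β) hz hw.nonneg n x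
  have hφ : ∀ M x, ∑ n ∈ range M, laceSum e β z (fun _ _ => 1) n x ≤
      ∑ n ∈ range M, twoPt e β z n x + 12 * β * ∑ y, (∑ n ∈ range M, twoPt e β z n y) *
        (∑ n ∈ range M, twoPt e β z n (x - y)) *
        (∑ n ∈ range M, laceSum e β z (fun _ _ => 1) n (y - x)) := by
    intro M x
    refine (sum_laceSum_le e hβ0 hβ hz isPathWeight_one M x).trans (le_of_eq ?_)
    simp only [mul_one, Finset.sum_add_distrib]
    ring
  have sq1 : ∀ M x, ∑ n ∈ range M, twoPt e β z n x ≤ B := by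
    intro M x
    have h1 : (∑ n ∈ range M, twoPt e β z n x) ^ 2 ≤ B :=
      (Finset.single_le_sum (f := fun x => (∑ n ∈ range M, twoPt e β z n x) ^ 2)
        (fun _ _ => sq_nonneg _) (mem_univ x)).trans (hB M)
    nlinarith
  have nn : ∀ M x, 0 ≤ ∑ n ∈ range M, twoPt e β z n x :=
    fun M x => Finset.sum_nonneg fun n _ => h0 n x
  have sy : ∀ M x, ∑ n ∈ range M, twoPt e β z n (-x) = ∑ n ∈ range M, twoPt e β z n x :=
    fun M x => Finset.sum_congr rfl fun n _ => twoPt_neg e hσ β z n x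
  have b1 : ∀ M x, ∑ n ∈ range M, laceSum e β z (fun _ _ => 1) n x ≤ 2 * B := by
    intro M x
    refine le_of_loop (g := fun x => ∑ n ∈ range M, twoPt e β z n x)
      (gw := fun x => ∑ n ∈ range M, twoPt e β z n x)
      (φ := fun x => ∑ n ∈ range M, laceSum e β z (fun _ _ => 1) n x)
      (ψ := fun x => ∑ n ∈ range M, laceSum e β z (fun _ _ => 1) n x)
      hβ0 (nn M) (sy M) (fun x => Finset.sum_nonneg fun n _ => hφ0 n x) (hB M) hβB (sq1 M)
      (by linarith) (hφ M) (fun x => (hφ M x).trans (le_of_eq ?_)) x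
    simp only [Finset.sum_add_distrib]
    ring
  have b2 : ∀ M x, ∑ n ∈ range M, laceSum e β z w n x ≤ 2 * γ := fun M x =>
    le_of_loop (g := fun x => ∑ n ∈ range M, twoPt e β z n x)
      (gw := fun x => ∑ n ∈ range M, twoPt e β z n x * w n x)
      (φ := fun x => ∑ n ∈ range M, laceSum e β z (fun _ _ => 1) n x)
      (ψ := fun x => ∑ n ∈ range M, laceSum e β z w n x)
      hβ0 (nn M) (sy M) (fun x => Finset.sum_nonneg fun n _ => hφ0 n x) (hB M) hβB (hγw M) hγ
      (hφ M) (fun x => sum_laceSum_le e hβ0 hβ hz hw M x) x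
  have shift : ∀ (f : ℕ → ℝ), (∀ n, 0 ≤ f n) → ∑ m ∈ range M, f (m + 1) ≤
      ∑ m ∈ range (M + 1), f m := by
    intro f hf
    rw [Finset.sum_range_succ']
    linarith [hf 0]
  calc ∑ m ∈ range M, laceAbs e β z w (m + 2)
      ≤ ∑ m ∈ range M, 4 * β * ∑ x, twoPt e β z 1 x *
      ((w 0 0 + w 1 x) * laceSum e β z (fun _ _ => 1) (m + 1) (-x) +
        laceSum e β z w (m + 1) (-x)) := by
        refine Finset.sum_le_sum fun m _ => ?_
        have := laceAbs_le e hβ0 hβ hz hw (l := m + 1) (by omega)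
        rwa [show 1 + (m + 1) = m + 2 by ring] at this
    _ = 4 * β * ∑ x, twoPt e β z 1 x *
      ((w 0 0 + w 1 x) * (∑ m ∈ range M, laceSum e β z (fun _ _ => 1) (m + 1) (-x)) +
        ∑ m ∈ range M, laceSum e β z w (m + 1) (-x)) := by
        rw [← Finset.mul_sum, Finset.sum_comm]
        congr 1
        refine Finset.sum_congr rfl fun x _ => ?_
        rw [← Finset.mul_sum, Finset.sum_add_distrib, ← Finset.mul_sum]
    _ ≤ 4 * β * ∑ x, twoPt e β z 1 x * ((w 0 0 + w 1 x) * (2 * B) + 2 * γ) := by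
        have a0 := hw.nonneg 0 0
        gcongr with x
        · exact h0 1 x
        · exact add_nonneg a0 (hw.nonneg 1 x)
        · exact (shift _ fun n => hφ0 n _).trans (b1 _ _)
        · exact (shift _ fun n => hψ0 n _).trans (b2 _ _)
    _ ≤ _ := by
        refine mul_le_mul_of_nonneg_left ?_ (by linarith)
        refine sum_twoPt_one_mul_le e hβ0 hβ hz (f := fun x => (w 0 0 + w 1 x) * (2 * B) + 2 * γ)
          fun x => ?_
        have := hw.nonneg 0 0
        have := hw.nonneg 1 x
        positivity

end walks

section cosTrans
variable {Λ : Type*} [AddCommGroup Λ]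

theorem addChar_map_add_re (l : AddChar Λ ℂ) (x y : Λ) :
    (l (x + y)).re = (l x).re * (l y).re - (l x).im * (l y).im := by
  rw [AddChar.map_add_eq_mul, Complex.mul_re]

theorem addChar_add_re (l k : AddChar Λ ℂ) (x : Λ) :
    ((l + k) x).re = (l x).re * (k x).re - (l x).im * (k x).im := by
  rw [AddChar.add_apply, Complex.mul_re]

variable [Finite Λ]

theorem addChar_neg_re (l : AddChar Λ ℂ) (x : Λ) : (l (-x)).re = (l x).re := by
  rw [AddChar.map_neg_eq_conj, Complex.conj_re]

theorem addChar_neg_im (l : AddChar Λ ℂ) (x : Λ) : (l (-x)).im = -(l x).im := by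
  rw [AddChar.map_neg_eq_conj, Complex.conj_im]

theorem addChar_sub_re (l k : AddChar Λ ℂ) (x : Λ) :
    ((l - k) x).re = (l x).re * (k x).re + (l x).im * (k x).im := by
  rw [AddChar.sub_apply, Complex.mul_re, addChar_neg_re, addChar_neg_im]; ring

theorem addChar_map_sub_re (l : AddChar Λ ℂ) (x y : Λ) :
    (l (x - y)).re = (l x).re * (l y).re + (l x).im * (l y).im := by
  rw [sub_eq_add_neg, addChar_map_add_re, addChar_neg_re, addChar_neg_im]; ring

theorem addChar_sq_add_sq (l : AddChar Λ ℂ) (x : Λ) : (l x).re ^ 2 + (l x).im ^ 2 = 1 := by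
  have := Complex.sq_norm (l x)
  rw [AddChar.norm_apply, Complex.normSq_apply] at this
  linarith

theorem addChar_re_le_one (l : AddChar Λ ℂ) (x : Λ) : (l x).re ≤ 1 := by
  nlinarith [addChar_sq_add_sq l x, sq_nonneg (l x).im]

theorem addChar_neg_one_le_re (l : AddChar Λ ℂ) (x : Λ) : -1 ≤ (l x).re := by
  nlinarith [addChar_sq_add_sq l x, sq_nonneg (l x).im]

theorem addChar_abs_re_le_one (l : AddChar Λ ℂ) (x : Λ) : |(l x).re| ≤ 1 :=
  abs_le.2 ⟨addChar_neg_one_le_re l x, addChar_re_le_one l x⟩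

theorem addChar_im_sq_le (l : AddChar Λ ℂ) (x : Λ) : (l x).im ^ 2 ≤ 2 * (1 - (l x).re) := by
  nlinarith [addChar_sq_add_sq l x, sq_nonneg (1 - (l x).re)]

theorem isPathWeight_one_sub_re (k : AddChar Λ ℂ) :
    IsPathWeight (fun (_ : ℕ) (x : Λ) => 1 - (k x).re) := by
  refine ⟨fun _ x => sub_nonneg.2 (addChar_re_le_one k x), fun _ _ x y => ?_⟩
  have h1 := addChar_sq_add_sq k x
  have h2 := addChar_sq_add_sq k y
  rw [addChar_map_add_re]
  have h3 := addChar_re_le_one k x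
  have h4 := addChar_re_le_one k y
  nlinarith [sq_nonneg ((k x).im - (k y).im), addChar_im_sq_le k x, addChar_im_sq_le k y,
    mul_nonneg (sub_nonneg.2 h3) (sub_nonneg.2 h4)]

theorem isPathWeight_length : IsPathWeight (fun (n : ℕ) (_ : Λ) => (n : ℝ)) :=
  ⟨fun _ _ => Nat.cast_nonneg _, fun m n _ _ => by
    push_cast
    have := Nat.cast_nonneg (α := ℝ) m
    have := Nat.cast_nonneg (α := ℝ) n
    linarith⟩

end cosTrans

section fourier
variable {Λ : Type*} [AddCommGroup Λ] [Fintype Λ]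

/-- The cosine transform of a real function on a finite abelian group. -/
noncomputable def cosT (f : Λ → ℝ) (l : AddChar Λ ℂ) : ℝ := ∑ x, f x * (l x).re

theorem sum_addChar_re [DecidableEq Λ] (x : Λ) :
    ∑ l : AddChar Λ ℂ, (l x).re = if x = 0 then (Fintype.card Λ : ℝ) else 0 := by
  have := congrArg Complex.re (AddChar.sum_apply_eq_ite x)
  rw [Complex.re_sum] at this
  rw [this]
  split_ifs <;> simp

theorem sum_cosT_mul {f : Λ → ℝ} (hf : ∀ x, f (-x) = f x) (x : Λ) :
    ∑ l, cosT f l * (l x).re = Fintype.card Λ * f x := by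
  classical
  have h1 : ∀ l : AddChar Λ ℂ, cosT f l * (l x).re =
      ∑ y, f y * (1 / 2 * (l (x + y)).re + 1 / 2 * (l (x - y)).re) := by
    intro l
    rw [cosT, Finset.sum_mul]
    refine Finset.sum_congr rfl fun y _ => ?_
    rw [addChar_map_add_re, addChar_map_sub_re]; ring
  rw [Finset.sum_congr rfl fun l _ => h1 l, Finset.sum_comm]
  have h2 : ∀ y, ∑ l : AddChar Λ ℂ, f y * (1 / 2 * (l (x + y)).re + 1 / 2 * (l (x - y)).re) =
      (if y = -x then f y * (1 / 2 * (Fintype.card Λ : ℝ)) else 0) +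
      (if y = x then f y * (1 / 2 * (Fintype.card Λ : ℝ)) else 0) := by
    intro y
    rw [← Finset.mul_sum, Finset.sum_add_distrib, ← Finset.mul_sum, ← Finset.mul_sum,
      sum_addChar_re, sum_addChar_re]
    have e1 : (x + y = 0) ↔ (y = -x) := by rw [add_comm, eq_neg_iff_add_eq_zero]
    have e2 : (x - y = 0) ↔ (y = x) := by rw [sub_eq_zero, eq_comm]
    simp only [e1, e2]
    split_ifs <;> ring
  rw [Finset.sum_congr rfl fun y _ => h2 y, Finset.sum_add_distrib]
  simp [hf]
  ring

theorem sum_cosT_sq {f : Λ → ℝ} (hf : ∀ x, f (-x) = f x) :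
    ∑ l, cosT f l ^ 2 = Fintype.card Λ * ∑ x, f x ^ 2 := by
  have : ∀ l : AddChar Λ ℂ, cosT f l ^ 2 = ∑ x, f x * (cosT f l * (l x).re) := by
    intro l
    rw [sq]
    nth_rewrite 1 [cosT]
    rw [Finset.sum_mul]
    exact Finset.sum_congr rfl fun x _ => by ring
  rw [Finset.sum_congr rfl fun l _ => this l, Finset.sum_comm, Finset.mul_sum]
  refine Finset.sum_congr rfl fun x _ => ?_
  rw [← Finset.mul_sum, sum_cosT_mul hf]; ring

theorem sum_cosT_second_diff {f : Λ → ℝ} (hf : ∀ x, f (-x) = f x) (k : AddChar Λ ℂ) (x : Λ) :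
    Fintype.card Λ * ((1 - (k x).re) * f x) =
      ∑ l, (cosT f l - 1 / 2 * (cosT f (l + k) + cosT f (l - k))) * (l x).re := by
  have h1 : ∑ l, cosT f (l + k) * (l x).re = ∑ l, cosT f l * ((l - k) x).re := by
    rw [← Equiv.sum_comp (Equiv.addRight k) (fun l => cosT f l * ((l - k) x).re)]
    simp
  have h2 : ∑ l, cosT f (l - k) * (l x).re = ∑ l, cosT f l * ((l + k) x).re := by
    rw [← Equiv.sum_comp (Equiv.subRight k) (fun l => cosT f l * ((l + k) x).re)]
    simp
  calc Fintype.card Λ * ((1 - (k x).re) * f x)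
      = (1 - (k x).re) * ∑ l, cosT f l * (l x).re := by rw [sum_cosT_mul hf]; ring
    _ = ∑ l, cosT f l * (l x).re - 1 / 2 * (∑ l, cosT f l * ((l - k) x).re +
        ∑ l, cosT f l * ((l + k) x).re) := by
        rw [← Finset.sum_add_distrib, Finset.mul_sum, Finset.mul_sum, ← Finset.sum_sub_distrib]
        refine Finset.sum_congr rfl fun l _ => ?_
        rw [addChar_sub_re, addChar_add_re]; ring
    _ = _ := by
        rw [← h1, ← h2, ← Finset.sum_add_distrib, Finset.mul_sum, ← Finset.sum_sub_distrib]
        exact Finset.sum_congr rfl fun l _ => by ring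

theorem cosT_mul_of_renewal [DecidableEq Λ] {g a : Λ → ℝ} (hg : ∀ x, g (-x) = g x)
    (h : ∀ x, g x = (if x = 0 then 1 else 0) + ∑ y, a y * g (x - y)) (l : AddChar Λ ℂ) :
    cosT g l * (1 - cosT a l) = 1 := by
  have him : ∑ x, g x * (l x).im = 0 := by
    have : ∑ x, g x * (l x).im = -∑ x, g x * (l x).im := by
      rw [← Finset.sum_neg_distrib, ← Equiv.sum_comp (Equiv.neg Λ) (fun x => -(g x * (l x).im))]
      refine Finset.sum_congr rfl fun x _ => ?_
      simp [hg, addChar_neg_im]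
    linarith
  have h1 : cosT g l = 1 + cosT a l * cosT g l := by
    have : cosT g l = ∑ x, ((if x = 0 then 1 else 0) + ∑ y, a y * g (x - y)) * (l x).re :=
      Finset.sum_congr rfl fun x _ => by rw [← h x]
    refine this.trans ?_
    simp only [add_mul, Finset.sum_add_distrib]
    congr 1
    · simp
    · simp only [Finset.sum_mul]
      rw [Finset.sum_comm, cosT, Finset.sum_mul]
      refine Finset.sum_congr rfl fun y _ => ?_
      rw [← Equiv.sum_comp (Equiv.addLeft y) (fun x => a y * g (x - y) * (l x).re)]
      have : ∀ x, a y * g (Equiv.addLeft y x - y) * (l (Equiv.addLeft y x)).re =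
          a y * (l y).re * (g x * (l x).re) - a y * (l y).im * (g x * (l x).im) := by
        intro x
        rw [Equiv.coe_addLeft, add_sub_cancel_left, addChar_map_add_re]; ring
      rw [Finset.sum_congr rfl fun x _ => this x, Finset.sum_sub_distrib, ← Finset.mul_sum,
        ← Finset.mul_sum, him, mul_zero, sub_zero]
      rfl
  linarith

theorem abs_second_diff_le {α hl hp hm Gl Gp Gm A c : ℝ} (h1 : Gl * hl = 1) (h2 : Gp * hp = 1)
    (h3 : Gm * hm = 1) (hl0 : 0 ≤ Gl) (hp0 : 0 ≤ Gp) (hm0 : 0 ≤ Gm)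
    (hA : |hp + hm - 2 * hl| ≤ 2 * α) (hd : (hp - hm) ^ 2 ≤ 16 * A * α) (hα : 0 ≤ α)
    (hG : Gl * A ≤ c) :
    |Gl - 1 / 2 * (Gp + Gm)| ≤ α * (1 / 2 * (Gl * Gp + Gl * Gm) + 4 * c * (Gp * Gm)) := by
  have e : Gl - 1 / 2 * (Gp + Gm) = 1 / 4 * (Gl * Gp + Gl * Gm) * (hp + hm - 2 * hl) -
      1 / 4 * (Gl * (Gp * Gm)) * (hp - hm) ^ 2 := by
    have n1 : hl ≠ 0 := by rintro rfl; simp at h1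
    have n2 : hp ≠ 0 := by rintro rfl; simp at h2
    have n3 : hm ≠ 0 := by rintro rfl; simp at h3
    rw [eq_div_of_mul_eq n1 h1, eq_div_of_mul_eq n2 h2, eq_div_of_mul_eq n3 h3]
    field_simp
    ring
  rw [e]
  refine (abs_sub _ _).trans ?_
  rw [abs_mul, abs_of_nonneg (show (0 : ℝ) ≤ 1 / 4 * (Gl * Gp + Gl * Gm) by positivity),
    abs_of_nonneg (show (0 : ℝ) ≤ 1 / 4 * (Gl * (Gp * Gm)) * (hp - hm) ^ 2 by positivity)]
  have t1 : 1 / 4 * (Gl * Gp + Gl * Gm) * |hp + hm - 2 * hl| ≤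
      1 / 4 * (Gl * Gp + Gl * Gm) * (2 * α) := by gcongr
  have t2 : 1 / 4 * (Gl * (Gp * Gm)) * (hp - hm) ^ 2 ≤
      1 / 4 * (Gl * (Gp * Gm)) * (16 * A * α) := by gcongr
  have t3 : (Gl * A) * (Gp * Gm * α) ≤ c * (Gp * Gm * α) := by gcongr
  linarith

theorem sum_mul_le_sum_sq (F : AddChar Λ ℂ → ℝ) (u v : AddChar Λ ℂ) :
    ∑ l, F (l + u) * F (l + v) ≤ ∑ l, F l ^ 2 := by
  have e1 := Equiv.sum_comp (Equiv.addRight u) (fun l => F l ^ 2)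
  have e2 := Equiv.sum_comp (Equiv.addRight v) (fun l => F l ^ 2)
  simp only [Equiv.coe_addRight] at e1 e2
  have : ∑ l, F (l + u) * F (l + v) ≤ ∑ l, (1 / 2 * F (l + u) ^ 2 + 1 / 2 * F (l + v) ^ 2) :=
    Finset.sum_le_sum fun l _ => by nlinarith [sq_nonneg (F (l + u) - F (l + v))]
  rw [Finset.sum_add_distrib, ← Finset.mul_sum, ← Finset.mul_sum, e1, e2] at this
  linarith

theorem renewal_bounds [DecidableEq Λ] {g a p : Λ → ℝ} {δ : AddChar Λ ℂ → ℝ} {s K : ℝ}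
    (hg : ∀ x, g (-x) = g x) (hg0 : ∀ x, 0 ≤ g x)
    (hren : ∀ x, g x = (if x = 0 then 1 else 0) + ∑ y, a y * g (x - y))
    (hs : ∑ x, |a x - p x| = s) (hap : ∀ x, 0 ≤ a x - p x)
    (hδ : ∀ k, ∑ x, (a x - p x) * (1 - (k x).re) = s * δ k)
    (hδ2 : ∀ k, δ k ≤ 2) (hδ0 : ∀ k, 0 ≤ δ k) (hδpos : ∀ k, k ≠ 0 → 0 < δ k)
    (hp : ∑ x, |p x| ≤ s / 8) (hpk : ∀ k, ∑ x, |p x| * (1 - (k x).re) ≤ s * δ k / 16)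
    (hχ : (∑ x, g x) ^ 2 ≤ 4 * Fintype.card Λ)
    (hK : ∑ k ∈ univ.erase (0 : AddChar Λ ℂ), (δ k ^ 2)⁻¹ ≤ K * Fintype.card Λ) :
    s ≤ 2 ∧ ∑ x, g x ^ 2 ≤ 4 + 16 * K ∧
      ∀ k x, (1 - (k x).re) * g x ≤ 147 * (4 + 16 * K) * δ k := by
  have hV : (0 : ℝ) < Fintype.card Λ := Nat.cast_pos.2 Fintype.card_pos
  have hs0 : 0 ≤ s := hs ▸ Finset.sum_nonneg fun _ _ => abs_nonneg _
  have hGh := cosT_mul_of_renewal hg hren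
  have ha0 : cosT a 0 = s + ∑ x, p x := by
    rw [← hs]
    simp only [fun x => abs_of_nonneg (hap x), ← Finset.sum_add_distrib, cosT]
    exact Finset.sum_congr rfl fun x _ => by simp
  have hG0 : cosT g 0 = ∑ x, g x := by simp [cosT]
  have hχ0 : 0 < ∑ x, g x := by
    have h1 := hGh 0
    rw [hG0] at h1
    refine lt_of_le_of_ne (Finset.sum_nonneg fun x _ => hg0 x) fun h => ?_
    rw [← h] at h1; simp at h1
  have hh0 : 0 < 1 - cosT a 0 := by
    have h1 := hGh 0
    rw [hG0] at h1
    exact (pos_iff_pos_of_mul_pos (by rw [h1]; exact one_pos)).1 hχ0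
  have hpabs : |∑ x, p x| ≤ s / 8 := (Finset.abs_sum_le_sum_abs _ _).trans hp
  have hs2 : s ≤ 2 := by
    have := abs_le.1 hpabs
    linarith [this.1]
  have hpk : ∀ k, ∑ x, |p x| * (1 - (k x).re) ≤ δ k / 8 := fun k =>
    (hpk k).trans (by nlinarith [hδ0 k])
  have hdiff : ∀ k, cosT a 0 - cosT a k = s * δ k + ∑ x, p x * (1 - (k x).re) := by
    intro k
    rw [← hδ, ← Finset.sum_add_distrib, cosT, cosT, ← Finset.sum_sub_distrib]
    refine Finset.sum_congr rfl fun x _ => ?_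
    simp
    ring
  have hpk' : ∀ k, |∑ x, p x * (1 - (k x).re)| ≤ δ k / 8 := by
    intro k
    refine (Finset.abs_sum_le_sum_abs _ _).trans (le_trans (le_of_eq ?_) (hpk k))
    refine Finset.sum_congr rfl fun x _ => ?_
    rw [abs_mul, abs_of_nonneg (sub_nonneg.2 (addChar_re_le_one k x))]
  have hhk : ∀ k, δ k / 4 ≤ 1 - cosT a k := by
    intro k
    have h1 := hdiff k
    have h2 := (abs_le.1 (hpk' k)).1
    have h3 := (abs_le.1 hpabs).2
    nlinarith [hδ2 k, hδ0 k, mul_nonneg (sub_nonneg.2 (hδ2 k)) hh0.le, mul_nonneg (hδ0 k) hs0,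
      mul_nonneg (hδ0 k) (sub_nonneg.2 hs2), mul_le_mul_of_nonneg_left h3 (hδ0 k)]
  have hhpos : ∀ k, 0 < 1 - cosT a k := by
    intro k
    by_cases hk : k = 0
    · rw [hk]; exact hh0
    · linarith [hhk k, hδpos k hk]
  have hGpos : ∀ k, 0 ≤ cosT g k := by
    intro k
    exact ((pos_iff_pos_of_mul_pos (by rw [hGh k]; exact one_pos)).2 (hhpos k)).le
  have hGle : ∀ k, cosT g k * δ k ≤ 4 := by
    intro k
    nlinarith [hGh k, hhk k, hGpos k]
  have hB : ∑ x, g x ^ 2 ≤ 4 + 16 * K := by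
    have h1 := sum_cosT_sq hg
    rw [← Finset.add_sum_erase _ _ (mem_univ (0 : AddChar Λ ℂ)), hG0] at h1
    have h2 : ∑ k ∈ univ.erase (0 : AddChar Λ ℂ), cosT g k ^ 2 ≤
        ∑ k ∈ univ.erase (0 : AddChar Λ ℂ), 16 * (δ k ^ 2)⁻¹ := by
      refine Finset.sum_le_sum fun k hk => ?_
      have hd := hδpos k (Finset.ne_of_mem_erase hk)
      rw [← div_eq_mul_inv, le_div_iff₀ (by positivity), ← mul_pow]
      have := mul_nonneg (hGpos k) hd.le
      nlinarith [hGle k]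
    rw [← Finset.mul_sum] at h2
    have h3 : Fintype.card Λ * ∑ x, g x ^ 2 ≤ Fintype.card Λ * (4 + 16 * K) := by
      rw [← h1]; linarith
    exact le_of_mul_le_mul_left h3 hV
  refine ⟨hs2, hB, fun k x => ?_⟩
  have hnn : ∀ (k : AddChar Λ ℂ) x, 0 ≤ 1 - (k x).re :=
    fun k x => sub_nonneg.2 (addChar_re_le_one k x)
  set A : AddChar Λ ℂ → ℝ := fun k => ∑ x, |a x| * (1 - (k x).re) with hAdef
  have hA0 : ∀ k, 0 ≤ A k := fun k => Finset.sum_nonneg fun x _ => mul_nonneg (abs_nonneg _) (hnn k x)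
  have hA3 : ∀ k, A k ≤ 3 * δ k := by
    intro k
    have : A k ≤ s * δ k + δ k / 8 := by
      rw [← hδ]
      refine le_trans ?_ (add_le_add le_rfl (hpk k))
      rw [← Finset.sum_add_distrib]
      refine Finset.sum_le_sum fun x _ => ?_
      rw [← add_mul]
      refine mul_le_mul_of_nonneg_right ?_ (hnn k x)
      have := abs_add_le (a x - p x) (p x)
      rw [sub_add_cancel, abs_of_nonneg (hap x)] at this
      exact this
    nlinarith [hδ0 k]
  have hGA : ∀ k, cosT g k * A k ≤ 12 := by
    intro k
    nlinarith [hGle k, hGpos k, hA3 k]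
  have hdp : ∀ l k, |(1 - cosT a (l + k)) + (1 - cosT a (l - k)) - 2 * (1 - cosT a l)| ≤
      2 * A k := by
    intro l k
    have e1 : (1 - cosT a (l + k)) + (1 - cosT a (l - k)) - 2 * (1 - cosT a l) =
        ∑ x, a x * ((l x).re * (2 * (1 - (k x).re))) := by
      have : ∑ x, a x * ((l x).re * (2 * (1 - (k x).re))) = 2 * cosT a l - cosT a (l + k) -
          cosT a (l - k) := by
        rw [cosT, cosT, cosT, Finset.mul_sum, ← Finset.sum_sub_distrib, ← Finset.sum_sub_distrib]
        refine Finset.sum_congr rfl fun x _ => ?_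
        rw [addChar_add_re, addChar_sub_re]; ring
      rw [this]; ring
    rw [e1, hAdef, Finset.mul_sum]
    refine (Finset.abs_sum_le_sum_abs _ _).trans (Finset.sum_le_sum fun x _ => ?_)
    rw [abs_mul, abs_mul, abs_of_nonneg (show 0 ≤ 2 * (1 - (k x).re) by linarith [hnn k x])]
    have := mul_le_mul_of_nonneg_right (addChar_abs_re_le_one l x)
      (mul_nonneg (abs_nonneg (a x)) (hnn k x))
    linarith
  have hdm : ∀ l k, ((1 - cosT a (l + k)) - (1 - cosT a (l - k))) ^ 2 ≤ 16 * A l * A k := by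
    intro l k
    have e1 : (1 - cosT a (l + k)) - (1 - cosT a (l - k)) =
        2 * ∑ x, a x * ((l x).im * (k x).im) := by
      have : 2 * ∑ x, a x * ((l x).im * (k x).im) = cosT a (l - k) - cosT a (l + k) := by
        rw [cosT, cosT, Finset.mul_sum, ← Finset.sum_sub_distrib]
        refine Finset.sum_congr rfl fun x _ => ?_
        rw [addChar_add_re, addChar_sub_re]; ring
      rw [this]; ring
    have e2 : (∑ x, a x * ((l x).im * (k x).im)) ^ 2 ≤
        (∑ x, |a x| * (l x).im ^ 2) * ∑ x, |a x| * (k x).im ^ 2 := by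
      refine Finset.sum_sq_le_sum_mul_sum_of_sq_le_mul _ (fun x _ => by positivity)
        (fun x _ => by positivity) fun x _ => ?_
      rw [mul_pow, ← sq_abs (a x)]; exact le_of_eq (by ring)
    have e3 : ∀ k, ∑ x, |a x| * (k x).im ^ 2 ≤ 2 * A k := by
      intro k
      rw [hAdef, Finset.mul_sum]
      refine Finset.sum_le_sum fun x _ => ?_
      have := mul_le_mul_of_nonneg_left (addChar_im_sq_le k x) (abs_nonneg (a x))
      linarith
    have e4 : (∑ x, |a x| * (l x).im ^ 2) * ∑ x, |a x| * (k x).im ^ 2 ≤ (2 * A l) * (2 * A k) :=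
      mul_le_mul (e3 l) (e3 k) (Finset.sum_nonneg fun x _ => by positivity)
        (by linarith [hA0 l])
    rw [e1, mul_pow]
    nlinarith
  have hsum := sum_cosT_second_diff hg k x
  have h1 : Fintype.card Λ * ((1 - (k x).re) * g x) ≤ ∑ l, A k * (1 / 2 * (cosT g l *
      cosT g (l + k) + cosT g l * cosT g (l - k)) + 4 * 12 * (cosT g (l + k) * cosT g (l - k))) := by
    rw [hsum]
    refine Finset.sum_le_sum fun l _ => ?_
    refine (le_abs_self _).trans ?_
    rw [abs_mul]
    refine (mul_le_of_le_one_right (abs_nonneg _) (addChar_abs_re_le_one l x)).trans ?_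
    exact abs_second_diff_le (hGh l) (hGh _) (hGh _) (hGpos _) (hGpos _) (hGpos _) (hdp l k)
      (hdm l k) (hA0 k) (hGA l)
  have h2 := sum_mul_le_sum_sq (cosT g) 0 k
  have h3 := sum_mul_le_sum_sq (cosT g) 0 (-k)
  have h4 := sum_mul_le_sum_sq (cosT g) k (-k)
  simp only [add_zero, ← sub_eq_add_neg] at h2 h3 h4
  rw [← Finset.mul_sum, Finset.sum_add_distrib, ← Finset.mul_sum, ← Finset.mul_sum,
    Finset.sum_add_distrib] at h1
  have h5 := sum_cosT_sq hg
  have h6 : Fintype.card Λ * ((1 - (k x).re) * g x) ≤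
      Fintype.card Λ * (147 * (4 + 16 * K) * δ k) := by
    refine h1.trans ?_
    have hS0 : 0 ≤ ∑ l, cosT g l ^ 2 := Finset.sum_nonneg fun _ _ => sq_nonneg _
    calc _ ≤ A k * (49 * ∑ l, cosT g l ^ 2) :=
          mul_le_mul_of_nonneg_left (by linarith) (hA0 k)
      _ ≤ (3 * δ k) * (49 * (Fintype.card Λ * (4 + 16 * K))) := by
          refine mul_le_mul (hA3 k) ?_ (by linarith) (by linarith [hδ0 k])
          rw [h5]
          have := mul_le_mul_of_nonneg_left hB hV.le
          linarith
      _ = _ := by ring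
  exact le_of_mul_le_mul_left h6 hV

end fourier

section walks
variable {Λ E : Type*} [AddCommGroup Λ] [Fintype E] (e : E → Λ) [DecidableEq Λ]

/-- The total weight of `n`-step walks. -/
noncomputable def walkTot (β z : ℝ) (n : ℕ) : ℝ :=
  walkSum e z n fun ω => pairProd (selfInt β ω) 0 n

/-- The lace coefficient with prescribed endpoint. -/
noncomputable def lacePt (β z : ℝ) (m : ℕ) (x : Λ) : ℝ :=
  walkSum e z m fun ω => if ω m = x then laceKer (selfInt β ω) 0 1 m else 0

/-- The total lace coefficient. -/
noncomputable def laceTot (β z : ℝ) (m : ℕ) : ℝ :=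
  walkSum e z m fun ω => laceKer (selfInt β ω) 0 1 m

theorem walkTot_nonneg {β z : ℝ} (hβ : β ≤ 1) (hz : 0 ≤ z) (n : ℕ) : 0 ≤ walkTot e β z n :=
  walkSum_nonneg e hz n fun ω => pairProd_nonneg (selfInt_nonneg hβ ω) _ _

theorem walkTot_zero (β z : ℝ) : walkTot e β z 0 = 1 := by
  unfold walkTot
  rw [walkSum_zero]
  simp [pairProd]

theorem laceKer_zero_one_one {β : ℝ} {ω : ℕ → Λ} (h : ω 0 ≠ ω 1) :
    laceKer (selfInt β ω) 0 1 1 = 1 := by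
  rw [laceKer_self]
  simp [pairProd, selfInt, h]

theorem laceTot_one [Fintype Λ] (he : ∀ i, e i ≠ 0) (β z : ℝ) :
    laceTot e β z 1 = z * Fintype.card E := by
  unfold laceTot walkSum
  rw [Finset.sum_congr rfl fun s _ => laceKer_zero_one_one (by simp [walkPos, (he _).symm])]
  simp

theorem lacePt_one [Fintype Λ] (he : ∀ i, e i ≠ 0) (β z : ℝ) (x : Λ) :
    lacePt e β z 1 x = z * ∑ i, if e i = x then 1 else 0 := by
  unfold lacePt
  rw [← walkSum_one e z (fun ω => if ω 1 = x then 1 else 0) (fun y => if y = x then 1 else 0)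
    (fun _ => rfl)]
  unfold walkSum
  congr 1
  refine Finset.sum_congr rfl fun s _ => ?_
  dsimp only
  rw [laceKer_zero_one_one]
  simp [walkPos, (he _).symm]

theorem walkTot_succ (β z : ℝ) (n : ℕ) :
    walkTot e β z (n + 1) = ∑ m ∈ range (n + 1), laceTot e β z (m + 1) * walkTot e β z (n - m) := by
  unfold walkTot
  simp_rw [fun u => pairProd_eq_sum_laceKer u (Nat.zero_le 1) (show 1 ≤ n + 1 by omega)]
  rw [walkSum_sum]
  have : Icc 1 (n + 1) = (range (n + 1)).image (· + 1) := by
    ext m; simp only [mem_Icc, mem_image, mem_range]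
    exact ⟨fun h => ⟨m - 1, by omega, by omega⟩, by rintro ⟨a, h, rfl⟩; omega⟩
  rw [this, Finset.sum_image (by simp)]
  refine Finset.sum_congr rfl fun m hm => ?_
  rw [mem_range] at hm
  have hmn : n + 1 = (m + 1) + (n - m) := by omega
  nth_rewrite 1 [hmn]
  rw [walkSum_add]
  unfold laceTot
  rw [← walkSum_mul_const]
  refine walkSum_congr e z _ fun ω₁ a₁ b₁ => ?_
  rw [← walkSum_const_mul]
  refine walkSum_congr e z _ fun ω₂ a₂ b₂ => ?_
  rw [laceKer_concat_left β a₂ (by omega) (by omega) le_rfl]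
  have := pairProd_concat_right β (ω₂ := ω₂) b₁ 0 (n - m)
  rw [add_zero, ← hmn] at this
  rw [this]

variable [Fintype Λ]

theorem sum_twoPt (β z : ℝ) (n : ℕ) : ∑ x, twoPt e β z n x = walkTot e β z n := by
  unfold twoPt walkTot
  rw [← walkSum_sum]
  simp

theorem twoPt_succ (β z : ℝ) (n : ℕ) (x : Λ) :
    twoPt e β z (n + 1) x =
      ∑ m ∈ range (n + 1), ∑ y, lacePt e β z (m + 1) y * twoPt e β z (n - m) (x - y) := by
  unfold twoPt
  simp_rw [fun u => pairProd_eq_sum_laceKer u (Nat.zero_le 1) (show 1 ≤ n + 1 by omega)]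
  have e0 : ∀ ω : ℕ → Λ, (if ω (n + 1) = x then ∑ m ∈ Icc 1 (n + 1), laceKer (selfInt β ω) 0 1 m *
      pairProd (selfInt β ω) m (n + 1) else 0) = ∑ m ∈ Icc 1 (n + 1), if ω (n + 1) = x then
      laceKer (selfInt β ω) 0 1 m * pairProd (selfInt β ω) m (n + 1) else 0 := by
    intro ω; split_ifs <;> simp
  simp_rw [e0]
  rw [walkSum_sum]
  have : Icc 1 (n + 1) = (range (n + 1)).image (· + 1) := by
    ext m; simp only [mem_Icc, mem_image, mem_range]
    exact ⟨fun h => ⟨m - 1, by omega, by omega⟩, by rintro ⟨a, h, rfl⟩; omega⟩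
  rw [this, Finset.sum_image (by simp)]
  refine Finset.sum_congr rfl fun m hm => ?_
  rw [mem_range] at hm
  have hmn : n + 1 = (m + 1) + (n - m) := by omega
  nth_rewrite 1 [hmn]
  rw [walkSum_add]
  unfold lacePt
  simp_rw [← walkSum_mul_const]
  rw [← walkSum_sum]
  refine walkSum_congr e z _ fun ω₁ a₁ b₁ => ?_
  rw [Finset.sum_eq_single (ω₁ (m + 1)) (fun y _ hy => by rw [if_neg (Ne.symm hy), zero_mul])
    (by simp), if_pos rfl, ← walkSum_const_mul]
  refine walkSum_congr e z _ fun ω₂ a₂ b₂ => ?_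
  rw [laceKer_concat_left β a₂ (by omega) (by omega) le_rfl]
  have := pairProd_concat_right β (ω₂ := ω₂) b₁ 0 (n - m)
  rw [add_zero, ← hmn] at this
  rw [this]
  have hx : (ω₁ (n + 1) + ω₂ (n + 1 - (m + 1)) = x) ↔ ω₂ (n - m) = x - ω₁ (m + 1) := by
    rw [b₁ _ (by omega), Nat.add_sub_add_right, eq_sub_iff_add_eq, add_comm]
  simp only [hx, mul_ite, mul_zero]

theorem abs_laceTot_le {β z : ℝ} (hz : 0 ≤ z) (m : ℕ) :
    |laceTot e β z m| ≤ laceAbs e β z (fun _ _ => 1) m := by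
  unfold laceTot laceAbs walkSum
  rw [abs_mul, abs_of_nonneg (pow_nonneg hz m)]
  simp only [mul_one]
  exact mul_le_mul_of_nonneg_left (Finset.abs_sum_le_sum_abs _ _) (pow_nonneg hz m)

theorem sum_abs_lacePt_mul_le {β z : ℝ} (hz : 0 ≤ z) {f : Λ → ℝ} (hf : ∀ x, 0 ≤ f x) (m : ℕ) :
    ∑ x, |lacePt e β z m x| * f x ≤ laceAbs e β z (fun _ => f) m := by
  calc _ ≤ ∑ x, walkSum e z m fun ω =>
        if ω m = x then |laceKer (selfInt β ω) 0 1 m| * f x else 0 := by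
        refine Finset.sum_le_sum fun x _ => ?_
        have : |lacePt e β z m x| ≤ walkSum e z m fun ω =>
            if ω m = x then |laceKer (selfInt β ω) 0 1 m| else 0 := by
          unfold lacePt walkSum
          rw [abs_mul, abs_of_nonneg (pow_nonneg hz m)]
          refine mul_le_mul_of_nonneg_left ?_ (pow_nonneg hz m)
          refine (Finset.abs_sum_le_sum_abs _ _).trans (Finset.sum_le_sum fun s _ => ?_)
          dsimp only
          split_ifs <;> simp
        refine (mul_le_mul_of_nonneg_right this (hf x)).trans (le_of_eq ?_)
        rw [← walkSum_mul_const]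
        congr 1
        funext ω
        split_ifs <;> simp
    _ = _ := by
        rw [← walkSum_sum]
        simp [laceAbs]

/-- The two-point function, summed over all lengths. -/
noncomputable def green (β z : ℝ) (x : Λ) : ℝ := ∑' n, twoPt e β z n x

/-- Minus the deviation of the transition function from one. -/
noncomputable def charGap (k : AddChar Λ ℂ) : ℝ :=
  (Fintype.card E : ℝ)⁻¹ * ∑ i, (1 - (k (e i)).re)

theorem charGap_nonneg (k : AddChar Λ ℂ) : 0 ≤ charGap e k :=
  mul_nonneg (by positivity) (Finset.sum_nonneg fun i _ => sub_nonneg.2 (addChar_re_le_one k _))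

theorem charGap_le_two (k : AddChar Λ ℂ) : charGap e k ≤ 2 := by
  unfold charGap
  rcases isEmpty_or_nonempty E with h | h
  · simp
  rw [inv_mul_le_iff₀ (by exact_mod_cast Fintype.card_pos)]
  refine (Finset.sum_le_card_nsmul univ _ 2 fun i _ => ?_).trans (le_of_eq (by simp))
  linarith [addChar_neg_one_le_re k (e i)]

theorem card_mul_charGap (k : AddChar Λ ℂ) :
    Fintype.card E * charGap e k = ∑ i, (1 - (k (e i)).re) := by
  unfold charGap
  rcases isEmpty_or_nonempty E with h | h
  · simp
  rw [mul_inv_cancel_left₀]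
  exact_mod_cast Fintype.card_ne_zero

theorem summable_twoPt {β z : ℝ} (hβ : β ≤ 1) (hz : 0 ≤ z) (hs : Summable (walkTot e β z))
    (x : Λ) : Summable fun n => twoPt e β z n x := by
  refine Summable.of_nonneg_of_le (fun n => twoPt_nonneg e hβ hz n x) (fun n => ?_) hs
  rw [← sum_twoPt]
  exact Finset.single_le_sum (fun y _ => twoPt_nonneg e hβ hz n y) (mem_univ x)

theorem green_nonneg {β z : ℝ} (hβ : β ≤ 1) (hz : 0 ≤ z) (x : Λ) : 0 ≤ green e β z x :=
  tsum_nonneg fun n => twoPt_nonneg e hβ hz n x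

theorem sum_range_twoPt_le_green {β z : ℝ} (hβ : β ≤ 1) (hz : 0 ≤ z)
    (hs : Summable (walkTot e β z)) (M : ℕ) (x : Λ) :
    ∑ n ∈ range M, twoPt e β z n x ≤ green e β z x :=
  (summable_twoPt e hβ hz hs x).sum_le_tsum _ fun n _ => twoPt_nonneg e hβ hz n x

theorem sum_green {β z : ℝ} (hβ : β ≤ 1) (hz : 0 ≤ z) (hs : Summable (walkTot e β z)) :
    ∑ x, green e β z x = ∑' n, walkTot e β z n := by
  unfold green
  rw [← Summable.tsum_finsetSum fun x _ => summable_twoPt e hβ hz hs x]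
  simp only [sum_twoPt]

theorem sum_laceAbs_le_of_green {β z B γ : ℝ} (hβ0 : 0 ≤ β) (hβ : β ≤ 1) (hz : 0 ≤ z)
    (hs : Summable (walkTot e β z)) {w : ℕ → Λ → ℝ}
    (hw : IsPathWeight w) {σ : E ≃ E} (hσ : ∀ i, e (σ i) = -e i) (hβB : 24 * β * B ≤ 1)
    (hB1 : 1 ≤ B) (hγ : 0 ≤ γ) (hB : ∑ x, green e β z x ^ 2 ≤ B)
    (hγw : ∀ M x, ∑ n ∈ range M, twoPt e β z n x * w n x ≤ γ) (M : ℕ) :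
    ∑ m ∈ range M, laceAbs e β z w (m + 2) ≤
      4 * β * (z * ∑ i, ((w 0 0 + w 1 (e i)) * (2 * B) + 2 * γ)) := by
  refine sum_laceAbs_le e hβ0 hβ hz hw hσ hβB hB1 hγ (fun M => le_trans ?_ hB) hγw M
  refine Finset.sum_le_sum fun x _ => ?_
  exact pow_le_pow_left₀ (Finset.sum_nonneg fun n _ => twoPt_nonneg e hβ hz n x)
    (sum_range_twoPt_le_green e hβ hz hs M x) 2

theorem sum_laceAbs_one_le {β z B : ℝ} (hβ0 : 0 ≤ β) (hβ : β ≤ 1) (hz : 0 ≤ z)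
    (hs : Summable (walkTot e β z)) {σ : E ≃ E} (hσ : ∀ i, e (σ i) = -e i)
    (hβB : 24 * β * B ≤ 1) (hB1 : 1 ≤ B) (hB : ∑ x, green e β z x ^ 2 ≤ B) (M : ℕ) :
    ∑ m ∈ range M, laceAbs e β z (fun _ _ => 1) (m + 2) ≤ 24 * β * B * (z * Fintype.card E) := by
  refine (sum_laceAbs_le_of_green e hβ0 hβ hz hs isPathWeight_one hσ hβB hB1 (γ := B)
    (by linarith) hB (fun M x => ?_) M).trans (le_of_eq ?_)
  · simp only [mul_one]
    refine (sum_range_twoPt_le_green e hβ hz hs M x).trans ?_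
    have h1 : green e β z x ^ 2 ≤ B := (Finset.single_le_sum
      (f := fun x => green e β z x ^ 2) (fun _ _ => sq_nonneg _) (mem_univ x)).trans hB
    nlinarith
  · simp; ring

theorem sum_laceAbs_length_le {β z B : ℝ} (hβ0 : 0 ≤ β) (hβ : β ≤ 1) (hz : 0 ≤ z)
    (hs : Summable (walkTot e β z)) {σ : E ≃ E} (hσ : ∀ i, e (σ i) = -e i)
    (hβB : 24 * β * B ≤ 1) (hB1 : 1 ≤ B) (hB : ∑ x, green e β z x ^ 2 ≤ B) (M : ℕ) :
    ∑ m ∈ range M, laceAbs e β z (fun n _ => n) (m + 2) ≤ 16 * β * B * (z * Fintype.card E) := by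
  refine (sum_laceAbs_le_of_green e hβ0 hβ hz hs isPathWeight_length hσ hβB hB1 (γ := B)
    (by linarith) hB (fun M x => ?_) M).trans (le_of_eq ?_)
  · refine sum_twoPt_mul_length_le e hβ0 hβ hz M (le_trans (Finset.sum_le_sum fun x _ => ?_) hB) x
    exact pow_le_pow_left₀ (Finset.sum_nonneg fun n _ => twoPt_nonneg e hβ hz n x)
      (sum_range_twoPt_le_green e hβ hz hs M x) 2
  · simp; ring

theorem sum_laceAbs_re_le {β z B W : ℝ} (hβ0 : 0 ≤ β) (hβ : β ≤ 1) (hz : 0 ≤ z)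
    (hs : Summable (walkTot e β z)) {σ : E ≃ E} (hσ : ∀ i, e (σ i) = -e i)
    (hβB : 24 * β * B ≤ 1) (hB1 : 1 ≤ B) (hB : ∑ x, green e β z x ^ 2 ≤ B)
    (k : AddChar Λ ℂ) (hW0 : 0 ≤ W) (hW : ∀ x, (1 - (k x).re) * green e β z x ≤ W * charGap e k)
    (M : ℕ) :
    ∑ m ∈ range M, laceAbs e β z (fun _ x => 1 - (k x).re) (m + 2) ≤
      8 * β * (B + W) * (z * Fintype.card E * charGap e k) := by
  refine (sum_laceAbs_le_of_green e hβ0 hβ hz hs (isPathWeight_one_sub_re k) hσ hβB hB1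
    (γ := W * charGap e k) (mul_nonneg hW0 (charGap_nonneg e k)) hB (fun M x => ?_) M).trans
    (le_of_eq ?_)
  · rw [← Finset.sum_mul, mul_comm]
    exact (mul_le_mul_of_nonneg_left (sum_range_twoPt_le_green e hβ hz hs M x)
      (sub_nonneg.2 (addChar_re_le_one k x))).trans (hW x)
  · rw [Finset.sum_add_distrib, mul_assoc z, card_mul_charGap]
    simp only [AddChar.map_zero_eq_one, Complex.one_re, sub_self, zero_add, Finset.sum_const,
      card_univ, nsmul_eq_mul]
    rw [← Finset.sum_mul, ← card_mul_charGap]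
    ring

end walks

section walks
variable {Λ E : Type*} [AddCommGroup Λ] [Fintype E] (e : E → Λ) [DecidableEq Λ] [Fintype Λ]

theorem green_neg {σ : E ≃ E} (hσ : ∀ i, e (σ i) = -e i) (β z : ℝ) (x : Λ) :
    green e β z (-x) = green e β z x := by
  unfold green
  simp only [twoPt_neg e hσ]

theorem green_renewal {β z : ℝ} (hβ : β ≤ 1) (hz : 0 ≤ z) (hs : Summable (walkTot e β z))
    (ha : ∀ y, Summable fun m => |lacePt e β z (m + 1) y|) (x : Λ) :
    green e β z x = (if x = 0 then 1 else 0) +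
      ∑ y, (∑' m, lacePt e β z (m + 1) y) * green e β z (x - y) := by
  have hc := fun x => summable_twoPt e hβ hz hs x
  unfold green
  rw [(hc x).tsum_eq_zero_add, twoPt_zero]
  congr 1
  have h1 : ∀ y, (∑' m, lacePt e β z (m + 1) y) * ∑' n, twoPt e β z n (x - y) =
      ∑' n, ∑ m ∈ range (n + 1), lacePt e β z (m + 1) y * twoPt e β z (n - m) (x - y) := fun y =>
    tsum_mul_tsum_eq_tsum_sum_range_of_summable_norm (f := fun m => lacePt e β z (m + 1) y)
      (g := fun n => twoPt e β z n (x - y)) (ha y) (hc (x - y)).norm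
  rw [Finset.sum_congr rfl fun y _ => h1 y]
  have h2 : ∀ y, Summable fun n => ∑ m ∈ range (n + 1),
      lacePt e β z (m + 1) y * twoPt e β z (n - m) (x - y) := fun y =>
    (summable_norm_sum_mul_range_of_summable_norm (f := fun m => lacePt e β z (m + 1) y)
      (g := fun n => twoPt e β z n (x - y)) (ha y) (hc (x - y)).norm).of_norm
  rw [← Summable.tsum_finsetSum fun y _ => h2 y]
  refine tsum_congr fun n => ?_
  rw [twoPt_succ, Finset.sum_comm]

theorem tsum_abs_lacePt_le {β z T : ℝ} (hz : 0 ≤ z) {f : Λ → ℝ} (hf : ∀ x, 0 ≤ f x)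
    (ha : ∀ y, Summable fun m => |lacePt e β z (m + 2) y|)
    (hT : ∀ M, ∑ m ∈ range M, laceAbs e β z (fun _ => f) (m + 2) ≤ T) :
    ∑ x, |∑' m, lacePt e β z (m + 2) x| * f x ≤ T := by
  have h1 : ∑ x, |∑' m, lacePt e β z (m + 2) x| * f x ≤
      ∑ x, ∑' m, |lacePt e β z (m + 2) x| * f x := by
    refine Finset.sum_le_sum fun x _ => ?_
    rw [tsum_mul_right]
    refine mul_le_mul_of_nonneg_right ?_ (hf x)
    have hn : Summable fun m => ‖lacePt e β z (m + 2) x‖ := ha x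
    have := norm_tsum_le_tsum_norm hn
    simpa only [Real.norm_eq_abs] using this
  refine h1.trans ?_
  rw [← Summable.tsum_finsetSum fun x _ => (ha x).mul_right (f x)]
  refine Real.tsum_le_of_sum_range_le (fun m => Finset.sum_nonneg fun x _ =>
    mul_nonneg (abs_nonneg _) (hf x)) fun M => ?_
  exact (Finset.sum_le_sum fun m _ => sum_abs_lacePt_mul_le e hz hf (m + 2)).trans (hT M)

theorem green_bootstrap_step {β z K : ℝ} (hβ0 : 0 ≤ β) (hβ : β ≤ 1) (hz : 0 ≤ z)
    (he : ∀ i, e i ≠ 0) {σ : E ≃ E} (hσ : ∀ i, e (σ i) = -e i)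
    (hgap : ∀ k : AddChar Λ ℂ, k ≠ 0 → 0 < charGap e k)
    (hK : ∑ k ∈ univ.erase (0 : AddChar Λ ℂ), (charGap e k ^ 2)⁻¹ ≤ K * Fintype.card Λ)
    (hK0 : 0 ≤ K) (hβK : 40000 * β * (4 + 16 * K) ≤ 1)
    (hs : Summable (walkTot e β z)) (hχ : (∑' n, walkTot e β z n) ^ 2 ≤ 4 * Fintype.card Λ)
    (hB : ∑ x, green e β z x ^ 2 ≤ 2 * (4 + 16 * K))
    (hW : ∀ k x, (1 - (k x).re) * green e β z x ≤ 2 * (147 * (4 + 16 * K)) * charGap e k) :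
    z * Fintype.card E ≤ 2 ∧ ∑ x, green e β z x ^ 2 ≤ 4 + 16 * K ∧
      ∀ k x, (1 - (k x).re) * green e β z x ≤ 147 * (4 + 16 * K) * charGap e k := by
  have hβB : 24 * β * (2 * (4 + 16 * K)) ≤ 1 := by nlinarith [mul_nonneg hβ0 hK0]
  have hB1 : 1 ≤ 2 * (4 + 16 * K) := by linarith
  have hone := sum_laceAbs_one_le e hβ0 hβ hz hs hσ hβB hB1 hB
  have hre := fun k => sum_laceAbs_re_le e hβ0 hβ hz hs hσ hβB hB1 hB k (by positivity) (hW k)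
  have hle : ∀ m x, |lacePt e β z m x| ≤ laceAbs e β z (fun _ _ => 1) m := by
    intro m x
    have h1 := sum_abs_lacePt_mul_le e (β := β) hz (f := fun _ => 1) (fun _ => zero_le_one) m
    simp only [mul_one] at h1
    exact (Finset.single_le_sum (f := fun x => |lacePt e β z m x|) (fun _ _ => abs_nonneg _)
      (mem_univ x)).trans h1
  have hsumabs : Summable fun m => laceAbs e β z (fun _ _ => 1) (m + 2) :=
    summable_of_sum_range_le (fun m => laceAbs_nonneg e hz (fun _ _ => zero_le_one) _) hone
  have ha2 : ∀ y, Summable fun m => |lacePt e β z (m + 2) y| := fun y =>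
    Summable.of_nonneg_of_le (fun _ => abs_nonneg _) (fun m => hle (m + 2) y) hsumabs
  have ha1 : ∀ y, Summable fun m => |lacePt e β z (m + 1) y| := fun y =>
    (summable_nat_add_iff (f := fun m => |lacePt e β z (m + 1) y|) 1).1 (ha2 y)
  have hE0 : (0 : ℝ) ≤ Fintype.card E := Nat.cast_nonneg _
  have hap : ∀ x, ∑' m, lacePt e β z (m + 1) x - ∑' m, lacePt e β z (m + 2) x =
      z * ∑ i, if e i = x then 1 else 0 := by
    intro x
    rw [(ha1 x).of_abs.tsum_eq_zero_add, lacePt_one e he]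
    simp
  have hap0 : ∀ x, 0 ≤ ∑' m, lacePt e β z (m + 1) x - ∑' m, lacePt e β z (m + 2) x := by
    intro x
    rw [hap]
    exact mul_nonneg hz (Finset.sum_nonneg fun i _ => by split_ifs <;> norm_num)
  refine renewal_bounds (a := fun x => ∑' m, lacePt e β z (m + 1) x)
    (p := fun x => ∑' m, lacePt e β z (m + 2) x) (green_neg e hσ β z)
    (green_nonneg e hβ hz) (green_renewal e hβ hz hs ha1) ?_ hap0 (fun k => ?_)
    (charGap_le_two e) (charGap_nonneg e) hgap ?_ (fun k => ?_) ?_ hK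
  · simp only [abs_of_nonneg (hap0 _)]
    simp only [hap]
    rw [← Finset.mul_sum, Finset.sum_comm]
    simp
  · simp only [hap]
    rw [mul_assoc, card_mul_charGap]
    simp only [mul_assoc, Finset.sum_mul]
    rw [← Finset.mul_sum, Finset.sum_comm]
    simp
  · have := tsum_abs_lacePt_le e hz (f := fun _ => 1) (fun _ => zero_le_one) ha2 hone
    simp only [mul_one] at this
    refine this.trans ?_
    have : 0 ≤ z * Fintype.card E := by positivity
    have h2 : 24 * β * (2 * (4 + 16 * K)) ≤ 1 / 8 := by nlinarith [mul_nonneg hβ0 hK0]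
    nlinarith
  · have := tsum_abs_lacePt_le e hz (f := fun x => 1 - (k x).re)
      (fun x => sub_nonneg.2 (addChar_re_le_one k x)) ha2 (hre k)
    refine this.trans ?_
    have : 0 ≤ z * Fintype.card E * charGap e k := mul_nonneg (by positivity) (charGap_nonneg e k)
    have h2 : 8 * β * (2 * (4 + 16 * K) + 2 * (147 * (4 + 16 * K))) ≤ 1 / 16 := by
      nlinarith [mul_nonneg hβ0 hK0]
    nlinarith
  · rw [sum_green e hβ hz hs]; exact hχ

theorem twoPt_eq_pow_mul (β z : ℝ) (n : ℕ) (x : Λ) :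
    twoPt e β z n x = z ^ n * twoPt e β 1 n x := by
  unfold twoPt
  rw [walkSum_eq_pow_mul]

theorem walkTot_eq_pow_mul (β z : ℝ) (n : ℕ) : walkTot e β z n = z ^ n * walkTot e β 1 n := by
  unfold walkTot
  rw [walkSum_eq_pow_mul]

theorem walkTot_mono {β z Z : ℝ} (hβ : β ≤ 1) (hz : 0 ≤ z) (hzZ : z ≤ Z) (n : ℕ) :
    walkTot e β z n ≤ walkTot e β Z n := by
  rw [walkTot_eq_pow_mul, walkTot_eq_pow_mul e β Z]
  exact mul_le_mul_of_nonneg_right (pow_le_pow_left₀ hz hzZ n) (walkTot_nonneg e hβ zero_le_one n)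

theorem continuousOn_green {β Z : ℝ} (hβ : β ≤ 1) (hZ : 0 ≤ Z)
    (hs : Summable (walkTot e β Z)) (x : Λ) :
    ContinuousOn (fun z => green e β z x) (Set.Icc 0 Z) := by
  unfold green
  refine continuousOn_tsum (u := fun n => twoPt e β Z n x) (fun n => ?_)
    (summable_twoPt e hβ hZ hs x) fun n z hz => ?_
  · have : (fun z => twoPt e β z n x) = fun z => z ^ n * twoPt e β 1 n x :=
      funext fun z => twoPt_eq_pow_mul e β z n x
    rw [this]
    fun_prop
  · rw [Real.norm_of_nonneg (twoPt_nonneg e hβ hz.1 n x), twoPt_eq_pow_mul,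
      twoPt_eq_pow_mul e β Z]
    exact mul_le_mul_of_nonneg_right (pow_le_pow_left₀ hz.1 hz.2 n)
      (twoPt_nonneg e hβ zero_le_one n x)

theorem green_zero (β : ℝ) (x : Λ) : green e β 0 x = if x = 0 then 1 else 0 := by
  unfold green
  rw [tsum_eq_single 0, twoPt_zero]
  intro n hn
  rw [twoPt_eq_pow_mul, zero_pow hn, zero_mul]

theorem green_bounds {β Z K : ℝ} (hβ0 : 0 ≤ β) (hβ : β ≤ 1) (hZ : 0 ≤ Z)
    (he : ∀ i, e i ≠ 0) {σ : E ≃ E} (hσ : ∀ i, e (σ i) = -e i)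
    (hgap : ∀ k : AddChar Λ ℂ, k ≠ 0 → 0 < charGap e k)
    (hK : ∑ k ∈ univ.erase (0 : AddChar Λ ℂ), (charGap e k ^ 2)⁻¹ ≤ K * Fintype.card Λ)
    (hK0 : 0 ≤ K) (hβK : 40000 * β * (4 + 16 * K) ≤ 1)
    (hs : Summable (walkTot e β Z)) (hχ : (∑' n, walkTot e β Z n) ^ 2 ≤ 4 * Fintype.card Λ) :
    Z * Fintype.card E ≤ 2 ∧ ∑ x, green e β Z x ^ 2 ≤ 4 + 16 * K := by
  have hsz : ∀ z ∈ Set.Icc 0 Z, Summable (walkTot e β z) := fun z hz =>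
    Summable.of_nonneg_of_le (walkTot_nonneg e hβ hz.1) (walkTot_mono e hβ hz.1 hz.2) hs
  have hχz : ∀ z ∈ Set.Icc 0 Z, (∑' n, walkTot e β z n) ^ 2 ≤ 4 * Fintype.card Λ := fun z hz =>
    (pow_le_pow_left₀ (tsum_nonneg (walkTot_nonneg e hβ hz.1))
      ((hsz z hz).tsum_le_tsum (walkTot_mono e hβ hz.1 hz.2) hs) 2).trans hχ
  set F : ℝ → Λ → ℝ := fun z => green e β z with hF
  have hFc : ContinuousOn F (Set.Icc 0 Z) :=
    continuousOn_pi.2 fun x => continuousOn_green e hβ hZ hs x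
  set T : Set (Λ → ℝ) := {v | ∑ x, v x ^ 2 ≤ 4 + 16 * K ∧
      ∀ (k : AddChar Λ ℂ) x, (1 - (k x).re) * v x ≤ 147 * (4 + 16 * K) * charGap e k} with hT
  have hTc : IsClosed T := by
    have h0 : IsClosed {v : Λ → ℝ | ∑ x, v x ^ 2 ≤ 4 + 16 * K} :=
      isClosed_le (by fun_prop) continuous_const
    refine h0.inter ?_
    have : {v : Λ → ℝ | ∀ (k : AddChar Λ ℂ) x, (1 - (k x).re) * v x ≤
        147 * (4 + 16 * K) * charGap e k} = ⋂ (k : AddChar Λ ℂ) (x : Λ),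
        {v | (1 - (k x).re) * v x ≤ 147 * (4 + 16 * K) * charGap e k} := by
      ext v; simp
    change IsClosed {v : Λ → ℝ | ∀ (k : AddChar Λ ℂ) x, (1 - (k x).re) * v x ≤
        147 * (4 + 16 * K) * charGap e k}
    rw [this]
    exact isClosed_iInter fun k => isClosed_iInter fun x =>
      isClosed_le (by fun_prop) continuous_const
  have hmain : Set.Icc 0 Z ⊆ F ⁻¹' T := by
    refine IsClosed.Icc_subset_of_forall_mem_nhdsWithin ?_ ?_ fun z hz => ?_
    · rw [Set.inter_comm]
      exact hFc.preimage_isClosed_of_isClosed isClosed_Icc hTc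
    · refine ⟨?_, fun k x => ?_⟩
      · simp only [hF, green_zero]
        simp
        linarith
      · simp only [hF, green_zero]
        have : 0 ≤ 147 * (4 + 16 * K) * charGap e k := mul_nonneg (by positivity)
          (charGap_nonneg e k)
        split_ifs with hx
        · simpa [hx] using this
        · simpa using this
    · have hzI : z ∈ Set.Icc 0 Z := Set.Ico_subset_Icc_self hz.2
      have h1 : ∀ᶠ y in nhdsWithin z (Set.Icc 0 Z), ∑ x, F y x ^ 2 < 2 * (4 + 16 * K) := by
        have hc : ContinuousWithinAt (fun y => ∑ x, F y x ^ 2) (Set.Icc 0 Z) z :=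
          (by fun_prop : Continuous fun v : Λ → ℝ => ∑ x, v x ^ 2).comp_continuousOn hFc z hzI
        exact hc.eventually_lt continuousWithinAt_const (by have := hz.1.1; linarith)
      have h2 : ∀ᶠ y in nhdsWithin z (Set.Icc 0 Z), ∀ (k : AddChar Λ ℂ) (x : Λ),
          (1 - (k x).re) * F y x ≤ 2 * (147 * (4 + 16 * K)) * charGap e k := by
        rw [Filter.eventually_all]
        intro k
        rw [Filter.eventually_all]
        intro x
        by_cases hk : k = 0
        · refine Filter.Eventually.of_forall fun y => ?_
          rw [hk]
          simp only [AddChar.zero_apply, Complex.one_re, sub_self, zero_mul]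
          exact mul_nonneg (by positivity) (charGap_nonneg e 0)
        · have hc : ContinuousWithinAt (fun y => (1 - (k x).re) * F y x) (Set.Icc 0 Z) z :=
            (by fun_prop : Continuous fun v : Λ → ℝ => (1 - (k x).re) * v x).comp_continuousOn
              hFc z hzI
          have := hz.1.2 k x
          have hp := hgap k hk
          have hp2 : 0 < 147 * (4 + 16 * K) * charGap e k := by positivity
          exact (hc.eventually_lt continuousWithinAt_const
            (lt_of_le_of_lt this (by linarith))).mono fun _ h => h.le
      have h3 : ∀ᶠ y in nhdsWithin z (Set.Icc 0 Z), y ∈ F ⁻¹' T := by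
        filter_upwards [h1, h2, self_mem_nhdsWithin] with y hy1 hy2 hyI
        exact (green_bootstrap_step e hβ0 hβ hyI.1 he hσ hgap hK hK0 hβK (hsz y hyI) (hχz y hyI)
          hy1.le hy2).2
      exact nhdsWithin_le_of_mem (Icc_mem_nhdsGT_of_mem hz.2) h3
  have hZT := hmain (Set.right_mem_Icc.2 hZ)
  refine ⟨(green_bootstrap_step e hβ0 hβ hZ he hσ hgap hK hK0 hβK hs hχ ?_ fun k x => ?_).1, hZT.1⟩
  · have := hZT.1
    linarith
  · have := hZT.2 k x
    have := mul_nonneg (show 0 ≤ 147 * (4 + 16 * K) by positivity) (charGap_nonneg e k)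
    linarith

/-- Smallness of the lace coefficients up to the point where the susceptibility is of the order of
the square root of the volume. -/
theorem sum_length_mul_abs_laceTot_le {β Z K : ℝ} (hβ0 : 0 ≤ β) (hβ : β ≤ 1) (hZ : 0 < Z)
    (he : ∀ i, e i ≠ 0) {σ : E ≃ E} (hσ : ∀ i, e (σ i) = -e i)
    (hgap : ∀ k : AddChar Λ ℂ, k ≠ 0 → 0 < charGap e k)
    (hK : ∑ k ∈ univ.erase (0 : AddChar Λ ℂ), (charGap e k ^ 2)⁻¹ ≤ K * Fintype.card Λ)
    (hK0 : 0 ≤ K) (hβK : 40000 * β * (4 + 16 * K) ≤ 1)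
    (hs : Summable (walkTot e β Z)) (hχ : (∑' n, walkTot e β Z n) ^ 2 ≤ 4 * Fintype.card Λ)
    (M : ℕ) :
    ∑ m ∈ range M, ((m + 2 : ℕ) : ℝ) * |laceTot e β 1 (m + 2)| * Z ^ (m + 1) ≤
      16 * β * (4 + 16 * K) * Fintype.card E := by
  obtain ⟨-, hB⟩ := green_bounds e hβ0 hβ hZ.le he hσ hgap hK hK0 hβK hs hχ
  have h := sum_laceAbs_length_le e hβ0 hβ hZ.le hs hσ (B := 4 + 16 * K)
    (by nlinarith [mul_nonneg hβ0 hK0]) (by linarith) hB M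
  have h1 : ∀ m, Z * (((m + 2 : ℕ) : ℝ) * |laceTot e β 1 (m + 2)| * Z ^ (m + 1)) ≤
      laceAbs e β Z (fun n _ => n) (m + 2) := by
    intro m
    have h2 : laceAbs e β Z (fun n _ => (n : ℝ)) (m + 2) =
        ((m + 2 : ℕ) : ℝ) * laceAbs e β Z (fun _ _ => 1) (m + 2) := by
      unfold laceAbs
      rw [← walkSum_const_mul]
      congr 1
      funext ω
      ring
    have h3 := abs_laceTot_le e (β := β) hZ.le (m + 2)
    have h4 : laceTot e β Z (m + 2) = Z ^ (m + 2) * laceTot e β 1 (m + 2) := by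
      unfold laceTot
      rw [walkSum_eq_pow_mul]
    rw [h4, abs_mul, abs_of_pos (pow_pos hZ _)] at h3
    rw [h2]
    refine le_trans (le_of_eq ?_) (mul_le_mul_of_nonneg_left h3 (Nat.cast_nonneg _))
    ring
  have h5 := (Finset.sum_le_sum fun m (_ : m ∈ range M) => h1 m).trans h
  rw [← Finset.mul_sum] at h5
  refine le_of_mul_le_mul_left (h5.trans (le_of_eq ?_)) hZ
  ring

end walks

theorem sum_range_rpow_neg_le {s : ℝ} (hs : 0 ≤ s) (hs' : s ≤ 4 / 5) (N : ℕ) :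
    ∑ k ∈ range N, ((k : ℝ) + 1) ^ (-s) ≤ 5 * (N : ℝ) ^ (1 - s) := by
  induction N with
  | zero =>
    rw [range_zero, sum_empty]
    positivity
  | succ N ih =>
    rw [sum_range_succ]
    have hN : (0 : ℝ) < N + 1 := by positivity
    have h1 := rpow_one_add_le_one_add_mul_self (s := -(1 / ((N : ℝ) + 1))) (p := 1 - s)
      (by rw [neg_le_neg_iff, div_le_one hN]; linarith [Nat.cast_nonneg (α := ℝ) N])
      (by linarith) (by linarith)
    have h2 : 1 + -(1 / ((N : ℝ) + 1)) = N / (N + 1) := by field_simp; ring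
    rw [h2, Real.div_rpow (Nat.cast_nonneg N) hN.le, div_le_iff₀ (by positivity)] at h1
    have h3 : ((N : ℝ) + 1) ^ (1 - s) = (N + 1) * ((N : ℝ) + 1) ^ (-s) := by
      rw [show 1 - s = 1 + -s by ring, Real.rpow_add hN, Real.rpow_one]
    have h4 : 0 ≤ ((N : ℝ) + 1) ^ (-s) := by positivity
    push_cast
    rw [h3] at h1 ⊢
    have h5 : (1 + (1 - s) * -(1 / ((N : ℝ) + 1))) * ((N + 1) * ((N : ℝ) + 1) ^ (-s)) =
        (N + 1) * ((N : ℝ) + 1) ^ (-s) - (1 - s) * ((N : ℝ) + 1) ^ (-s) := by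
      field_simp
      ring
    rw [h5] at h1
    nlinarith

theorem sum_zmod_rpow_neg_le {s : ℝ} (hs : 0 ≤ s) (hs' : s ≤ 4 / 5) (r : ℕ) [NeZero r] :
    ∑ j : ZMod r, ((j.valMinAbs.natAbs : ℝ) + 1) ^ (-s) ≤ 10 * (r : ℝ) ^ (1 - s) := by
  have h1 : ∀ j : ZMod r, ((j.valMinAbs.natAbs : ℝ) + 1) ^ (-s) ≤
      ((j.val : ℝ) + 1) ^ (-s) + (((r - 1 - j.val : ℕ) : ℝ) + 1) ^ (-s) := by
    intro j
    have p1 : 0 ≤ ((j.val : ℝ) + 1) ^ (-s) := by positivity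
    have p2 : 0 ≤ (((r - 1 - j.val : ℕ) : ℝ) + 1) ^ (-s) := by positivity
    rw [ZMod.valMinAbs_natAbs_eq_min]
    rcases min_choice j.val (r - j.val) with h | h
    · rw [h]
      linarith
    · rw [h]
      refine le_add_of_nonneg_of_le p1 ?_
      refine Real.rpow_le_rpow_of_nonpos (by positivity) ?_ (by linarith)
      have : r - 1 - j.val ≤ r - j.val := by omega
      have : ((r - 1 - j.val : ℕ) : ℝ) ≤ (r - j.val : ℕ) := by exact_mod_cast this
      linarith
  have h2 : ∀ f : ℕ → ℝ, ∑ j : ZMod r, f j.val = ∑ k ∈ range r, f k := by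
    intro f
    refine Finset.sum_bij (fun j _ => j.val) (fun j _ => mem_range.2 (ZMod.val_lt j))
      (fun a _ b _ h => ZMod.val_injective r h) (fun k hk => ⟨(k : ZMod r), mem_univ _, ?_⟩)
      fun _ _ => rfl
    exact ZMod.val_cast_of_lt (mem_range.1 hk)
  refine (Finset.sum_le_sum fun j _ => h1 j).trans ?_
  rw [Finset.sum_add_distrib, h2 fun k => ((k : ℝ) + 1) ^ (-s),
    h2 fun k => (((r - 1 - k : ℕ) : ℝ) + 1) ^ (-s),
    Finset.sum_range_reflect (fun k => ((k : ℝ) + 1) ^ (-s)) r]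
  linarith [sum_range_rpow_neg_le hs hs' r]

/-- A unit step on the torus. -/
def torusStep (d r : ℕ) (ε : Fin d × Bool) : Fin d → ZMod r := fun i => (wsawStep d ε i : ZMod r)

theorem torusStep_true (d r : ℕ) (i : Fin d) : torusStep d r (i, true) = Pi.single i 1 := by
  funext j
  by_cases h : j = i <;> simp [torusStep, wsawStep, h]

theorem torusStep_false (d r : ℕ) (i : Fin d) : torusStep d r (i, false) = -Pi.single i 1 := by
  funext j
  by_cases h : j = i <;> simp [torusStep, wsawStep, h]

theorem torusStep_ne_zero {d r : ℕ} (hr : r ≠ 1) (ε : Fin d × Bool) : torusStep d r ε ≠ 0 := by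
  have : Nontrivial (ZMod r) := ZMod.nontrivial_iff.2 hr
  rcases ε with ⟨i, _ | _⟩
  · rw [torusStep_false]
    simp
  · rw [torusStep_true]
    simp

/-- Reversal of a step. -/
def flipStep (d : ℕ) : Fin d × Bool ≃ Fin d × Bool := (Equiv.refl _).prodCongr Equiv.boolNot

theorem torusStep_flipStep (d r : ℕ) (ε : Fin d × Bool) :
    torusStep d r (flipStep d ε) = -torusStep d r ε := by
  rcases ε with ⟨i, _ | _⟩ <;> simp [flipStep, torusStep_true, torusStep_false]

/-- The frequency of a character of the torus. -/
noncomputable def charFreq {d r : ℕ} [NeZero r] (k : AddChar (Fin d → ZMod r) ℂ) : Fin d → ZMod r :=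
  fun i => AddChar.zmodAddEquiv.symm
    (k.compAddMonoidHom (AddMonoidHom.single (fun _ : Fin d => ZMod r) i))

theorem charFreq_injective {d r : ℕ} [NeZero r] :
    Function.Injective (charFreq : AddChar (Fin d → ZMod r) ℂ → Fin d → ZMod r) := by
  intro k l h
  ext x
  have h1 : ∀ i, ∀ a, k (Pi.single i a) = l (Pi.single i a) := by
    intro i a
    have := AddChar.zmodAddEquiv.symm.injective (congrFun h i)
    exact DFunLike.congr_fun this a
  rw [← Finset.univ_sum_single x]
  induction (univ : Finset (Fin d)) using Finset.induction_on with
  | empty => simp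
  | insert i s hi ih =>
    rw [Finset.sum_insert hi, AddChar.map_add_eq_mul, AddChar.map_add_eq_mul, h1, ih]

theorem charFreq_zero {d r : ℕ} [NeZero r] :
    charFreq (0 : AddChar (Fin d → ZMod r) ℂ) = 0 := by
  funext i
  unfold charFreq
  rw [Pi.zero_apply, AddEquiv.symm_apply_eq, map_zero]
  ext a
  simp

theorem apply_single_re {d r : ℕ} [NeZero r] (k : AddChar (Fin d → ZMod r) ℂ) (i : Fin d) :
    (k (Pi.single i 1)).re = Real.cos (2 * Real.pi * ((charFreq k i).valMinAbs / r)) := by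
  have h : k.compAddMonoidHom (AddMonoidHom.single (fun _ : Fin d => ZMod r) i) =
      AddChar.zmodAddEquiv (charFreq k i) := by
    unfold charFreq
    rw [AddEquiv.apply_symm_apply]
  have h1 := DFunLike.congr_fun h (1 : ZMod r)
  have h2 : k (Pi.single i 1) = (AddChar.zmod r (charFreq k i) 1 : ℂ) := h1
  have h3 := AddChar.zmod_intCast r (charFreq k i).valMinAbs 1
  rw [ZMod.coe_valMinAbs, Int.cast_one, Int.cast_one, mul_one] at h3
  rw [h2, h3, Circle.coe_exp, Complex.exp_ofReal_mul_I_re]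

theorem le_one_sub_apply_single_re {d r : ℕ} [NeZero r] (k : AddChar (Fin d → ZMod r) ℂ)
    (i : Fin d) :
    8 / (r : ℝ) ^ 2 * ((charFreq k i).valMinAbs.natAbs : ℝ) ^ 2 ≤ 1 - (k (Pi.single i 1)).re := by
  have hr : (0 : ℝ) < r := by exact_mod_cast Nat.pos_of_ne_zero (NeZero.ne r)
  rw [apply_single_re]
  set v := (charFreq k i).valMinAbs with hv
  have h1 : (v.natAbs : ℝ) = |(v : ℝ)| := by
    rw [Nat.cast_natAbs, Int.cast_abs]
  have h2 : 2 * |(v : ℝ)| ≤ r := by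
    rw [← h1]
    have := ZMod.natAbs_valMinAbs_le (charFreq k i)
    have : 2 * v.natAbs ≤ r := by omega
    exact_mod_cast this
  have h3 : |2 * Real.pi * (v / r)| ≤ Real.pi := by
    rw [abs_mul, abs_div, abs_of_pos hr, abs_of_pos Real.two_pi_pos]
    rw [mul_div_assoc', div_le_iff₀ hr]
    nlinarith [Real.pi_pos]
  have h4 := Real.cos_le_one_sub_mul_cos_sq h3
  have h5 : 2 / Real.pi ^ 2 * (2 * Real.pi * (v / r)) ^ 2 = 8 / (r : ℝ) ^ 2 * (v : ℝ) ^ 2 := by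
    have := Real.pi_ne_zero
    field_simp
    ring
  rw [h1, sq_abs]
  linarith

theorem charGap_torusStep {d r : ℕ} [NeZero r] (k : AddChar (Fin d → ZMod r) ℂ) :
    charGap (torusStep d r) k = (d : ℝ)⁻¹ * ∑ i, (1 - (k (Pi.single i 1)).re) := by
  unfold charGap
  rw [Fintype.sum_prod_type]
  have : ∀ i : Fin d, ∑ b : Bool, (1 - (k (torusStep d r (i, b))).re) =
      2 * (1 - (k (Pi.single i 1)).re) := by
    intro i
    rw [Fintype.sum_bool, torusStep_true, torusStep_false, AddChar.map_neg_eq_conj, Complex.conj_re]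
    ring
  rw [Finset.sum_congr rfl fun i _ => this i, ← Finset.mul_sum, Fintype.card_prod,
    Fintype.card_bool, Fintype.card_fin]
  push_cast
  rw [mul_inv]
  ring

theorem le_charGap_torusStep {d r : ℕ} [NeZero r] {k : AddChar (Fin d → ZMod r) ℂ} (hk : k ≠ 0)
    (i : Fin d) :
    (d * (r : ℝ) ^ 2)⁻¹ * (((charFreq k i).valMinAbs.natAbs : ℝ) + 1) ^ 2 ≤
      charGap (torusStep d r) k := by
  have hr : (0 : ℝ) < r := by exact_mod_cast Nat.pos_of_ne_zero (NeZero.ne r)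
  set m : Fin d → ℕ := fun i => (charFreq k i).valMinAbs.natAbs with hm
  obtain ⟨j, hj⟩ : ∃ j, m j ≠ 0 := by
    by_contra! h
    refine hk (charFreq_injective ?_)
    rw [charFreq_zero]
    funext j
    simpa [hm] using h j
  have h1 : ∀ i, 8 / (r : ℝ) ^ 2 * (m i : ℝ) ^ 2 ≤ ∑ i, (1 - (k (Pi.single i 1)).re) := fun i =>
    (le_one_sub_apply_single_re k i).trans (Finset.single_le_sum
      (f := fun i => 1 - (k (Pi.single i 1)).re)
      (fun i _ => le_trans (by positivity) (le_one_sub_apply_single_re k i)) (mem_univ i))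
  have h2 : ((m i : ℝ) + 1) ^ 2 ≤ 8 * (m i : ℝ) ^ 2 ∨ ((m i : ℝ) + 1) ^ 2 ≤ 8 * (m j : ℝ) ^ 2 := by
    rcases Nat.eq_zero_or_pos (m i) with h | h
    · right
      have : (1 : ℝ) ≤ m j := by exact_mod_cast Nat.one_le_iff_ne_zero.2 hj
      rw [h]
      push_cast
      nlinarith
    · left
      have : (1 : ℝ) ≤ m i := by exact_mod_cast h
      nlinarith
  rw [charGap_torusStep, mul_inv, mul_assoc]
  refine mul_le_mul_of_nonneg_left ?_ (by positivity)
  rcases h2 with h | h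
  · refine le_trans ?_ (h1 i)
    rw [div_eq_inv_mul, mul_assoc]
    exact mul_le_mul_of_nonneg_left h (by positivity)
  · refine le_trans ?_ (h1 j)
    rw [div_eq_inv_mul, mul_assoc]
    exact mul_le_mul_of_nonneg_left h (by positivity)

theorem charGap_torusStep_pos {d r : ℕ} [NeZero r] (hd : 0 < d) {k : AddChar (Fin d → ZMod r) ℂ}
    (hk : k ≠ 0) : 0 < charGap (torusStep d r) k := by
  have hr : (0 : ℝ) < r := by exact_mod_cast Nat.pos_of_ne_zero (NeZero.ne r)
  refine lt_of_lt_of_le ?_ (le_charGap_torusStep hk ⟨0, hd⟩)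
  positivity

theorem le_prod_of_forall_le {d : ℕ} (hd : 0 < d) {x : ℝ} (hx : 0 ≤ x) {b : Fin d → ℝ}
    (h : ∀ i, x ≤ b i) : x ≤ ∏ i, b i ^ ((d : ℝ)⁻¹) := by
  have h1 : ∏ _i : Fin d, x ^ ((d : ℝ)⁻¹) = x := by
    rw [Finset.prod_const, card_univ, Fintype.card_fin, Real.rpow_inv_natCast_pow hx hd.ne']
  calc x = ∏ _i : Fin d, x ^ ((d : ℝ)⁻¹) := h1.symm
    _ ≤ _ := Finset.prod_le_prod (fun _ _ => by positivity) fun i _ =>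
      Real.rpow_le_rpow hx (h i) (by positivity)

/-- The torus bubble sum is of the order of the volume in dimensions `d > 4`. -/
theorem sum_charGap_torusStep_le {d r : ℕ} [NeZero r] (hd : 4 < d) :
    ∑ k ∈ univ.erase (0 : AddChar (Fin d → ZMod r) ℂ), (charGap (torusStep d r) k ^ 2)⁻¹ ≤
      (d : ℝ) ^ 2 * 10 ^ d * Fintype.card (Fin d → ZMod r) := by
  have hr : (0 : ℝ) < r := by exact_mod_cast Nat.pos_of_ne_zero (NeZero.ne r)
  have hd0 : (0 : ℝ) < d := by positivity
  set s : ℝ := 4 / d with hs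
  have hs0 : 0 ≤ s := by positivity
  have hs1 : s ≤ 4 / 5 := by
    have : (5 : ℝ) ≤ d := by exact_mod_cast hd
    rw [hs]
    gcongr
  set D : ℝ := d ^ 2 * (r : ℝ) ^ 4 with hD
  have hD0 : 0 < D := by positivity
  set g : ZMod r → ℝ := fun j => ((j.valMinAbs.natAbs : ℝ) + 1) ^ (-s) with hg
  have h1 : ∀ k ∈ univ.erase (0 : AddChar (Fin d → ZMod r) ℂ),
      (charGap (torusStep d r) k ^ 2)⁻¹ ≤ D * ∏ i, g (charFreq k i) := by
    intro k hk
    have hk0 := Finset.ne_of_mem_erase hk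
    have hp := charGap_torusStep_pos (by omega) hk0
    have h2 := le_prod_of_forall_le (d := d) (by omega)
      (x := (charGap (torusStep d r) k ^ 2)⁻¹ / D) (by positivity)
      (b := fun i => ((((charFreq k i).valMinAbs.natAbs : ℝ) + 1) ^ 4)⁻¹) fun i => by
        have h3 := le_charGap_torusStep hk0 i
        rw [div_le_iff₀ hD0, ← inv_inv D, ← mul_inv, inv_le_inv₀ (by positivity) (by positivity)]
        calc _ = ((d * (r : ℝ) ^ 2)⁻¹ * (((charFreq k i).valMinAbs.natAbs : ℝ) + 1) ^ 2) ^ 2 := by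
              rw [hD]
              field_simp
          _ ≤ _ := pow_le_pow_left₀ (by positivity) h3 2
    rw [div_le_iff₀ hD0, mul_comm] at h2
    refine h2.trans (le_of_eq ?_)
    congr 1
    refine Finset.prod_congr rfl fun i _ => ?_
    rw [hg]
    dsimp only
    rw [Real.inv_rpow (by positivity), Real.rpow_neg (by positivity), ← Real.rpow_natCast,
      ← Real.rpow_mul (by positivity), hs]
    norm_num [div_eq_mul_inv]
  calc _ ≤ ∑ k ∈ univ.erase (0 : AddChar (Fin d → ZMod r) ℂ), D * ∏ i, g (charFreq k i) :=
        Finset.sum_le_sum h1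
    _ ≤ ∑ k : AddChar (Fin d → ZMod r) ℂ, D * ∏ i, g (charFreq k i) :=
        Finset.sum_le_sum_of_subset_of_nonneg (erase_subset _ _) fun k _ _ => by positivity
    _ = ∑ p ∈ univ.image (charFreq : AddChar (Fin d → ZMod r) ℂ → Fin d → ZMod r),
          D * ∏ i, g (p i) := by
        rw [Finset.sum_image fun a _ b _ h => charFreq_injective h]
    _ ≤ ∑ p : Fin d → ZMod r, D * ∏ i, g (p i) :=
        Finset.sum_le_sum_of_subset_of_nonneg (subset_univ _) fun k _ _ => by positivity
    _ = D * (∑ j, g j) ^ d := by rw [← Finset.mul_sum, Fintype.sum_pow]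
    _ ≤ D * (10 * (r : ℝ) ^ (1 - s)) ^ d := by
        have : 0 ≤ ∑ j, g j := Finset.sum_nonneg fun j _ => by positivity
        exact mul_le_mul_of_nonneg_left
          (pow_le_pow_left₀ this (sum_zmod_rpow_neg_le hs0 hs1 r) d) hD0.le
    _ = _ := by
        rw [Fintype.card_fun, ZMod.card, Fintype.card_fin, mul_pow, ← Real.rpow_mul_natCast hr.le,
          hD]
        have : (1 - s) * d = ((d - 4 : ℕ) : ℝ) := by
          rw [Nat.cast_sub (by omega), hs]
          field_simp
          norm_num
        rw [this, Real.rpow_natCast]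
        have : (r : ℝ) ^ d = (r : ℝ) ^ 4 * (r : ℝ) ^ (d - 4) := by
          rw [← pow_add]
          congr 1
          omega
        push_cast
        rw [this]
        ring

theorem norm_pow_sub_pow_le_mul {z w : ℂ} {Z : ℝ} (hz : ‖z‖ ≤ Z) (hw : ‖w‖ ≤ Z) (k : ℕ) :
    ‖z ^ (k + 1) - w ^ (k + 1)‖ ≤ (k + 1) * Z ^ k * ‖z - w‖ := by
  have hZ : 0 ≤ Z := (norm_nonneg z).trans hz
  induction k with
  | zero => simp
  | succ k ih =>
    have h : z ^ (k + 1 + 1) - w ^ (k + 1 + 1) =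
        z * (z ^ (k + 1) - w ^ (k + 1)) + (z - w) * w ^ (k + 1) := by ring
    rw [h]
    refine (norm_add_le _ _).trans ?_
    rw [norm_mul, norm_mul, norm_pow]
    have h1 : ‖z‖ * ‖z ^ (k + 1) - w ^ (k + 1)‖ ≤ Z * ((k + 1) * Z ^ k * ‖z - w‖) :=
      mul_le_mul hz ih (norm_nonneg _) hZ
    have h2 : ‖z - w‖ * ‖w‖ ^ (k + 1) ≤ ‖z - w‖ * Z ^ (k + 1) :=
      mul_le_mul_of_nonneg_left (pow_le_pow_left₀ (norm_nonneg _) hw _) (norm_nonneg _)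
    push_cast
    refine (add_le_add h1 h2).trans (le_of_eq ?_)
    ring

section renewal
variable {a p : ℕ → ℝ} {Z L : ℝ}

theorem summable_norm_ofReal_mul_pow (ha : ∀ n, 0 ≤ a n) (hs : Summable fun n => a n * Z ^ n)
    {z : ℂ} (hz : ‖z‖ ≤ Z) : Summable fun n => ‖(a n : ℂ) * z ^ n‖ := by
  refine Summable.of_nonneg_of_le (fun _ => norm_nonneg _) (fun n => ?_) hs
  rw [norm_mul, norm_pow, Complex.norm_of_nonneg (ha n)]
  exact mul_le_mul_of_nonneg_left (pow_le_pow_left₀ (norm_nonneg _) hz n) (ha n)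

/-- A solution of a renewal equation with coefficients that are small beyond the first has a
generating function whose reciprocal is nearly affine. -/
theorem renewal_inv_sub_inv (ha : ∀ n, 0 ≤ a n) (ha0 : a 0 = 1)
    (har : ∀ n, a (n + 1) = ∑ m ∈ range (n + 1), p m * a (n - m)) (hZ : 0 < Z)
    (hs : Summable fun n => a n * Z ^ n)
    (hL : ∀ M, ∑ m ∈ range M, ((m + 2 : ℕ) : ℝ) * |p (m + 1)| * Z ^ (m + 1) ≤ L) :
    (∀ z : ℂ, ‖z‖ ≤ Z → ∑' n, (a n : ℂ) * z ^ n ≠ 0) ∧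
      ∀ z w : ℂ, ‖z‖ ≤ Z → ‖w‖ ≤ Z →
        ‖(∑' n, (a n : ℂ) * z ^ n)⁻¹ - (∑' n, (a n : ℂ) * w ^ n)⁻¹ + p 0 * (z - w)‖ ≤
          L * ‖z - w‖ := by
  have hsL : Summable fun m => ((m + 2 : ℕ) : ℝ) * |p (m + 1)| * Z ^ (m + 1) :=
    summable_of_sum_range_le (fun m => by positivity) hL
  have hsp : ∀ z : ℂ, ‖z‖ ≤ Z → Summable fun m => ‖(p m : ℂ) * z ^ (m + 1)‖ := by
    intro z hz
    rw [← summable_nat_add_iff 1]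
    refine Summable.of_nonneg_of_le (fun _ => norm_nonneg _) (fun m => ?_) (hsL.mul_right Z)
    rw [norm_mul, norm_pow, Complex.norm_real, Real.norm_eq_abs]
    calc |p (m + 1)| * ‖z‖ ^ (m + 1 + 1) ≤ |p (m + 1)| * Z ^ (m + 1 + 1) :=
          mul_le_mul_of_nonneg_left (pow_le_pow_left₀ (norm_nonneg _) hz _) (abs_nonneg _)
      _ = 1 * |p (m + 1)| * Z ^ (m + 1) * Z := by ring
      _ ≤ ((m + 2 : ℕ) : ℝ) * |p (m + 1)| * Z ^ (m + 1) * Z := by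
        have : (1 : ℝ) ≤ ((m + 2 : ℕ) : ℝ) := by
          push_cast
          linarith [Nat.cast_nonneg (α := ℝ) m]
        gcongr
  have hmul : ∀ z : ℂ, ‖z‖ ≤ Z →
      (∑' n, (a n : ℂ) * z ^ n) * (1 - ∑' m, (p m : ℂ) * z ^ (m + 1)) = 1 := by
    intro z hz
    have h1 := summable_norm_ofReal_mul_pow ha hs hz
    have h2 := tsum_mul_tsum_eq_tsum_sum_range_of_summable_norm (hsp z hz) h1
    have h3 : ∀ n, ∑ k ∈ range (n + 1), (p k : ℂ) * z ^ (k + 1) * (a (n - k) * z ^ (n - k)) =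
        (a (n + 1) : ℂ) * z ^ (n + 1) := by
      intro n
      rw [har, Complex.ofReal_sum, Finset.sum_mul]
      refine Finset.sum_congr rfl fun k hk => ?_
      rw [show n + 1 = (k + 1) + (n - k) by have := mem_range.1 hk; omega, pow_add]
      push_cast
      ring
    simp only [h3] at h2
    have h4 := h1.of_norm.tsum_eq_zero_add
    rw [ha0] at h4
    have h5 : ∑' n, (a n : ℂ) * z ^ n = 1 + (∑' m, (p m : ℂ) * z ^ (m + 1)) *
        ∑' n, (a n : ℂ) * z ^ n := by
      rw [h2]
      simpa using h4
    linear_combination h5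
  have hinv : ∀ z : ℂ, ‖z‖ ≤ Z →
      (∑' n, (a n : ℂ) * z ^ n)⁻¹ = 1 - ∑' m, (p m : ℂ) * z ^ (m + 1) := fun z hz =>
    inv_eq_of_mul_eq_one_right (hmul z hz)
  refine ⟨fun z hz h => ?_, fun z w hz hw => ?_⟩
  · have := hmul z hz
    rw [h, zero_mul] at this
    exact zero_ne_one this
  · rw [hinv z hz, hinv w hw, (hsp z hz).of_norm.tsum_eq_zero_add,
      (hsp w hw).of_norm.tsum_eq_zero_add]
    have e1 : ∀ z : ℂ, ‖z‖ ≤ Z → Summable fun m => (p (m + 1) : ℂ) * z ^ (m + 1 + 1) := fun z hz =>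
      (summable_nat_add_iff (f := fun m => (p m : ℂ) * z ^ (m + 1)) 1).2 (hsp z hz).of_norm
    have e2 : (1 - ((p 0 : ℂ) * z ^ (0 + 1) + ∑' m, (p (m + 1) : ℂ) * z ^ (m + 1 + 1))) -
        (1 - ((p 0 : ℂ) * w ^ (0 + 1) + ∑' m, (p (m + 1) : ℂ) * w ^ (m + 1 + 1))) +
        p 0 * (z - w) = -∑' m, (p (m + 1) : ℂ) * (z ^ (m + 1 + 1) - w ^ (m + 1 + 1)) := by
      simp only [mul_sub]
      rw [(e1 z hz).tsum_sub (e1 w hw)]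
      ring
    rw [e2, norm_neg]
    have e3 : ∀ m, ‖(p (m + 1) : ℂ) * (z ^ (m + 1 + 1) - w ^ (m + 1 + 1))‖ ≤
        ((m + 2 : ℕ) : ℝ) * |p (m + 1)| * Z ^ (m + 1) * ‖z - w‖ := by
      intro m
      rw [norm_mul, Complex.norm_real, Real.norm_eq_abs]
      have := norm_pow_sub_pow_le_mul hz hw (m + 1)
      refine (mul_le_mul_of_nonneg_left this (abs_nonneg _)).trans (le_of_eq ?_)
      push_cast
      ring
    refine (tsum_of_norm_bounded (hsL.mul_right ‖z - w‖).hasSum e3).trans ?_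
    rw [tsum_mul_right]
    exact mul_le_mul_of_nonneg_right
      (Real.tsum_le_of_sum_range_le (fun m => by positivity) hL) (norm_nonneg _)

end renewal

/-- A difference quotient bound on a closed disk bounds the derivative, also on the boundary. -/
theorem norm_deriv_add_le_of_closedBall {f : ℂ → ℂ} {b : ℂ} {Z L : ℝ} (hZ : 0 < Z) {z : ℂ}
    (hz : ‖z‖ ≤ Z) (hf : DifferentiableAt ℂ f z)
    (h : ∀ w : ℂ, ‖w‖ ≤ Z → ‖f w - f z + b * (w - z)‖ ≤ L * ‖w - z‖) : ‖deriv f z + b‖ ≤ L := by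
  obtain ⟨v, hv0, hv⟩ : ∃ v : ℂ, v ≠ 0 ∧ ‖z + v‖ ≤ Z := by
    by_cases h0 : z = 0
    · refine ⟨Z, by exact_mod_cast hZ.ne', ?_⟩
      rw [h0, zero_add, Complex.norm_of_nonneg hZ.le]
    · exact ⟨-z, neg_ne_zero.2 h0, by simpa using hZ.le⟩
  have hseg : ∀ t ∈ Set.Ioc (0 : ℝ) 1, ‖z + t * v‖ ≤ Z := by
    intro t ht
    have : z + t * v = ((1 - t : ℝ) : ℂ) * z + t * (z + v) := by push_cast; ring
    rw [this]
    refine (norm_add_le _ _).trans ?_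
    rw [norm_mul, norm_mul, Complex.norm_of_nonneg (by linarith [ht.2]),
      Complex.norm_of_nonneg ht.1.le]
    nlinarith [mul_le_mul_of_nonneg_left hz (sub_nonneg.2 ht.2),
      mul_le_mul_of_nonneg_left hv ht.1.le]
  have hslope := (hf.hasDerivAt.add ((hasDerivAt_id z).const_mul b)).tendsto_slope
  have hpath : Filter.Tendsto (fun t : ℝ => z + t * v) (nhdsWithin 0 (Set.Ioi 0))
      (nhdsWithin z {z}ᶜ) := by
    refine tendsto_nhdsWithin_iff.2 ⟨?_, ?_⟩
    · have hc : Continuous fun t : ℝ => z + t * v := by fun_prop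
      simpa using (hc.tendsto 0).mono_left nhdsWithin_le_nhds
    · filter_upwards [self_mem_nhdsWithin] with t ht
      have ht' : (t : ℂ) ≠ 0 := by exact_mod_cast (Set.mem_Ioi.1 ht).ne'
      simp [ht', hv0]
  have hlim := (hslope.comp hpath).norm
  rw [mul_one] at hlim
  refine le_of_tendsto hlim ?_
  filter_upwards [Ioc_mem_nhdsGT (zero_lt_one (α := ℝ))] with t ht
  have ht' : (t : ℂ) ≠ 0 := by exact_mod_cast ht.1.ne'
  have h1 := h _ (hseg t ht)
  have h2 : z + t * v - z = t * v := by ring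
  have h3 : 0 < ‖(t : ℂ) * v‖ := norm_pos_iff.2 (mul_ne_zero ht' hv0)
  rw [Function.comp_apply, slope_def_field, h2, norm_div, div_le_iff₀ h3]
  refine le_trans (le_of_eq ?_) (h1.trans (by rw [h2]))
  congr 1
  simp only [Pi.add_apply, id]
  ring

theorem prod_filter_lt_eq_pairProd (u : ℕ → ℕ → ℝ) (n : ℕ) :
    ∏ p ∈ (range (n + 1) ×ˢ range (n + 1)).filter (fun p => p.1 < p.2), u p.1 p.2 =
      pairProd u 0 n := by
  unfold pairProd
  rw [Finset.prod_sigma']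
  refine Finset.prod_bij' (fun p _ => ⟨p.2, p.1⟩) (fun q _ => (q.2, q.1)) ?_ ?_
    (fun _ _ => rfl) (fun _ _ => rfl) (fun _ _ => rfl)
  · rintro ⟨s, t⟩ h
    simp only [mem_filter, mem_product, mem_range] at h
    simp only [mem_sigma, mem_Ioc, mem_Ico]
    omega
  · rintro ⟨t, s⟩ h
    simp only [mem_sigma, mem_Ioc, mem_Ico] at h
    simp only [mem_filter, mem_product, mem_range]
    omega

theorem one_add_mul_ite_eq_selfInt {Λ : Type*} [DecidableEq Λ] (β : ℝ) (ω : ℕ → Λ) (s t : ℕ) :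
    1 + β * (if ω s = ω t then (-1 : ℝ) else 0) = selfInt β ω s t := by
  unfold selfInt
  split_ifs <;> ring

theorem wsawWeight_eq_pairProd {d : ℕ} (β : ℝ) (n : ℕ) (s : Fin n → Fin d × Bool) :
    wsawWeight β n s = pairProd (selfInt β (wsawPos s)) 0 n := by
  rw [← prod_filter_lt_eq_pairProd]
  unfold wsawWeight
  exact Finset.prod_congr rfl fun p _ => one_add_mul_ite_eq_selfInt β (wsawPos s) p.1 p.2

theorem wsawWeightT_eq_pairProd {d : ℕ} (r : ℕ) (β : ℝ) (n : ℕ) (s : Fin n → Fin d × Bool) :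
    wsawWeightT r β n s = pairProd (selfInt β (wsawPosT r s)) 0 n := by
  rw [← prod_filter_lt_eq_pairProd]
  unfold wsawWeightT
  exact Finset.prod_congr rfl fun p _ => one_add_mul_ite_eq_selfInt β (wsawPosT r s) p.1 p.2

theorem walkPos_torusStep {d r n : ℕ} (s : Fin n → Fin d × Bool) :
    walkPos (torusStep d r) s = wsawPosT r s := by
  funext k i
  simp [walkPos, torusStep, wsawPosT, wsawPos]

theorem cT_eq_walkTot (d r : ℕ) (β : ℝ) (n : ℕ) : cT d r β n = walkTot (torusStep d r) β 1 n := by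
  unfold cT walkTot walkSum
  rw [one_pow, one_mul]
  exact Finset.sum_congr rfl fun s _ => by rw [wsawWeightT_eq_pairProd, walkPos_torusStep]

theorem wsawWeight_nonneg {d : ℕ} {β : ℝ} (hβ : β ≤ 1) (n : ℕ) (s : Fin n → Fin d × Bool) :
    0 ≤ wsawWeight β n s := by
  rw [wsawWeight_eq_pairProd]
  exact pairProd_nonneg (selfInt_nonneg hβ _) _ _

theorem wsawWeightT_le_wsawWeight {d : ℕ} (r : ℕ) {β : ℝ} (hβ0 : 0 ≤ β) (hβ : β ≤ 1) (n : ℕ)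
    (s : Fin n → Fin d × Bool) : wsawWeightT r β n s ≤ wsawWeight β n s := by
  rw [wsawWeight_eq_pairProd, wsawWeightT_eq_pairProd]
  unfold pairProd
  refine Finset.prod_le_prod (fun _ _ => Finset.prod_nonneg fun _ _ => selfInt_nonneg hβ _ _ _)
    fun t _ => Finset.prod_le_prod (fun _ _ => selfInt_nonneg hβ _ _ _) fun u _ => ?_
  by_cases h : wsawPos s u = wsawPos s t
  · have h' : wsawPosT r s u = wsawPosT r s t := by
      unfold wsawPosT
      rw [h]
    simp [selfInt, h, h']
  · have : selfInt β (wsawPos s) u t = 1 := by simp [selfInt, h]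
    rw [this]
    exact selfInt_le_one hβ0 _ _ _

theorem cT_nonneg (d r : ℕ) {β : ℝ} (hβ : β ≤ 1) (n : ℕ) : 0 ≤ cT d r β n := by
  rw [cT_eq_walkTot]
  exact walkTot_nonneg _ hβ zero_le_one n

theorem cT_le_cZ (d r : ℕ) {β : ℝ} (hβ0 : 0 ≤ β) (hβ : β ≤ 1) (n : ℕ) : cT d r β n ≤ cZ d β n :=
  Finset.sum_le_sum fun s _ => wsawWeightT_le_wsawWeight r hβ0 hβ n s

theorem abs_wsawStep_le_one {d : ℕ} (ε : Fin d × Bool) (i : Fin d) : |wsawStep d ε i| ≤ 1 := by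
  unfold wsawStep
  split_ifs <;> simp

theorem abs_wsawPos_sub_le {d n : ℕ} (s : Fin n → Fin d × Bool) {u t : ℕ} (h : u ≤ t) (i : Fin d) :
    |wsawPos s t i - wsawPos s u i| ≤ n := by
  have h1 : wsawPos s t i - wsawPos s u i =
      ∑ j : Fin n, if u ≤ (j : ℕ) ∧ (j : ℕ) < t then wsawStep d (s j) i else 0 := by
    unfold wsawPos
    rw [Finset.sum_apply, Finset.sum_apply, Finset.sum_filter, Finset.sum_filter,
      ← Finset.sum_sub_distrib]
    refine Finset.sum_congr rfl fun j _ => ?_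
    split_ifs <;> omega
  rw [h1]
  refine (Finset.abs_sum_le_sum_abs _ _).trans ?_
  calc _ ≤ ∑ j : Fin n, (1 : ℤ) := Finset.sum_le_sum fun j _ => by
        split_ifs
        · exact abs_wsawStep_le_one _ _
        · simp
    _ = n := by simp

theorem wsawPos_eq_of_wsawPosT_eq {d n r : ℕ} (hr : n < r) (s : Fin n → Fin d × Bool) {u t : ℕ}
    (h : u ≤ t) (heq : wsawPosT r s u = wsawPosT r s t) : wsawPos s u = wsawPos s t := by
  funext i
  have h1 : ((wsawPos s u i : ℤ) : ZMod r) = (wsawPos s t i : ℤ) := congrFun heq i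
  rw [ZMod.intCast_eq_intCast_iff_dvd_sub] at h1
  have h2 := Int.eq_zero_of_abs_lt_dvd h1
    (lt_of_le_of_lt (abs_wsawPos_sub_le s h i) (by exact_mod_cast hr))
  linarith

theorem cT_eq_cZ (d : ℕ) {r n : ℕ} (hr : n < r) (β : ℝ) : cT d r β n = cZ d β n := by
  refine Finset.sum_congr rfl fun s _ => ?_
  rw [wsawWeight_eq_pairProd, wsawWeightT_eq_pairProd]
  refine pairProd_congr fun u t _ hut _ => ?_
  have : wsawPosT r s u = wsawPosT r s t ↔ wsawPos s u = wsawPos s t :=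
    ⟨wsawPos_eq_of_wsawPosT_eq hr s hut.le, fun h => by unfold wsawPosT; rw [h]⟩
  simp [selfInt, this]

theorem cZ_nonneg (d : ℕ) {β : ℝ} (hβ : β ≤ 1) (n : ℕ) : 0 ≤ cZ d β n :=
  Finset.sum_nonneg fun s _ => wsawWeight_nonneg hβ n s

theorem one_le_cZ {d : ℕ} (hd : 0 < d) {β : ℝ} (hβ : β ≤ 1) (n : ℕ) : 1 ≤ cZ d β n := by
  set s₀ : Fin n → Fin d × Bool := fun _ => (⟨0, hd⟩, true) with hs₀
  have h1 : ∀ k ≤ n, wsawPos s₀ k ⟨0, hd⟩ = k := by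
    intro k hk
    have h2 : (univ.filter fun j : Fin n => (j : ℕ) < k).card = k := by
      rw [Fin.card_filter_val_lt, min_eq_right hk]
    unfold wsawPos
    rw [Finset.sum_apply]
    simp [wsawStep, hs₀, h2]
  have h3 : wsawWeight β n s₀ = 1 := by
    rw [wsawWeight_eq_pairProd]
    refine Finset.prod_eq_one fun t ht => Finset.prod_eq_one fun u hu => ?_
    rw [mem_Ioc] at ht
    rw [mem_Ico] at hu
    have h4 : wsawPos s₀ u ≠ wsawPos s₀ t := by
      intro h
      have h5 := congrFun h ⟨0, hd⟩
      rw [h1 u (by omega), h1 t ht.2] at h5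
      have : u = t := by exact_mod_cast h5
      omega
    simp [selfInt, h4]
  rw [← h3]
  exact Finset.single_le_sum (f := fun s => wsawWeight β n s)
    (fun s _ => wsawWeight_nonneg hβ n s) (mem_univ s₀)

theorem cZ_le_pow (d : ℕ) {β : ℝ} (hβ0 : 0 ≤ β) (hβ : β ≤ 1) (n : ℕ) :
    cZ d β n ≤ (2 * d) ^ n := by
  have h : ∀ s : Fin n → Fin d × Bool, wsawWeight β n s ≤ 1 := by
    intro s
    rw [wsawWeight_eq_pairProd]
    exact Finset.prod_le_one (fun _ _ => Finset.prod_nonneg fun _ _ => selfInt_nonneg hβ _ _ _)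
      fun t _ => Finset.prod_le_one (fun _ _ => selfInt_nonneg hβ _ _ _)
        fun u _ => selfInt_le_one hβ0 _ _ _
  refine (Finset.sum_le_sum fun s _ => h s).trans (le_of_eq ?_)
  simp
  ring

theorem one_le_of_hasGrowthConst {d : ℕ} (hd : 0 < d) {β μ : ℝ} (hβ : β ≤ 1)
    (hμ : HasGrowthConst d β μ) : 1 ≤ μ :=
  ge_of_tendsto' hμ fun n => Real.one_le_rpow (one_le_cZ hd hβ n) (by positivity)

theorem le_of_hasGrowthConst {d : ℕ} {β μ : ℝ} (hβ0 : 0 ≤ β) (hβ : β ≤ 1)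
    (hμ : HasGrowthConst d β μ) : μ ≤ 2 * d := by
  refine le_of_tendsto hμ ?_
  filter_upwards [Filter.eventually_ne_atTop 0] with n hn
  calc _ ≤ ((2 * d : ℝ) ^ n) ^ ((n : ℝ)⁻¹) :=
        Real.rpow_le_rpow (cZ_nonneg d hβ n) (cZ_le_pow d hβ0 hβ n) (by positivity)
    _ = 2 * d := Real.pow_rpow_inv_natCast (by positivity) hn

theorem summable_cZ_mul_pow {d : ℕ} {β μ z : ℝ} (hβ : β ≤ 1) (hμ1 : 0 < μ)
    (hμ : HasGrowthConst d β μ) (hz : 0 ≤ z) (hzμ : z < μ⁻¹) :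
    Summable fun n => cZ d β n * z ^ n := by
  have h1 : z * μ < 1 := (lt_div_iff₀ hμ1).1 (by rwa [one_div])
  obtain ⟨ρ, hρ1, hρ2⟩ := exists_between h1
  have hρ0 : 0 ≤ ρ := (mul_nonneg hz hμ1.le).trans hρ1.le
  have h2 : ∀ᶠ n : ℕ in Filter.atTop, z * cZ d β n ^ ((n : ℝ)⁻¹) < ρ :=
    (hμ.const_mul z).eventually_lt_const hρ1
  refine Summable.of_norm_bounded_eventually_nat (summable_geometric_of_lt_one hρ0 hρ2) ?_
  filter_upwards [h2, Filter.eventually_ne_atTop 0] with n hn hn0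
  have h0 := cZ_nonneg d hβ n
  rw [Real.norm_of_nonneg (by positivity)]
  have h3 : (cZ d β n ^ ((n : ℝ)⁻¹)) ^ n = cZ d β n := Real.rpow_inv_natCast_pow h0 hn0
  calc cZ d β n * z ^ n = (z * cZ d β n ^ ((n : ℝ)⁻¹)) ^ n := by rw [mul_pow, h3, mul_comm]
    _ ≤ ρ ^ n := pow_le_pow_left₀ (by positivity) hn.le n

/-- The bound on the torus bubble sum divided by the volume. -/
noncomputable def bubbleConst (d : ℕ) : ℝ := (d : ℝ) ^ 2 * 10 ^ d

/-- The Lipschitz constant of the reciprocal susceptibility divided by `β`. -/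
noncomputable def lipConst (d : ℕ) : ℝ := 16 * (4 + 16 * bubbleConst d) * (2 * d)

theorem bubbleConst_nonneg (d : ℕ) : 0 ≤ bubbleConst d := by
  unfold bubbleConst
  positivity

/-- As long as the torus susceptibility is at most of the order of the square root of the volume,
its reciprocal is nearly affine. -/
theorem chiT_inv_sub_inv {d r : ℕ} (hd : 4 < d) (hr : 3 ≤ r) {β Z : ℝ} (hβ0 : 0 ≤ β) (hβ : β ≤ 1)
    (hβK : 40000 * β * (4 + 16 * bubbleConst d) ≤ 1) (hZ : 0 < Z)
    (hs : Summable fun n => cT d r β n * Z ^ n)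
    (hχ : (∑' n, cT d r β n * Z ^ n) ^ 2 ≤ 4 * (r : ℝ) ^ d) :
    (∀ z : ℂ, ‖z‖ ≤ Z → chiT d r β z ≠ 0) ∧
      ∀ z w : ℂ, ‖z‖ ≤ Z → ‖w‖ ≤ Z →
        ‖(chiT d r β z)⁻¹ - (chiT d r β w)⁻¹ + 2 * d * (z - w)‖ ≤ lipConst d * β * ‖z - w‖ := by
  have : NeZero r := ⟨by omega⟩
  have hcard : (Fintype.card (Fin d → ZMod r) : ℝ) = (r : ℝ) ^ d := by
    rw [Fintype.card_fun, ZMod.card, Fintype.card_fin]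
    push_cast
    rfl
  have hE : (Fintype.card (Fin d × Bool) : ℝ) = 2 * d := by
    rw [Fintype.card_prod, Fintype.card_bool, Fintype.card_fin]
    push_cast
    ring
  have hwalk : walkTot (torusStep d r) β Z = fun n => cT d r β n * Z ^ n := funext fun n => by
    rw [walkTot_eq_pow_mul, cT_eq_walkTot, mul_comm]
  have hne := torusStep_ne_zero (d := d) (r := r) (by omega)
  have hL := sum_length_mul_abs_laceTot_le (torusStep d r) hβ0 hβ hZ hne
    (torusStep_flipStep d r) (fun k hk => charGap_torusStep_pos (by omega) hk)
    (sum_charGap_torusStep_le hd) (bubbleConst_nonneg d) hβK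
    (by rwa [hwalk]) (by rwa [hwalk, hcard])
  have hmain := renewal_inv_sub_inv (a := cT d r β)
    (p := fun m => laceTot (torusStep d r) β 1 (m + 1)) (cT_nonneg d r hβ)
    (by rw [cT_eq_walkTot, walkTot_zero])
    (fun n => by simp only [cT_eq_walkTot, walkTot_succ]) hZ hs hL
  have hp0 : laceTot (torusStep d r) β 1 (0 + 1) = 2 * d := by
    rw [zero_add, laceTot_one _ hne, hE, one_mul]
  refine ⟨hmain.1, fun z w hz hw => ?_⟩
  have := hmain.2 z w hz hw
  rw [hp0, hE] at this
  unfold chiT lipConst bubbleConst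
  push_cast at this
  refine this.trans (le_of_eq ?_)
  ring

theorem chiT_ofReal (d r : ℕ) (β x : ℝ) : chiT d r β x = (chiTR d r β x : ℂ) := by
  unfold chiT chiTR
  rw [Complex.ofReal_tsum]
  push_cast
  rfl

theorem summable_cT_mul_pow {d r : ℕ} {β z : ℝ} (hβ0 : 0 ≤ β) (hβ : β ≤ 1) (hz : 0 ≤ z)
    (hs : Summable fun n => cZ d β n * z ^ n) : Summable fun n => cT d r β n * z ^ n :=
  Summable.of_nonneg_of_le (fun n => mul_nonneg (cT_nonneg d r hβ n) (pow_nonneg hz n))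
    (fun n => mul_le_mul_of_nonneg_right (cT_le_cZ d r hβ0 hβ n) (pow_nonneg hz n)) hs

theorem chiTR_le_chiR {d r : ℕ} {β z : ℝ} (hβ0 : 0 ≤ β) (hβ : β ≤ 1) (hz : 0 ≤ z)
    (hs : Summable fun n => cZ d β n * z ^ n) : chiTR d r β z ≤ chiR d β z :=
  (summable_cT_mul_pow hβ0 hβ hz hs).tsum_le_tsum
    (fun n => mul_le_mul_of_nonneg_right (cT_le_cZ d r hβ0 hβ n) (pow_nonneg hz n)) hs

theorem one_le_chiTR {d r : ℕ} {β z : ℝ} (hβ : β ≤ 1) (hz : 0 ≤ z)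
    (hs : Summable fun n => cT d r β n * z ^ n) : 1 ≤ chiTR d r β z := by
  have h := hs.le_tsum 0 fun n _ => mul_nonneg (cT_nonneg d r hβ n) (pow_nonneg hz n)
  rwa [cT_eq_walkTot, walkTot_zero, one_mul, pow_zero] at h

/-- Comparison of the reciprocal torus susceptibility at two real points. -/
theorem mul_sub_le_inv_chiTR {d r : ℕ} (hd : 4 < d) (hr : 3 ≤ r) {β z Z : ℝ} (hβ0 : 0 ≤ β)
    (hβ : β ≤ 1) (hβK : 40000 * β * (4 + 16 * bubbleConst d) ≤ 1) (hβL : lipConst d * β ≤ d)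
    (hz : 0 ≤ z) (hzZ : z < Z) (hs : Summable fun n => cT d r β n * Z ^ n)
    (hχ : chiTR d r β Z ^ 2 ≤ 4 * (r : ℝ) ^ d) :
    d * (Z - z) ≤ (chiTR d r β z)⁻¹ := by
  have hZ : 0 < Z := hz.trans_lt hzZ
  have h := (chiT_inv_sub_inv hd hr hβ0 hβ hβK hZ hs hχ).2 z Z
    (by rw [Complex.norm_of_nonneg hz]; exact hzZ.le) (by rw [Complex.norm_of_nonneg hZ.le])
  rw [chiT_ofReal, chiT_ofReal] at h
  have h1 : ((chiTR d r β z : ℂ))⁻¹ - ((chiTR d r β Z : ℂ))⁻¹ + 2 * d * (z - Z) =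
      (((chiTR d r β z)⁻¹ - (chiTR d r β Z)⁻¹ + 2 * d * (z - Z) : ℝ) : ℂ) := by
    push_cast
    rfl
  have h2 : (z : ℂ) - Z = ((z - Z : ℝ) : ℂ) := by
    push_cast
    rfl
  rw [h1, h2, Complex.norm_real, Complex.norm_real, Real.norm_eq_abs, Real.norm_eq_abs,
    abs_of_neg (sub_neg.2 hzZ)] at h
  have h3 := (abs_le.1 h).1
  have h4 : 0 < (chiTR d r β Z)⁻¹ := inv_pos.2 (zero_lt_one.trans_le (one_le_chiTR hβ hZ.le hs))
  have h5 := mul_le_mul_of_nonneg_right hβL (sub_nonneg.2 hzZ.le)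
  linarith

/-- The susceptibility on `ℤ^d` diverges at most linearly at the critical point. -/
theorem mul_sub_mul_chiR_le_one {d : ℕ} (hd : 4 < d) {β μ z : ℝ} (hβ0 : 0 ≤ β) (hβ : β ≤ 1)
    (hβK : 40000 * β * (4 + 16 * bubbleConst d) ≤ 1) (hβL : lipConst d * β ≤ d)
    (hμ : HasGrowthConst d β μ) (hz : 0 ≤ z) (hzμ : z < μ⁻¹) :
    d * (μ⁻¹ - z) * chiR d β z ≤ 1 := by
  have hμ0 : 0 < μ := zero_lt_one.trans_le (one_le_of_hasGrowthConst (by omega) hβ hμ)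
  have hs := summable_cZ_mul_pow hβ hμ0 hμ hz hzμ
  have key : ∀ Z, z < Z → Z < μ⁻¹ → d * (Z - z) * chiR d β z ≤ 1 := by
    intro Z hzZ hZμ
    have hZ : 0 < Z := hz.trans_lt hzZ
    have hsZ := summable_cZ_mul_pow hβ hμ0 hμ hZ.le hZμ
    have hdZ : 0 < d * (Z - z) := mul_pos (by positivity) (sub_pos.2 hzZ)
    rw [mul_comm, ← le_div_iff₀ hdZ, one_div]
    refine Real.tsum_le_of_sum_range_le
      (fun n => mul_nonneg (cZ_nonneg d hβ n) (pow_nonneg hz n)) fun M => ?_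
    obtain ⟨N, hN⟩ := exists_nat_gt (chiR d β Z ^ 2)
    set r := max 3 (max M N) with hr
    have hr3 : 3 ≤ r := le_max_left _ _
    have hrM : M ≤ r := (le_max_left _ _).trans (le_max_right _ _)
    have hrN : (N : ℝ) ≤ r := by exact_mod_cast (le_max_right M N).trans (le_max_right _ _)
    have hsT := summable_cT_mul_pow (r := r) hβ0 hβ hZ.le hsZ
    have hsz := summable_cT_mul_pow (r := r) hβ0 hβ hz hs
    have h0 : 0 ≤ chiTR d r β Z := zero_le_one.trans (one_le_chiTR hβ hZ.le hsT)
    have hr1 : (1 : ℝ) ≤ r := by exact_mod_cast (by omega : 1 ≤ r)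
    have h1 : chiTR d r β Z ^ 2 ≤ 4 * (r : ℝ) ^ d := by
      have h2 := pow_le_pow_left₀ h0 (chiTR_le_chiR (r := r) hβ0 hβ hZ.le hsZ) 2
      have h3 : (r : ℝ) ≤ (r : ℝ) ^ d := le_self_pow₀ hr1 (by omega)
      linarith
    have h4 := mul_sub_le_inv_chiTR hd hr3 hβ0 hβ hβK hβL hz hzZ hsT h1
    have h5 : chiTR d r β z ≤ (d * (Z - z))⁻¹ := by
      rw [← inv_inv (chiTR d r β z)]
      exact inv_anti₀ hdZ h4
    refine le_trans ?_ h5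
    calc _ = ∑ n ∈ range M, cT d r β n * z ^ n := Finset.sum_congr rfl fun n hn => by
          rw [cT_eq_cZ d (lt_of_lt_of_le (mem_range.1 hn) hrM)]
      _ ≤ _ := hsz.sum_le_tsum _ fun n _ => mul_nonneg (cT_nonneg d r hβ n) (pow_nonneg hz n)
  have hlim : Filter.Tendsto (fun Z => d * (Z - z) * chiR d β z) (nhdsWithin μ⁻¹ (Set.Iio μ⁻¹))
      (nhds (d * (μ⁻¹ - z) * chiR d β z)) := by
    have hc : Continuous fun Z : ℝ => d * (Z - z) * chiR d β z := by fun_prop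
    exact (hc.tendsto _).mono_left nhdsWithin_le_nhds
  refine le_of_tendsto hlim ?_
  filter_upwards [Ioo_mem_nhdsLT hzμ] with Z hZ
  exact key Z hZ.1 hZ.2

theorem differentiableAt_chiT {d r : ℕ} {β ρ : ℝ} (hβ : β ≤ 1)
    (hs : Summable fun n => cT d r β n * ρ ^ n) {z : ℂ} (hz : ‖z‖ < ρ) :
    DifferentiableAt ℂ (chiT d r β) z := by
  have h := Complex.differentiableOn_tsum_of_summable_norm (U := Metric.ball (0 : ℂ) ρ)
    (F := fun n w => (cT d r β n : ℂ) * w ^ n) hs (fun n => by fun_prop) Metric.isOpen_ball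
    fun n w hw => by
      rw [norm_mul, norm_pow, Complex.norm_of_nonneg (cT_nonneg d r hβ n)]
      exact mul_le_mul_of_nonneg_left
        (pow_le_pow_left₀ (norm_nonneg _) (mem_ball_zero_iff.1 hw).le n) (cT_nonneg d r hβ n)
  exact h.differentiableAt (Metric.isOpen_ball.mem_nhds (mem_ball_zero_iff.2 hz))

/-- The bound `χ^𝕋 ≤ 2 V^{1/2}` at the point `z_c (1 - V^{-1/2})`. -/
theorem chiTR_sq_le {d r : ℕ} (hd : 4 < d) {β μ : ℝ} (hβ0 : 0 ≤ β) (hβ : β ≤ 1)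
    (hβK : 40000 * β * (4 + 16 * bubbleConst d) ≤ 1) (hβL : lipConst d * β ≤ d)
    (hμ : HasGrowthConst d β μ) {v : ℝ} (hv : 1 < v) (hv2 : v ^ 2 = (r : ℝ) ^ d) :
    chiTR d r β (μ⁻¹ * (1 - v⁻¹)) ^ 2 ≤ 4 * (r : ℝ) ^ d := by
  have hμ0 : 0 < μ := zero_lt_one.trans_le (one_le_of_hasGrowthConst (by omega) hβ hμ)
  have hv0 : 0 < v := zero_lt_one.trans hv
  have hvi : v⁻¹ < 1 := inv_lt_one_of_one_lt₀ hv
  have hvi0 : 0 < v⁻¹ := inv_pos.2 hv0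
  have hμi : 0 < μ⁻¹ := inv_pos.2 hμ0
  set ζ := μ⁻¹ * (1 - v⁻¹) with hζ
  have hζ0 : 0 < ζ := mul_pos hμi (by linarith)
  have hζμ : ζ < μ⁻¹ := by nlinarith
  have hs := summable_cZ_mul_pow hβ hμ0 hμ hζ0.le hζμ
  have h1 := mul_sub_mul_chiR_le_one hd hβ0 hβ hβK hβL hμ hζ0.le hζμ
  have h2 := chiTR_le_chiR (r := r) hβ0 hβ hζ0.le hs
  have h3 : 0 ≤ chiTR d r β ζ :=
    zero_le_one.trans (one_le_chiTR hβ hζ0.le (summable_cT_mul_pow hβ0 hβ hζ0.le hs))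
  have hd0 : (0 : ℝ) < d := by positivity
  have h4 : μ⁻¹ - ζ = μ⁻¹ * v⁻¹ := by rw [hζ]; ring
  have h5 : chiTR d r β ζ ≤ 2 * v := by
    refine h2.trans ?_
    rw [h4] at h1
    have h6 : (d : ℝ) * (μ⁻¹ * v⁻¹) * chiR d β ζ * (μ * v) = d * chiR d β ζ := by
      field_simp
    have h7 := mul_le_mul_of_nonneg_right h1 (mul_pos hμ0 hv0).le
    rw [h6, one_mul] at h7
    have h8 := mul_le_mul_of_nonneg_right (le_of_hasGrowthConst hβ0 hβ hμ) hv0.le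
    refine le_of_mul_le_mul_left (h7.trans (h8.trans (le_of_eq ?_))) hd0
    ring
  calc chiTR d r β ζ ^ 2 ≤ (2 * v) ^ 2 := pow_le_pow_left₀ h3 h5 2
    _ = 4 * (r : ℝ) ^ d := by rw [mul_pow, hv2]; norm_num

theorem mul_norm_one_sub_div_le {d : ℕ} {ζ L a : ℝ} {b : ℂ} (hζ : 0 < ζ) (hL : L ≤ d)
    (hdζ : 1 / 3 ≤ d * ζ) (ha : 0 ≤ a) {z : ℂ} (hz : ‖z‖ ≤ ζ)
    (h : ‖b - a + 2 * d * (z - ζ)‖ ≤ L * ‖z - ζ‖) : 1 / 3 * ‖1 - z / (ζ : ℂ)‖ ≤ ‖b‖ := by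
  have hζ' : (ζ : ℂ) ≠ 0 := by exact_mod_cast hζ.ne'
  have h1 : ‖(1 : ℂ) - z / ζ‖ = ‖z - ζ‖ / ζ := by
    rw [← Complex.norm_of_nonneg hζ.le, ← norm_div, ← norm_neg, Complex.norm_of_nonneg hζ.le]
    congr 1
    field_simp
    ring
  have h2 : 2 * d * ‖z - ζ‖ ≤ ‖(a : ℂ) - 2 * d * (z - ζ)‖ := by
    have hre : z.re ≤ ζ := (Complex.re_le_norm z).trans hz
    have hd0 : (0 : ℝ) ≤ d := Nat.cast_nonneg d
    have e1 : ‖(a : ℂ) - 2 * d * (z - ζ)‖ ^ 2 =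
        (a + 2 * d * (ζ - z.re)) ^ 2 + (2 * d * z.im) ^ 2 := by
      rw [Complex.sq_norm, Complex.normSq_apply]
      simp
      ring
    have e2 : (2 * d * ‖z - ζ‖) ^ 2 = (2 * d * (ζ - z.re)) ^ 2 + (2 * d * z.im) ^ 2 := by
      rw [mul_pow, Complex.sq_norm, Complex.normSq_apply]
      simp
      ring
    refine (sq_le_sq₀ (by positivity) (norm_nonneg _)).1 ?_
    rw [e1, e2]
    have : 0 ≤ 2 * d * (ζ - z.re) := mul_nonneg (by positivity) (sub_nonneg.2 hre)
    gcongr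
    linarith
  have h3 : ‖(a : ℂ) - 2 * d * (z - ζ)‖ ≤ ‖b‖ + ‖b - a + 2 * d * (z - ζ)‖ := by
    have : (a : ℂ) - 2 * d * (z - ζ) = b - (b - a + 2 * d * (z - ζ)) := by ring
    rw [this]
    exact norm_sub_le _ _
  have h4 := mul_le_mul_of_nonneg_right hL (norm_nonneg (z - ζ))
  rw [h1, mul_div_assoc', div_le_iff₀ hζ]
  have h5 : d * ‖z - ζ‖ ≤ ‖b‖ := by linarith
  have h6 := mul_le_mul_of_nonneg_right h5 hζ.le
  have h7 := mul_le_mul_of_nonneg_right hdζ (norm_nonneg (z - ζ))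
  linarith

end laceExpansion

/-- properties of `φ = 1/χ^𝕋` on the torus for `d > 4` and small `β`:
`χ^𝕋 ≠ 0` on the closed disk `|z| ≤ ζ = z_c(1 - V^{-1/2})`, `φ' = -2d + O(β)` there,
and `|φ(z)| ≥ c|1 - z/ζ|` there. -/
theorem statement10 (d : ℕ) (hd : 4 < d) :
    ∃ β0 c C : ℝ, 0 < β0 ∧ 0 < c ∧ 0 < C ∧
      ∀ β : ℝ, 0 < β → β ≤ β0 →
        ∀ μ : ℝ, HasGrowthConst d β μ →
          ∀ r : ℕ, 3 ≤ r →
            (∀ z : ℂ, ‖z‖ ≤ μ⁻¹ * (1 - (Real.sqrt ((r : ℝ) ^ d))⁻¹) →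
              chiT d r β z ≠ 0) ∧
            (∀ z : ℂ, ‖z‖ ≤ μ⁻¹ * (1 - (Real.sqrt ((r : ℝ) ^ d))⁻¹) →
              ‖deriv (fun w => (chiT d r β w)⁻¹) z + 2 * (d : ℂ)‖ ≤ C * β) ∧
            (∀ z : ℂ, ‖z‖ ≤ μ⁻¹ * (1 - (Real.sqrt ((r : ℝ) ^ d))⁻¹) →
              c * ‖1 - z / ((μ⁻¹ * (1 - (Real.sqrt ((r : ℝ) ^ d))⁻¹) : ℝ) : ℂ)‖ ≤
                ‖(chiT d r β z)⁻¹‖) := by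
  have hd0 : (0 : ℝ) < d := by positivity
  have hK0 := bubbleConst_nonneg d
  have hL0 : 0 < lipConst d := by
    unfold lipConst
    positivity
  set M : ℝ := 40000 * (4 + 16 * bubbleConst d) + lipConst d with hM
  have hM0 : 1 ≤ M := by linarith
  refine ⟨M⁻¹, 1 / 3, lipConst d, by positivity, by norm_num, hL0, ?_⟩
  intro β hβ0 hβM μ hμ r hr
  have hβM' : β * M ≤ 1 := by
    calc β * M ≤ M⁻¹ * M := mul_le_mul_of_nonneg_right hβM (by linarith)
      _ = 1 := inv_mul_cancel₀ (by linarith)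
  have hβ : β ≤ 1 := by nlinarith
  have hβK : 40000 * β * (4 + 16 * bubbleConst d) ≤ 1 := by nlinarith
  have hd5 : (5 : ℝ) ≤ d := by exact_mod_cast hd
  have hβL : lipConst d * β ≤ d := by nlinarith [mul_nonneg hβ0.le hK0]
  have hμ1 := one_le_of_hasGrowthConst (by omega) hβ hμ
  have hμ2 := le_of_hasGrowthConst hβ0.le hβ hμ
  have hμ0 : 0 < μ := by linarith
  set v : ℝ := Real.sqrt ((r : ℝ) ^ d) with hv
  have hv2 : v ^ 2 = (r : ℝ) ^ d := Real.sq_sqrt (by positivity)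
  have hr3 : (3 : ℝ) ≤ r := by exact_mod_cast hr
  have hv3 : 3 ≤ v := by
    refine Real.le_sqrt_of_sq_le ?_
    calc (3 : ℝ) ^ 2 ≤ (r : ℝ) ^ 2 := by gcongr
      _ ≤ (r : ℝ) ^ d := pow_le_pow_right₀ (by linarith) (by omega)
  have hvi : v⁻¹ ≤ 1 / 3 := by
    rw [one_div]
    exact inv_anti₀ (by norm_num) hv3
  have hvi0 : 0 < v⁻¹ := inv_pos.2 (by linarith)
  have hμi : 0 < μ⁻¹ := inv_pos.2 hμ0
  have hχ := chiTR_sq_le hd hβ0.le hβ hβK hβL hμ (by linarith : 1 < v) hv2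
  set ζ : ℝ := μ⁻¹ * (1 - v⁻¹) with hζ
  have hζ0 : 0 < ζ := mul_pos hμi (by linarith)
  have hζμ : ζ < μ⁻¹ := by nlinarith
  have hdζ : 1 / 3 ≤ d * ζ := by
    have h1 : 1 / 2 ≤ d * μ⁻¹ := by
      rw [← div_eq_mul_inv, le_div_iff₀ hμ0]
      linarith
    rw [hζ, ← mul_assoc]
    nlinarith
  have hs := summable_cT_mul_pow (r := r) hβ0.le hβ hζ0.le
    (summable_cZ_mul_pow hβ hμ0 hμ hζ0.le hζμ)
  obtain ⟨hne, hlip⟩ := chiT_inv_sub_inv hd hr hβ0.le hβ hβK hζ0 hs hχ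
  obtain ⟨ρ, hρ1, hρ2⟩ := exists_between hζμ
  have hsρ := summable_cT_mul_pow (r := r) hβ0.le hβ (hζ0.trans hρ1).le
    (summable_cZ_mul_pow hβ hμ0 hμ (hζ0.trans hρ1).le hρ2)
  refine ⟨hne, fun z hz => ?_, fun z hz => ?_⟩
  · exact norm_deriv_add_le_of_closedBall hζ0 hz
      ((differentiableAt_chiT hβ hsρ (hz.trans_lt hρ1)).inv (hne z hz))
      fun w hw => hlip w z hw hz
  · have h := hlip z ζ hz (by rw [Complex.norm_of_nonneg hζ0.le])
    rw [chiT_ofReal, ← Complex.ofReal_inv] at h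
    exact mul_norm_one_sub_div_le hζ0 hβL hdζ
      (inv_nonneg.2 (zero_le_one.trans (one_le_chiTR hβ hζ0.le hs))) hz h
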